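/- Let K be a continuous, symmetric coagulation kernel satisfying the power-law bounds with exponents α, β, and let r be an admissible fusion kernel. Assume f_in is a nonnegative Radon measure on (0,∞)² supported in {a ≥ c₀ v^{2/3}} with ∫ (v^{−1} + v² + a) df_in(a,v) < ∞. Let T > 0 and fix ε ∈ (0,1). Then there exists a weak solution f_ε ∈ C([0,T]; 𝓜^I₊) of the ε-fusion coagulation problem with initial datum f_in such that sup_{t∈[0,T]} ∫ (v^{−1} + v² + a) df_ε(t)(a,v) ≤ C(T) for some constant C(T) > 0. -/

import Mathlib

open MeasureTheory Real Set Filter Topology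
open scoped ENNReal

noncomputable section

/-- `c₀ = (36π)^(1/3)`, the isoperimetric constant relating area and volume of a ball. -/
def c0 : ℝ := (36 * Real.pi) ^ ((1 : ℝ) / 3)

/-- The open quadrant `(0,∞)²` of pairs `(a,v)` (surface area, volume). -/
def Quad : Set (ℝ × ℝ) := {p | 0 < p.1 ∧ 0 < p.2}

/-- The isoperimetric region `{(a,v) : v > 0, a ≥ c₀ v^(2/3)}`. -/
def IsoRegion : Set (ℝ × ℝ) := {p | 0 < p.2 ∧ c0 * p.2 ^ ((2 : ℝ) / 3) ≤ p.1}

/-- A nonnegative (Radon) measure on `(0,∞)²` supported in `{a ≥ c₀ v^(2/3)}`: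
it gives zero mass to the complement of the isoperimetric region. -/
def IsIsoMeasure (m : Measure (ℝ × ℝ)) : Prop := m IsoRegionᶜ = 0

/-- `C₀((0,∞)²)`: continuous functions vanishing at infinity of the open quadrant
(extended by zero outside the quadrant). -/
def IsC0Quad (φ : ℝ × ℝ → ℝ) : Prop :=
  Continuous φ ∧ (∀ p, p ∉ Quad → φ p = 0) ∧
    ∀ δ > 0, ∃ Kc : Set (ℝ × ℝ), IsCompact Kc ∧ Kc ⊆ Quad ∧ ∀ p ∉ Kc, |φ p| ≤ δ

/-- `C_c((0,∞)²)`: continuous functions with compact support contained in the quadrant. -/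
def IsCcQuad (φ : ℝ × ℝ → ℝ) : Prop :=
  Continuous φ ∧ HasCompactSupport φ ∧ tsupport φ ⊆ Quad

/-- `C₀((0,∞))`: continuous functions on `(0,∞)` vanishing at infinity (extended by zero). -/
def IsC0Pos (φ : ℝ → ℝ) : Prop :=
  Continuous φ ∧ (∀ v, v ∉ Ioi (0 : ℝ) → φ v = 0) ∧
    ∀ δ > 0, ∃ Kc : Set ℝ, IsCompact Kc ∧ Kc ⊆ Ioi (0 : ℝ) ∧ ∀ v ∉ Kc, |φ v| ≤ δ

/-- `C_c((0,∞))`: continuous functions with compact support contained in `(0,∞)`. -/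
def IsCcPos (φ : ℝ → ℝ) : Prop :=
  Continuous φ ∧ HasCompactSupport φ ∧ tsupport φ ⊆ Ioi (0 : ℝ)

/-- Partial derivative in the area variable `a`. -/
def da (φ : ℝ × ℝ → ℝ) (p : ℝ × ℝ) : ℝ := deriv (fun a => φ (a, p.2)) p.1

/-- Time-dependent test functions `φ ∈ C¹_c([0,∞); C¹_c((0,∞)²))`. -/
def IsTestFun (ψ : ℝ × (ℝ × ℝ) → ℝ) : Prop :=
  ContDiff ℝ 1 ψ ∧ HasCompactSupport ψ ∧ ∀ q : ℝ × (ℝ × ℝ), q.2 ∉ Quad → ψ q = 0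

/-- The assumptions on the coagulation kernel `K`: continuity, symmetry, and the
two-sided power law bounds with constants `K₀ ≥ K₁ > 0` and exponents
`al > 0`, `be ∈ (0,1)`, `be - al ∈ (0,1)`. -/
structure IsCoagKernel (K : ℝ × ℝ → ℝ × ℝ → ℝ) (K₀ K₁ al be : ℝ) : Prop where
  cont : ContinuousOn (fun q : (ℝ × ℝ) × (ℝ × ℝ) => K q.1 q.2) (Quad ×ˢ Quad)
  symm : ∀ η η', K η η' = K η' η
  K1_pos : 0 < K₁
  K1_le_K0 : K₁ ≤ K₀
  al_pos : 0 < al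
  be_mem : be ∈ Ioo (0 : ℝ) 1
  be_sub_al_mem : be - al ∈ Ioo (0 : ℝ) 1
  lower : ∀ η ∈ Quad, ∀ η' ∈ Quad,
    K₁ * (η.2 ^ (-al) * η'.2 ^ be + η'.2 ^ (-al) * η.2 ^ be) ≤ K η η'
  upper : ∀ η ∈ Quad, ∀ η' ∈ Quad,
    K η η' ≤ K₀ * (η.2 ^ (-al) * η'.2 ^ be + η'.2 ^ (-al) * η.2 ^ be)

/-- The assumptions on an admissible fusion kernel `r`: positivity, `C¹` regularity,
two-sided power law bounds `R₀ a^mu v^sg ≤ r ≤ R₁ a^mu v^sg`, and the structural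
differential inequalities on the isoperimetric region. -/
structure IsFusionKernel (r : ℝ × ℝ → ℝ) (R₀ R₁ mu sg B : ℝ) : Prop where
  smooth : ContDiffOn ℝ 1 r Quad
  pos : ∀ η ∈ Quad, 0 < r η
  R0_pos : 0 < R₀
  R1_pos : 0 < R₁
  B_pos : 0 < B
  lower : ∀ η ∈ Quad, R₀ * η.1 ^ mu * η.2 ^ sg ≤ r η
  upper : ∀ η ∈ Quad, r η ≤ R₁ * η.1 ^ mu * η.2 ^ sg
  cond_pos : 0 < mu → ∀ η ∈ IsoRegion, 0 ≤ da r η - mu * η.1⁻¹ * r η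
  cond_nonpos : mu ≤ 0 → ∀ η ∈ IsoRegion,
    0 ≤ da r η * (η.1 - c0 * η.2 ^ ((2 : ℝ) / 3)) + r η
  cond_upper : ∀ η ∈ IsoRegion, da r η ≤ B * η.1⁻¹ * r η

/-- The weak identity at time `t` against the test function `ψ`, for the
fusion–coagulation equation with fusion coefficient `c` (the `Λ`-fusion problem
corresponds to `c = Λ⁻¹`). -/
def WeakIdentity (K : ℝ × ℝ → ℝ × ℝ → ℝ) (r : ℝ × ℝ → ℝ) (c : ℝ)
    (fin : Measure (ℝ × ℝ)) (f : ℝ → Measure (ℝ × ℝ))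
    (ψ : ℝ × (ℝ × ℝ) → ℝ) (t : ℝ) : Prop :=
  (∫ η, ψ (t, η) ∂(f t)) - (∫ η, ψ (0, η) ∂fin)
      - ∫ s in (0 : ℝ)..t, ∫ η, deriv (fun u => ψ (u, η)) s ∂(f s)
    = (∫ s in (0 : ℝ)..t, (1 / 2) *
        ∫ η, ∫ η', K η η' * (ψ (s, η + η') - ψ (s, η) - ψ (s, η')) ∂(f s) ∂(f s))
      + c * ∫ s in (0 : ℝ)..t,
          ∫ η, r η * (c0 * η.2 ^ ((2 : ℝ) / 3) - η.1) * da (fun p => ψ (s, p)) η ∂(f s)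

/-- A weak solution of the fusion–coagulation problem with fusion coefficient `c`
(power-law exponents `al`, `be` of the coagulation kernel enter the a priori moment
bound), initial datum `fin`: a weak-* continuous family of measures supported in the
isoperimetric region, with locally uniformly bounded `(v^(-al) + v^be)`-moments,
satisfying the weak identity for all test functions and times. -/
def IsWeakSolution (K : ℝ × ℝ → ℝ × ℝ → ℝ) (r : ℝ × ℝ → ℝ) (c al be : ℝ)
    (fin : Measure (ℝ × ℝ)) (f : ℝ → Measure (ℝ × ℝ)) : Prop :=
  (∀ t, 0 ≤ t → IsIsoMeasure (f t)) ∧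
  (∀ φ, IsC0Quad φ → ContinuousOn (fun t => ∫ η, φ η ∂(f t)) (Ici (0 : ℝ))) ∧
  (∀ T > (0 : ℝ), ∃ C : ℝ≥0∞, C ≠ ⊤ ∧ ∀ t ∈ Icc (0 : ℝ) T,
      (∫⁻ η, ENNReal.ofReal (η.2 ^ (-al) + η.2 ^ be) ∂(f t)) ≤ C) ∧
  (∀ ψ, IsTestFun ψ → ∀ t, 0 ≤ t → WeakIdentity K r c fin f ψ t)

/-- The regularized fusion kernel `r̄_ε(a,v) = r(a,v)/(1 + ε^(2μ+2) a^μ)`. -/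
def rbarFn (r : ℝ × ℝ → ℝ) (mu ε : ℝ) (η : ℝ × ℝ) : ℝ :=
  r η / (1 + ε ^ (2 * mu + 2) * η.1 ^ mu)

end

noncomputable section

/-! ### The isoperimetric region -/

lemma c0_nonneg : 0 ≤ c0 := Real.rpow_nonneg (by positivity) _

lemma two_le_c0 : 2 ≤ c0 := by
  have h : ((2 : ℝ) ^ (3 : ℝ)) ^ ((1 : ℝ) / 3) = 2 := by
    rw [← Real.rpow_mul (by norm_num)]; norm_num
  rw [← h, c0]
  have := Real.pi_gt_three
  exact Real.rpow_le_rpow (by positivity) (by norm_num; linarith) (by norm_num)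

lemma iso_fst_pos {p : ℝ × ℝ} (hp : p ∈ IsoRegion) : 0 < p.1 :=
  lt_of_lt_of_le (mul_pos (by linarith [two_le_c0]) (Real.rpow_pos_of_pos hp.1 _)) hp.2

lemma isoRegion_subset_quad : IsoRegion ⊆ Quad := fun _ hp => ⟨iso_fst_pos hp, hp.1⟩

lemma isOpen_quad : IsOpen Quad :=
  (isOpen_lt continuous_const continuous_fst).inter (isOpen_lt continuous_const continuous_snd)

lemma measurableSet_quad : MeasurableSet Quad := isOpen_quad.measurableSet

lemma measurableSet_isoRegion : MeasurableSet IsoRegion := by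
  apply MeasurableSet.inter
  · exact measurableSet_lt measurable_const measurable_snd
  · exact measurableSet_le (by fun_prop) measurable_fst

lemma iso_add {p q : ℝ × ℝ} (hp : p ∈ IsoRegion) (hq : q ∈ IsoRegion) :
    p + q ∈ IsoRegion := by
  refine ⟨add_pos hp.1 hq.1, ?_⟩
  have h := Real.rpow_add_le_add_rpow hp.1.le hq.1.le (p := (2 : ℝ) / 3) (by norm_num) (by norm_num)
  have h2 := mul_le_mul_of_nonneg_left h c0_nonneg
  have := hp.2
  have := hq.2
  simp only [Prod.fst_add, Prod.snd_add]
  linarith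

/-- A point of the isoperimetric region with `v ≥ t`, `t ≤ 1`, has area at least `2 t`. -/
lemma iso_two_mul_le_fst {p : ℝ × ℝ} (hp : p ∈ IsoRegion) {t : ℝ} (ht : 0 < t) (ht1 : t ≤ 1)
    (hpt : t ≤ p.2) : 2 * t ≤ p.1 := by
  have h1 : t ≤ t ^ ((2 : ℝ) / 3) := by
    simpa using Real.rpow_le_rpow_of_exponent_ge ht ht1 (by norm_num : (2 : ℝ) / 3 ≤ 1)
  have h2 : t ^ ((2 : ℝ) / 3) ≤ p.2 ^ ((2 : ℝ) / 3) :=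
    Real.rpow_le_rpow ht.le hpt (by norm_num)
  have h3 := hp.2
  nlinarith [two_le_c0]

/-! ### Weights -/

/-- The weight `v⁻¹ + v² + a`. -/
def weight (η : ℝ × ℝ) : ℝ := η.2 ^ (-1 : ℝ) + η.2 ^ (2 : ℝ) + η.1

/-- The weight `v^(-al) + v^be` controlling the coagulation kernel. -/
def coagWeight (al be : ℝ) (η : ℝ × ℝ) : ℝ := η.2 ^ (-al) + η.2 ^ be

lemma measurable_weight : Measurable weight := by unfold weight; fun_prop

lemma measurable_coagWeight (al be : ℝ) : Measurable (coagWeight al be) := by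
  unfold coagWeight; fun_prop

lemma inv_add_sq_ge {v : ℝ} (hv : 0 < v) :
    1 ≤ v ^ (-1 : ℝ) + v ^ (2 : ℝ) ∧ v ≤ v ^ (-1 : ℝ) + v ^ (2 : ℝ) := by
  have h1 : 0 < v ^ (-1 : ℝ) := Real.rpow_pos_of_pos hv _
  have h2 : v ^ (-1 : ℝ) * v = 1 := by
    rw [Real.rpow_neg_one]; exact inv_mul_cancel₀ hv.ne'
  have h3 : v ^ (2 : ℝ) = v * v := by norm_cast; ring
  rw [h3]
  rcases le_total v 1 with h | h
  · constructor <;> nlinarith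
  · constructor <;> nlinarith

lemma iso_one_le_weight {η : ℝ × ℝ} (h : η ∈ IsoRegion) : 1 ≤ weight η := by
  have := inv_add_sq_ge h.1
  have := iso_fst_pos h
  unfold weight; linarith

lemma iso_inv_le_weight {η : ℝ × ℝ} (h : η ∈ IsoRegion) : η.2 ^ (-1 : ℝ) ≤ weight η := by
  have := iso_fst_pos h
  have := Real.rpow_nonneg h.1.le 2
  unfold weight; linarith

lemma iso_snd_le_weight {η : ℝ × ℝ} (h : η ∈ IsoRegion) : η.2 ≤ weight η := by
  have := inv_add_sq_ge h.1
  have := iso_fst_pos h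
  unfold weight; linarith

lemma iso_fst_le_weight {η : ℝ × ℝ} (h : η ∈ IsoRegion) : η.1 ≤ weight η := by
  have := inv_add_sq_ge h.1
  unfold weight; linarith

lemma rpow_le_one_add {x θ : ℝ} (hx : 0 < x) (h0 : 0 ≤ θ) (h1 : θ ≤ 1) : x ^ θ ≤ 1 + x := by
  rcases le_total x 1 with h | h
  · have := Real.rpow_le_one hx.le h h0
    linarith
  · have := Real.rpow_le_rpow_of_exponent_le h h1
    rw [Real.rpow_one] at this
    linarith

lemma coagWeight_nonneg {al be : ℝ} {η : ℝ × ℝ} (h : η ∈ Quad) : 0 ≤ coagWeight al be η :=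
  add_nonneg (Real.rpow_nonneg h.2.le _) (Real.rpow_nonneg h.2.le _)

lemma rpow_neg_le_one_add {v al : ℝ} (hv : 0 < v) (h0 : 0 ≤ al) (h1 : al ≤ 1) :
    v ^ (-al) ≤ 1 + v ^ (-1 : ℝ) := by
  have : v ^ (-al) = (v ^ (-1 : ℝ)) ^ al := by rw [← Real.rpow_mul hv.le]; simp
  rw [this]
  exact rpow_le_one_add (Real.rpow_pos_of_pos hv _) h0 h1

lemma iso_coagWeight_le {al be : ℝ} {η : ℝ × ℝ} (h : η ∈ IsoRegion) (ha : al ∈ Icc (0 : ℝ) 1)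
    (hb : be ∈ Icc (0 : ℝ) 1) : coagWeight al be η ≤ 4 * weight η := by
  have h1 := rpow_neg_le_one_add h.1 ha.1 ha.2
  have h2 := rpow_le_one_add h.1 hb.1 hb.2
  have := iso_one_le_weight h
  have := iso_inv_le_weight h
  have := iso_snd_le_weight h
  unfold coagWeight; linarith

lemma exists_rpow_le_mul_add {θ δ : ℝ} (h0 : 0 ≤ θ) (h1 : θ < 1) (hδ : 0 < δ) :
    ∃ C, 0 ≤ C ∧ ∀ x, 0 < x → x ^ θ ≤ δ * x + C := by
  have hθ : 0 < 1 - θ := by linarith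
  set y := δ ^ (-(1 / (1 - θ))) with hy
  have hy0 : 0 < y := Real.rpow_pos_of_pos hδ _
  refine ⟨y ^ θ, Real.rpow_nonneg hy0.le _, fun x hx => ?_⟩
  rcases le_total x y with h | h
  · have := Real.rpow_le_rpow hx.le h h0
    have := mul_pos hδ hx
    linarith
  · have e1 : x ^ θ = x * x ^ (-(1 - θ)) := by
      rw [show -(1 - θ) = θ - 1 by ring, Real.rpow_sub hx, Real.rpow_one]
      field_simp
    have e2 : x ^ (-(1 - θ)) ≤ δ := by
      have := Real.rpow_le_rpow_of_nonpos hy0 h (by linarith : -(1 - θ) ≤ 0)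
      refine this.trans (le_of_eq ?_)
      rw [hy, ← Real.rpow_mul hδ.le]
      rw [show -(1 / (1 - θ)) * -(1 - θ) = 1 by field_simp]
      simp
    have := Real.rpow_nonneg hy0.le θ
    rw [e1]
    nlinarith

/-- The coagulation weight is of lower order than `weight`. -/
lemma exists_coagWeight_le {al be δ : ℝ} (ha : al ∈ Ico (0 : ℝ) 1) (hb : be ∈ Ico (0 : ℝ) 1)
    (hδ : 0 < δ) : ∃ C, 0 ≤ C ∧ ∀ η ∈ IsoRegion, coagWeight al be η ≤ δ * weight η + C := by
  obtain ⟨C1, hC1, h1⟩ := exists_rpow_le_mul_add ha.1 ha.2 hδ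
  obtain ⟨C2, hC2, h2⟩ := exists_rpow_le_mul_add (θ := be / 2) (by linarith [hb.1])
    (by linarith [hb.2]) hδ
  refine ⟨C1 + C2, add_nonneg hC1 hC2, fun η hη => ?_⟩
  have e1 : η.2 ^ (-al) = (η.2 ^ (-1 : ℝ)) ^ al := by rw [← Real.rpow_mul hη.1.le]; simp
  have e2 : η.2 ^ be = (η.2 ^ (2 : ℝ)) ^ (be / 2) := by
    rw [← Real.rpow_mul hη.1.le]; congr 1; ring
  have := h1 _ (Real.rpow_pos_of_pos hη.1 (-1))
  have := h2 _ (Real.rpow_pos_of_pos hη.1 2)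
  have := mul_pos hδ (iso_fst_pos hη)
  unfold coagWeight weight
  rw [e1, e2]
  linarith

/-! ### Cutoff functions -/

/-- A smooth function equal to `1` on `[2/R, R]` and supported in `[1/R, 2R]`. -/
def cutoffAux (R x : ℝ) : ℝ := smoothTransition (R * x - 1) * smoothTransition (2 - x / R)

/-- A smooth function equal to `1` on `[2/R, R]²` and supported in `[1/R, 2R]²`. -/
def cutoff (R : ℝ) (η : ℝ × ℝ) : ℝ := cutoffAux R η.1 * cutoffAux R η.2

lemma cutoffAux_nonneg (R x : ℝ) : 0 ≤ cutoffAux R x :=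
  mul_nonneg (smoothTransition.nonneg _) (smoothTransition.nonneg _)

lemma cutoffAux_le_one (R x : ℝ) : cutoffAux R x ≤ 1 :=
  mul_le_one₀ (smoothTransition.le_one _) (smoothTransition.nonneg _) (smoothTransition.le_one _)

lemma cutoff_nonneg (R : ℝ) (η : ℝ × ℝ) : 0 ≤ cutoff R η :=
  mul_nonneg (cutoffAux_nonneg _ _) (cutoffAux_nonneg _ _)

lemma cutoff_le_one (R : ℝ) (η : ℝ × ℝ) : cutoff R η ≤ 1 :=
  mul_le_one₀ (cutoffAux_le_one _ _) (cutoffAux_nonneg _ _) (cutoffAux_le_one _ _)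

lemma contDiff_cutoffAux (R : ℝ) : ContDiff ℝ 1 (cutoffAux R) := by
  unfold cutoffAux
  have h : ContDiff ℝ 1 smoothTransition := smoothTransition.contDiff
  exact (h.comp (by fun_prop)).mul (h.comp (by fun_prop))

lemma contDiff_cutoff (R : ℝ) : ContDiff ℝ 1 (cutoff R) :=
  ((contDiff_cutoffAux R).comp contDiff_fst).mul ((contDiff_cutoffAux R).comp contDiff_snd)

lemma cutoffAux_eq_one {R x : ℝ} (hR : 0 < R) (h1 : 2 / R ≤ x) (h2 : x ≤ R) :
    cutoffAux R x = 1 := by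
  rw [cutoffAux, smoothTransition.one_of_one_le, smoothTransition.one_of_one_le, one_mul]
  · have : x / R ≤ 1 := (div_le_one hR).2 h2
    linarith
  · rw [div_le_iff₀ hR] at h1
    linarith

lemma cutoffAux_eq_zero {R x : ℝ} (hR : 0 < R) (h : x ∉ Icc (1 / R) (2 * R)) :
    cutoffAux R x = 0 := by
  rw [cutoffAux, mul_eq_zero]
  rcases not_and_or.1 h with h | h <;> rw [not_le] at h
  · left
    apply smoothTransition.zero_of_nonpos
    rw [lt_div_iff₀ hR] at h
    linarith
  · right
    apply smoothTransition.zero_of_nonpos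
    have : 2 ≤ x / R := (le_div_iff₀ hR).2 h.le
    linarith

lemma cutoff_eq_one {R : ℝ} {η : ℝ × ℝ} (hR : 0 < R) (h1 : 2 / R ≤ η.1) (h2 : η.1 ≤ R)
    (h3 : 2 / R ≤ η.2) (h4 : η.2 ≤ R) : cutoff R η = 1 := by
  rw [cutoff, cutoffAux_eq_one hR h1 h2, cutoffAux_eq_one hR h3 h4, one_mul]

lemma cutoff_eq_zero {R : ℝ} {η : ℝ × ℝ} (hR : 0 < R)
    (h : η ∉ Icc (1 / R) (2 * R) ×ˢ Icc (1 / R) (2 * R)) : cutoff R η = 0 := by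
  rw [cutoff, mul_eq_zero]
  rcases not_and_or.1 h with h | h
  · exact Or.inl (cutoffAux_eq_zero hR h)
  · exact Or.inr (cutoffAux_eq_zero hR h)

/-- Continuous functions vanishing outside a compact subset of the quadrant. -/
lemma isCcQuad_of_eq_zero {φ : ℝ × ℝ → ℝ} {S : Set (ℝ × ℝ)} (hφ : Continuous φ) (hS : IsCompact S)
    (hSQ : S ⊆ Quad) (h : ∀ η ∉ S, φ η = 0) : IsCcQuad φ := by
  refine ⟨hφ, HasCompactSupport.intro hS h, ?_⟩
  refine (closure_minimal (fun η hη => ?_) hS.isClosed).trans hSQ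
  by_contra hn
  exact hη (h η hn)

lemma isCcQuad_cutoff {R : ℝ} (hR : 0 < R) : IsCcQuad (cutoff R) := by
  refine isCcQuad_of_eq_zero (contDiff_cutoff R).continuous (isCompact_Icc.prod isCompact_Icc)
    (fun η hη => ?_) (fun η hη => cutoff_eq_zero hR hη)
  have : 0 < 1 / R := by positivity
  exact ⟨this.trans_le hη.1.1, this.trans_le hη.2.1⟩

lemma IsCcQuad.mul_continuousOn {φ g : ℝ × ℝ → ℝ} (hφ : IsCcQuad φ) (hg : ContinuousOn g Quad) :
    IsCcQuad (fun η => φ η * g η) := by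
  have hs : tsupport (fun η => φ η * g η) ⊆ tsupport φ := tsupport_mul_subset_left
  refine ⟨?_, hφ.2.1.mul_right, hs.trans hφ.2.2⟩
  exact (hφ.1.continuousOn.mul hg).continuous_of_tsupport_subset isOpen_quad (hs.trans hφ.2.2)

lemma IsCcQuad.exists_bound {φ : ℝ × ℝ → ℝ} (hφ : IsCcQuad φ) : ∃ C, 0 ≤ C ∧ ∀ η, |φ η| ≤ C := by
  obtain ⟨C, hC⟩ := hφ.2.1.exists_bound_of_continuous hφ.1
  exact ⟨C, (norm_nonneg _).trans (hC 0), hC⟩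

lemma eventually_cutoff_eq_one {S : Set (ℝ × ℝ)} (hS : IsCompact S) (hSQ : S ⊆ Quad) :
    ∀ᶠ R : ℝ in atTop, ∀ η ∈ S, cutoff R η = 1 := by
  rcases S.eq_empty_or_nonempty with rfl | hne
  · simp
  obtain ⟨p, hp, hpm⟩ := hS.exists_isMinOn hne continuous_fst.continuousOn
  obtain ⟨q, hq, hqm⟩ := hS.exists_isMinOn hne continuous_snd.continuousOn
  obtain ⟨P, -, hPm⟩ := hS.exists_isMaxOn hne continuous_fst.continuousOn
  obtain ⟨Q, -, hQm⟩ := hS.exists_isMaxOn hne continuous_snd.continuousOn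
  have h1 := (hSQ hp).1
  have h2 := (hSQ hq).2
  filter_upwards [eventually_gt_atTop 0, eventually_ge_atTop P.1, eventually_ge_atTop Q.2,
    eventually_ge_atTop (2 / p.1), eventually_ge_atTop (2 / q.2)] with R h0 hP hQ h3 h4 η hη
  have a1 : p.1 ≤ η.1 := hpm hη
  have a2 : q.2 ≤ η.2 := hqm hη
  have a3 : η.1 ≤ P.1 := hPm hη
  have a4 : η.2 ≤ Q.2 := hQm hη
  rw [div_le_iff₀ h1] at h3
  rw [div_le_iff₀ h2] at h4
  refine cutoff_eq_one h0 ?_ (a3.trans hP) ?_ (a4.trans hQ) <;> rw [div_le_iff₀ h0] <;> nlinarith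

lemma tendsto_cutoff {η : ℝ × ℝ} (h : η ∈ Quad) :
    ∀ᶠ R : ℝ in atTop, cutoff R η = 1 := by
  filter_upwards [eventually_cutoff_eq_one (isCompact_singleton (x := η)) (by simpa using h)] with
    R hR using hR η rfl

lemma iso_le_weight_of_cutoff_ne_one {R : ℝ} {η : ℝ × ℝ} (hR : 2 ≤ R) (h : η ∈ IsoRegion)
    (hc : cutoff R η ≠ 1) : R / 2 ≤ weight η := by
  by_contra! hlt
  have hR0 : 0 < R := by linarith
  have h1 := iso_inv_le_weight h
  have h2 := iso_snd_le_weight h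
  have h3 := iso_fst_le_weight h
  have hv : 2 / R ≤ η.2 := by
    by_contra! hv
    rw [lt_div_iff₀ hR0] at hv
    have : η.2 ^ (-1 : ℝ) * η.2 = 1 := by
      rw [Real.rpow_neg_one]; exact inv_mul_cancel₀ h.1.ne'
    nlinarith [h.1]
  have ha := iso_two_mul_le_fst h (t := 2 / R) (by positivity) ((div_le_one hR0).2 hR) hv
  have : 0 < 2 / R := by positivity
  exact hc (cutoff_eq_one hR0 (by linarith) (by linarith) hv (by linarith))

/-- The coagulation weight is uniformly small, relative to `weight`, outside the cutoff. -/
lemma eventually_one_sub_cutoff_mul_le {al be δ : ℝ} (ha : al ∈ Ico (0 : ℝ) 1)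
    (hb : be ∈ Ico (0 : ℝ) 1) (hδ : 0 < δ) :
    ∀ᶠ R : ℝ in atTop, ∀ η ∈ IsoRegion,
      (1 - cutoff R η) * coagWeight al be η ≤ δ * weight η := by
  obtain ⟨C, hC, h⟩ := exists_coagWeight_le ha hb (half_pos hδ)
  filter_upwards [eventually_ge_atTop 2, eventually_ge_atTop (4 * C / δ)] with R hR hRC η hη
  have hw := iso_one_le_weight hη
  by_cases hc : cutoff R η = 1
  · rw [hc]; nlinarith
  · have h1 := iso_le_weight_of_cutoff_ne_one hR hη hc
    have h2 := h η hη
    rw [div_le_iff₀ hδ] at hRC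
    have h3 := cutoff_nonneg R η
    have h4 := cutoff_le_one R η
    have h5 : 0 ≤ coagWeight al be η := coagWeight_nonneg (isoRegion_subset_quad hη)
    nlinarith

/-! ### One explicit Euler step -/

section EulerStep

variable {E : Type*} [MeasurableSpace E]

/-- The rate at which particles of type `η` disappear by coagulation with the population `f`. -/
def lossRate (κ : E × E → ℝ) (f : Measure E) (η : E) : ℝ := ∫ η', κ (η, η') ∂f

/-- One explicit Euler step, of length `h`, for the coagulation equation with kernel `κ`; half of
the population is moved by `Φ`, the other half takes part in the coagulation. -/
def eulerStep [Add E] (κ : E × E → ℝ) (Φ : E → E) (h : ℝ) (f : Measure E) : Measure E :=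
  (2⁻¹ : ℝ≥0∞) • f.map Φ + f.withDensity (fun η => ENNReal.ofReal (1 / 2 - h * lossRate κ f η)) +
    ENNReal.ofReal (h / 2) •
      ((f.prod f).withDensity (fun q => ENNReal.ofReal (κ q))).map (fun q => q.1 + q.2)

/-- The conditions under which an explicit Euler step is well behaved. -/
structure StepAdmissible (κ : E × E → ℝ) (Φ : E → E) (h N : ℝ) (f : Measure E) : Prop where
  measurable_kernel : Measurable κ
  kernel_nonneg : ∀ q, 0 ≤ κ q
  kernel_le : ∀ q, κ q ≤ N
  kernel_symm : ∀ q : E × E, κ q.swap = κ q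
  measurable_move : Measurable Φ
  step_nonneg : 0 ≤ h
  finite : IsFiniteMeasure f
  step_le : h * N * f.real univ ≤ 1 / 2

namespace StepAdmissible

variable {κ : E × E → ℝ} {Φ : E → E} {h N : ℝ} {f : Measure E}

lemma integrable_kernel (H : StepAdmissible κ Φ h N f) : Integrable κ (f.prod f) := by
  have := H.finite
  exact Integrable.of_bound H.measurable_kernel.aestronglyMeasurable N
    (ae_of_all _ fun q => by rw [Real.norm_of_nonneg (H.kernel_nonneg q)]; exact H.kernel_le q)

lemma integrable_kernel_right (H : StepAdmissible κ Φ h N f) (η : E) :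
    Integrable (fun η' => κ (η, η')) f := by
  have := H.finite
  exact Integrable.of_bound
    (H.measurable_kernel.comp measurable_prodMk_left).aestronglyMeasurable N
    (ae_of_all _ fun q => by rw [Real.norm_of_nonneg (H.kernel_nonneg _)]; exact H.kernel_le _)

lemma measurable_lossRate (H : StepAdmissible κ Φ h N f) : Measurable (lossRate κ f) := by
  have := H.finite
  exact (H.measurable_kernel.stronglyMeasurable.integral_prod_right' (ν := f)).measurable

lemma lossRate_nonneg (H : StepAdmissible κ Φ h N f) (η : E) : 0 ≤ lossRate κ f η :=
  integral_nonneg fun _ => H.kernel_nonneg _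

lemma lossRate_le (H : StepAdmissible κ Φ h N f) (η : E) : lossRate κ f η ≤ N * f.real univ := by
  have := H.finite
  have h1 : lossRate κ f η ≤ ∫ _, N ∂f :=
    integral_mono (H.integrable_kernel_right η) (integrable_const N) fun _ => H.kernel_le _
  simpa [mul_comm] using h1

lemma mul_lossRate_le (H : StepAdmissible κ Φ h N f) (η : E) : h * lossRate κ f η ≤ 1 / 2 := by
  have h1 := mul_le_mul_of_nonneg_left (H.lossRate_le η) H.step_nonneg
  have := H.step_le
  nlinarith

lemma ofReal_lossRate (H : StepAdmissible κ Φ h N f) (η : E) :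
    ENNReal.ofReal (lossRate κ f η) = ∫⁻ η', ENNReal.ofReal (κ (η, η')) ∂f :=
  ofReal_integral_eq_lintegral_ofReal (H.integrable_kernel_right η)
    (ae_of_all _ fun _ => H.kernel_nonneg _)

lemma lintegral_kernel_mul_fst (H : StepAdmissible κ Φ h N f) {φ : E → ℝ≥0∞} (hφ : Measurable φ) :
    ∫⁻ q, ENNReal.ofReal (κ q) * φ q.1 ∂(f.prod f)
      = ∫⁻ η, ENNReal.ofReal (lossRate κ f η) * φ η ∂f := by
  have := H.finite
  have hκ := H.measurable_kernel
  rw [lintegral_prod _ (by fun_prop)]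
  refine lintegral_congr fun η => ?_
  change ∫⁻ y, ENNReal.ofReal (κ (η, y)) * φ η ∂f = _
  rw [lintegral_mul_const _ (by fun_prop), H.ofReal_lossRate]

lemma lintegral_kernel_mul_snd (H : StepAdmissible κ Φ h N f) {φ : E → ℝ≥0∞} (hφ : Measurable φ) :
    ∫⁻ q, ENNReal.ofReal (κ q) * φ q.2 ∂(f.prod f)
      = ∫⁻ η, ENNReal.ofReal (lossRate κ f η) * φ η ∂f := by
  have := H.finite
  have hκ := H.measurable_kernel
  rw [← H.lintegral_kernel_mul_fst hφ,
    ← (Measure.measurePreserving_swap (μ := f) (ν := f)).lintegral_comp (by fun_prop)]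
  simp only [H.kernel_symm, Prod.snd_swap]

variable [Add E] [MeasurableAdd₂ E]

lemma lintegral_eulerStep (H : StepAdmissible κ Φ h N f) {φ : E → ℝ≥0∞} (hφ : Measurable φ) :
    ∫⁻ η, φ η ∂(eulerStep κ Φ h f) = 2⁻¹ * ∫⁻ η, φ (Φ η) ∂f
      + ∫⁻ η, ENNReal.ofReal (1 / 2 - h * lossRate κ f η) * φ η ∂f
      + ENNReal.ofReal (h / 2) * ∫⁻ q, ENNReal.ofReal (κ q) * φ (q.1 + q.2) ∂(f.prod f) := by
  have hm := H.measurable_lossRate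
  have hκ := H.measurable_kernel
  have hΦ := H.measurable_move
  rw [eulerStep, lintegral_add_measure, lintegral_add_measure, lintegral_smul_measure,
    lintegral_smul_measure, lintegral_map hφ hΦ, lintegral_map hφ (by fun_prop),
    lintegral_withDensity_eq_lintegral_mul _ (by fun_prop) hφ,
    lintegral_withDensity_eq_lintegral_mul _ (by fun_prop) (by fun_prop)]
  rfl

/-- If `φ` loses at least `d` when moved by `Φ` and is subadditive up to an error `c`, its integral
grows at most by the integral of the error. -/
lemma lintegral_eulerStep_le (H : StepAdmissible κ Φ h N f) {φ d : E → ℝ≥0∞} {c : E × E → ℝ≥0∞}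
    (hφ : Measurable φ) (hd : Measurable d)
    (h1 : ∀ᵐ η ∂f, φ (Φ η) + d η ≤ φ η)
    (h2 : ∀ᵐ q ∂(f.prod f), φ (q.1 + q.2) ≤ φ q.1 + φ q.2 + c q) :
    ∫⁻ η, φ η ∂(eulerStep κ Φ h f) + 2⁻¹ * ∫⁻ η, d η ∂f ≤ ∫⁻ η, φ η ∂f
      + ENNReal.ofReal (h / 2) * ∫⁻ q, ENNReal.ofReal (κ q) * c q ∂(f.prod f) := by
  have hκ := H.measurable_kernel
  have hm := H.measurable_lossRate
  have hΦ := H.measurable_move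
  have hh := H.step_nonneg
  have e1 : 2⁻¹ * ∫⁻ η, φ (Φ η) ∂f + 2⁻¹ * ∫⁻ η, d η ∂f ≤ 2⁻¹ * ∫⁻ η, φ η ∂f := by
    rw [← mul_add, ← lintegral_add_right _ hd]
    gcongr 2⁻¹ * ?_
    exact lintegral_mono_ae h1
  have e2 : ∫⁻ q, ENNReal.ofReal (κ q) * φ (q.1 + q.2) ∂(f.prod f) ≤
      (∫⁻ q, ENNReal.ofReal (κ q) * φ q.1 ∂(f.prod f) +
        ∫⁻ q, ENNReal.ofReal (κ q) * φ q.2 ∂(f.prod f)) +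
        ∫⁻ q, ENNReal.ofReal (κ q) * c q ∂(f.prod f) := by
    rw [← lintegral_add_left (by fun_prop), ← lintegral_add_left (by fun_prop)]
    refine lintegral_mono_ae (h2.mono fun q hq => ?_)
    rw [← mul_add, ← mul_add]
    gcongr
  rw [H.lintegral_kernel_mul_fst hφ, H.lintegral_kernel_mul_snd hφ] at e2
  have e3 : ∫⁻ η, ENNReal.ofReal (1 / 2 - h * lossRate κ f η) * φ η ∂f +
      ENNReal.ofReal (h / 2) * (∫⁻ η, ENNReal.ofReal (lossRate κ f η) * φ η ∂f +
        ∫⁻ η, ENNReal.ofReal (lossRate κ f η) * φ η ∂f) = 2⁻¹ * ∫⁻ η, φ η ∂f := by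
    rw [← lintegral_add_left (by fun_prop), ← lintegral_const_mul _ (by fun_prop),
      ← lintegral_add_left (by fun_prop), ← lintegral_const_mul _ (by fun_prop)]
    refine lintegral_congr fun η => ?_
    have a1 := H.lossRate_nonneg η
    have a2 := H.mul_lossRate_le η
    rw [← add_mul, ← mul_assoc, ← add_mul, ← ENNReal.ofReal_add a1 a1,
      ← ENNReal.ofReal_mul (by positivity), ← ENNReal.ofReal_add (by linarith) (by positivity)]
    congr 1
    rw [show 1 / 2 - h * lossRate κ f η + h / 2 * (lossRate κ f η + lossRate κ f η) = 2⁻¹ by ring,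
      ENNReal.ofReal_inv_of_pos (by norm_num)]
    norm_num
  rw [H.lintegral_eulerStep hφ]
  calc _ = (2⁻¹ * ∫⁻ η, φ (Φ η) ∂f + 2⁻¹ * ∫⁻ η, d η ∂f) +
        (∫⁻ η, ENNReal.ofReal (1 / 2 - h * lossRate κ f η) * φ η ∂f +
          ENNReal.ofReal (h / 2) *
            ∫⁻ q, ENNReal.ofReal (κ q) * φ (q.1 + q.2) ∂(f.prod f)) := by ring
    _ ≤ 2⁻¹ * ∫⁻ η, φ η ∂f + (∫⁻ η, ENNReal.ofReal (1 / 2 - h * lossRate κ f η) * φ η ∂f +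
          ENNReal.ofReal (h / 2) * ((∫⁻ η, ENNReal.ofReal (lossRate κ f η) * φ η ∂f +
            ∫⁻ η, ENNReal.ofReal (lossRate κ f η) * φ η ∂f) +
            ∫⁻ q, ENNReal.ofReal (κ q) * c q ∂(f.prod f))) := by gcongr
    _ = 2⁻¹ * ∫⁻ η, φ η ∂f + 2⁻¹ * ∫⁻ η, φ η ∂f +
          ENNReal.ofReal (h / 2) * ∫⁻ q, ENNReal.ofReal (κ q) * c q ∂(f.prod f) := by
        rw [← e3]; ring
    _ = _ := by rw [← add_mul, ENNReal.inv_two_add_inv_two, one_mul]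

lemma lintegral_eulerStep_le_of_subadditive (H : StepAdmissible κ Φ h N f) {φ : E → ℝ≥0∞}
    (hφ : Measurable φ) (h1 : ∀ᵐ η ∂f, φ (Φ η) ≤ φ η)
    (h2 : ∀ᵐ q ∂(f.prod f), φ (q.1 + q.2) ≤ φ q.1 + φ q.2) :
    ∫⁻ η, φ η ∂(eulerStep κ Φ h f) ≤ ∫⁻ η, φ η ∂f := by
  simpa using H.lintegral_eulerStep_le (d := 0) (c := 0) hφ measurable_zero
    (by simpa using h1) (by simpa using h2)

lemma isFiniteMeasure_eulerStep (H : StepAdmissible κ Φ h N f) :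
    IsFiniteMeasure (eulerStep κ Φ h f) := by
  have := H.finite
  constructor
  have := H.lintegral_eulerStep_le_of_subadditive (φ := fun _ => 1) measurable_const (by simp)
    (by simp)
  simp only [lintegral_one] at this
  exact this.trans_lt (measure_lt_top f univ)

lemma integral_eulerStep (H : StepAdmissible κ Φ h N f) {φ : E → ℝ} (hφ : Measurable φ) {C : ℝ}
    (hC : ∀ η, |φ η| ≤ C) :
    ∫ η, φ η ∂(eulerStep κ Φ h f) = ∫ η, φ η ∂f + 1 / 2 * ∫ η, (φ (Φ η) - φ η) ∂f
      + h / 2 * ∫ q, κ q * (φ (q.1 + q.2) - φ q.1 - φ q.2) ∂(f.prod f) := by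
  have := H.finite
  have hκ := H.measurable_kernel
  have hm := H.measurable_lossRate
  have hΦ := H.measurable_move
  have hh := H.step_nonneg
  have hfin := H.isFiniteMeasure_eulerStep
  have hInt : Integrable φ (eulerStep κ Φ h f) :=
    Integrable.of_bound hφ.aestronglyMeasurable C (ae_of_all _ hC)
  have hi0 : Integrable φ f := Integrable.of_bound hφ.aestronglyMeasurable C (ae_of_all _ hC)
  have hi1 : Integrable (fun η => φ (Φ η)) f :=
    Integrable.of_bound (hφ.comp hΦ).aestronglyMeasurable C (ae_of_all _ fun _ => hC _)
  have hk (g : E × E → E) (hg : Measurable g) :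
      Integrable (fun q => κ q * φ (g q)) (f.prod f) := by
    refine (H.integrable_kernel.mul_const C).mono' (by fun_prop) (ae_of_all _ fun q => ?_)
    rw [norm_mul, Real.norm_of_nonneg (H.kernel_nonneg q)]
    exact mul_le_mul_of_nonneg_left (hC _) (H.kernel_nonneg q)
  have hL : Integrable (fun η => lossRate κ f η * φ η) f := by
    refine Integrable.of_bound (by fun_prop) (N * f.real univ * C) (ae_of_all _ fun η => ?_)
    rw [norm_mul, Real.norm_of_nonneg (H.lossRate_nonneg η)]
    exact mul_le_mul (H.lossRate_le η) (hC η) (abs_nonneg _)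
      ((H.lossRate_nonneg η).trans (H.lossRate_le η))
  have f1 : ∫ q, κ q * φ q.1 ∂(f.prod f) = ∫ η, lossRate κ f η * φ η ∂f := by
    rw [integral_prod _ (hk _ measurable_fst)]
    refine integral_congr_ae (ae_of_all _ fun η => ?_)
    change ∫ y, κ (η, y) * φ η ∂f = _
    exact integral_mul_const _ _
  have f2 : ∫ q, κ q * φ q.2 ∂(f.prod f) = ∫ η, lossRate κ f η * φ η ∂f := by
    rw [← f1, ← integral_prod_swap]
    simp only [H.kernel_symm, Prod.snd_swap]
  unfold eulerStep at hInt ⊢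
  rw [integrable_add_measure, integrable_add_measure] at hInt
  rw [integral_add_measure (hInt.1.1.add_measure hInt.1.2) hInt.2,
    integral_add_measure hInt.1.1 hInt.1.2, integral_smul_measure, integral_smul_measure,
    integral_map (by fun_prop) (by fun_prop), integral_map (by fun_prop) (by fun_prop),
    integral_withDensity_eq_integral_toReal_smul (by fun_prop) (by simp),
    integral_withDensity_eq_integral_toReal_smul (by fun_prop) (by simp)]
  have g1 (η : E) : (ENNReal.ofReal (1 / 2 - h * lossRate κ f η)).toReal • φ η =
      1 / 2 * φ η - h * (lossRate κ f η * φ η) := by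
    rw [ENNReal.toReal_ofReal (by linarith [H.mul_lossRate_le η]), smul_eq_mul]; ring
  have g2 (q : E × E) : (ENNReal.ofReal (κ q)).toReal • φ (q.1 + q.2) = κ q * φ (q.1 + q.2) := by
    rw [ENNReal.toReal_ofReal (H.kernel_nonneg q), smul_eq_mul]
  simp only [g1, g2]
  rw [integral_sub (hi0.const_mul _) (hL.const_mul _), integral_const_mul, integral_const_mul,
    integral_sub hi1 hi0]
  have g3 : ∫ q, κ q * (φ (q.1 + q.2) - φ q.1 - φ q.2) ∂(f.prod f) =
      ∫ q, κ q * φ (q.1 + q.2) ∂(f.prod f) - ∫ q, κ q * φ q.1 ∂(f.prod f)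
        - ∫ q, κ q * φ q.2 ∂(f.prod f) := by
    rw [← integral_sub (hk (fun q => q.1 + q.2) (by fun_prop)) (hk _ measurable_fst),
      ← integral_sub _ (hk _ measurable_snd)]
    · simp only [mul_sub]
    · exact (hk (fun q => q.1 + q.2) (by fun_prop)).sub (hk _ measurable_fst)
  rw [g3, f1, f2, ENNReal.toReal_ofReal (by positivity)]
  simp only [smul_eq_mul, ENNReal.toReal_inv, ENNReal.toReal_ofNat]
  ring

end StepAdmissible

end EulerStep

/-! ### Truncated kernels -/

section Truncation

/-- The distance `a - c₀ v^(2/3)` to the isoperimetric curve. -/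
def excess (η : ℝ × ℝ) : ℝ := η.1 - c0 * η.2 ^ ((2 : ℝ) / 3)

lemma continuous_excess : Continuous excess := by
  unfold excess
  exact continuous_fst.sub
    (continuous_const.mul (continuous_snd.rpow_const fun _ => Or.inr (by norm_num)))

lemma iso_excess_nonneg {η : ℝ × ℝ} (h : η ∈ IsoRegion) : 0 ≤ excess η := sub_nonneg.2 h.2

lemma iso_excess_le {η : ℝ × ℝ} (h : η ∈ IsoRegion) : excess η ≤ η.1 :=
  sub_le_self _ (mul_nonneg c0_nonneg (Real.rpow_nonneg h.1.le _))

/-- The coagulation kernel truncated at level `N` and extended by zero. -/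
def truncKernel (K : ℝ × ℝ → ℝ × ℝ → ℝ) (N : ℝ) : (ℝ × ℝ) × (ℝ × ℝ) → ℝ :=
  (Quad ×ˢ Quad).indicator fun q => min (K q.1 q.2) N

/-- The fusion kernel truncated at level `N`, in value and in area, and extended by zero. -/
def truncFusion (r : ℝ × ℝ → ℝ) (N : ℝ) : ℝ × ℝ → ℝ :=
  (Quad ∩ {η | η.1 ≤ N}).indicator fun η => min (r η) N

lemma ContinuousOn.measurable_indicator_real {X : Type*} [TopologicalSpace X]
    [MeasurableSpace X] [BorelSpace X] {g : X → ℝ} {s : Set X} (hg : ContinuousOn g s)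
    (hs : MeasurableSet s) : Measurable (s.indicator g) := by
  classical
  rw [← Set.piecewise_eq_indicator]
  exact hg.measurable_piecewise continuousOn_const hs

variable {K : ℝ × ℝ → ℝ × ℝ → ℝ} {K₀ K₁ al be : ℝ}
  {r : ℝ × ℝ → ℝ} {R₀ R₁ mu sg B : ℝ}

lemma IsCoagKernel.al_mem (hK : IsCoagKernel K K₀ K₁ al be) : al ∈ Ioo (0 : ℝ) 1 := by
  have h1 := hK.be_mem
  have h2 := hK.be_sub_al_mem
  exact ⟨hK.al_pos, by linarith [h1.2, h2.1]⟩

lemma IsCoagKernel.K0_pos (hK : IsCoagKernel K K₀ K₁ al be) : 0 < K₀ :=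
  hK.K1_pos.trans_le hK.K1_le_K0

lemma IsCoagKernel.nonneg (hK : IsCoagKernel K K₀ K₁ al be) {η η' : ℝ × ℝ} (h : η ∈ Quad)
    (h' : η' ∈ Quad) : 0 ≤ K η η' := by
  refine le_trans ?_ (hK.lower η h η' h')
  have := Real.rpow_pos_of_pos h.2 (-al)
  have := Real.rpow_pos_of_pos h'.2 (-al)
  have := Real.rpow_pos_of_pos h.2 be
  have := Real.rpow_pos_of_pos h'.2 be
  have := hK.K1_pos
  positivity

lemma IsCoagKernel.le_coagWeight_mul (hK : IsCoagKernel K K₀ K₁ al be) {η η' : ℝ × ℝ}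
    (h : η ∈ Quad) (h' : η' ∈ Quad) :
    K η η' ≤ K₀ * (coagWeight al be η * coagWeight al be η') := by
  refine (hK.upper η h η' h').trans ?_
  have := Real.rpow_pos_of_pos h.2 (-al)
  have := Real.rpow_pos_of_pos h'.2 (-al)
  have := Real.rpow_pos_of_pos h.2 be
  have := Real.rpow_pos_of_pos h'.2 be
  have := hK.K0_pos
  refine mul_le_mul_of_nonneg_left ?_ this.le
  unfold coagWeight
  nlinarith [mul_pos (Real.rpow_pos_of_pos h.2 (-al)) (Real.rpow_pos_of_pos h'.2 (-al)),
    mul_pos (Real.rpow_pos_of_pos h.2 be) (Real.rpow_pos_of_pos h'.2 be)]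

lemma IsCoagKernel.measurable_trunc (hK : IsCoagKernel K K₀ K₁ al be) (N : ℝ) :
    Measurable (truncKernel K N) :=
  ContinuousOn.measurable_indicator_real (hK.cont.inf continuousOn_const)
    (measurableSet_quad.prod measurableSet_quad)

lemma IsCoagKernel.trunc_nonneg (hK : IsCoagKernel K K₀ K₁ al be) {N : ℝ} (hN : 0 ≤ N)
    (q : (ℝ × ℝ) × (ℝ × ℝ)) : 0 ≤ truncKernel K N q :=
  Set.indicator_nonneg (fun _ hq => le_min (hK.nonneg hq.1 hq.2) hN) q

lemma truncKernel_le {N : ℝ} (hN : 0 ≤ N) (q : (ℝ × ℝ) × (ℝ × ℝ)) : truncKernel K N q ≤ N :=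
  Set.indicator_le' (fun _ _ => min_le_right _ _) (fun _ _ => hN) q

lemma IsCoagKernel.trunc_symm (hK : IsCoagKernel K K₀ K₁ al be) (N : ℝ)
    (q : (ℝ × ℝ) × (ℝ × ℝ)) : truncKernel K N q.swap = truncKernel K N q := by
  by_cases h : q ∈ Quad ×ˢ Quad
  · rw [truncKernel, Set.indicator_of_mem (show q.swap ∈ Quad ×ˢ Quad from ⟨h.2, h.1⟩),
      Set.indicator_of_mem h, Prod.fst_swap, Prod.snd_swap, hK.symm]
  · rw [truncKernel, Set.indicator_of_notMem (fun h' => h ⟨h'.2, h'.1⟩),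
      Set.indicator_of_notMem h]

lemma truncKernel_le_self {N : ℝ} {q : (ℝ × ℝ) × (ℝ × ℝ)} (hq : q ∈ Quad ×ˢ Quad) :
    truncKernel K N q ≤ K q.1 q.2 := by
  rw [truncKernel, Set.indicator_of_mem hq]
  exact min_le_left _ _

lemma IsFusionKernel.measurable_trunc (hr : IsFusionKernel r R₀ R₁ mu sg B) (N : ℝ) :
    Measurable (truncFusion r N) :=
  ContinuousOn.measurable_indicator_real
    ((hr.smooth.continuousOn.mono inter_subset_left).inf continuousOn_const)
    (measurableSet_quad.inter (measurableSet_le measurable_fst measurable_const))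

lemma IsFusionKernel.trunc_nonneg (hr : IsFusionKernel r R₀ R₁ mu sg B) {N : ℝ} (hN : 0 ≤ N)
    (η : ℝ × ℝ) : 0 ≤ truncFusion r N η :=
  Set.indicator_nonneg (fun _ hq => le_min (hr.pos _ hq.1).le hN) η

lemma truncFusion_le {N : ℝ} (hN : 0 ≤ N) (η : ℝ × ℝ) : truncFusion r N η ≤ N :=
  Set.indicator_le' (fun _ _ => min_le_right _ _) (fun _ _ => hN) η

lemma IsFusionKernel.trunc_le_self (hr : IsFusionKernel r R₀ R₁ mu sg B) {N : ℝ} {η : ℝ × ℝ}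
    (h : η ∈ Quad) : truncFusion r N η ≤ r η := by
  by_cases h' : η.1 ≤ N
  · rw [truncFusion, Set.indicator_of_mem (show η ∈ Quad ∩ {η | η.1 ≤ N} from ⟨h, h'⟩)]
    exact min_le_left _ _
  · rw [truncFusion, Set.indicator_of_notMem (fun h2 => h' h2.2)]
    exact (hr.pos _ h).le

lemma truncFusion_eq_zero {N : ℝ} {η : ℝ × ℝ} (h : N < η.1) : truncFusion r N η = 0 :=
  Set.indicator_of_notMem (fun h2 => h.not_ge h2.2) _

lemma eventually_truncKernel_eq (hK : IsCoagKernel K K₀ K₁ al be) {S : Set ((ℝ × ℝ) × (ℝ × ℝ))}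
    (hS : IsCompact S) (hSQ : S ⊆ Quad ×ˢ Quad) :
    ∀ᶠ N : ℝ in atTop, ∀ q ∈ S, truncKernel K N q = K q.1 q.2 := by
  obtain ⟨C, hC⟩ := hS.exists_bound_of_continuousOn (hK.cont.mono hSQ)
  filter_upwards [eventually_ge_atTop C] with N hN q hq
  rw [truncKernel, Set.indicator_of_mem (hSQ hq)]
  exact min_eq_left (((le_abs_self _).trans (hC q hq)).trans hN)

lemma eventually_truncFusion_eq (hr : IsFusionKernel r R₀ R₁ mu sg B) {S : Set (ℝ × ℝ)}
    (hS : IsCompact S) (hSQ : S ⊆ Quad) :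
    ∀ᶠ N : ℝ in atTop, ∀ η ∈ S, truncFusion r N η = r η := by
  obtain ⟨C, hC⟩ := hS.exists_bound_of_continuousOn (hr.smooth.continuousOn.mono hSQ)
  obtain ⟨C', hC'⟩ := hS.exists_bound_of_continuousOn (f := fun η => η.1) continuousOn_fst
  filter_upwards [eventually_ge_atTop C, eventually_ge_atTop C'] with N hN hN' η hη
  rw [truncFusion, Set.indicator_of_mem
    (show η ∈ Quad ∩ {η | η.1 ≤ N} from ⟨hSQ hη, ((le_abs_self _).trans (hC' η hη)).trans hN'⟩)]
  exact min_eq_left (((le_abs_self _).trans (hC η hη)).trans hN)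

end Truncation

/-! ### Measures with a bounded moment -/

/-- Measures on the isoperimetric region whose `(v⁻¹ + v² + a)`-moment is at most `C`. -/
structure MomentLe (C : ℝ) (m : Measure (ℝ × ℝ)) : Prop where
  iso : IsIsoMeasure m
  lintegral_le : ∫⁻ η, ENNReal.ofReal (weight η) ∂m ≤ ENNReal.ofReal C

namespace MomentLe

variable {C : ℝ} {m : Measure (ℝ × ℝ)}

lemma ae_iso (h : MomentLe C m) : ∀ᵐ η ∂m, η ∈ IsoRegion := h.iso

lemma ae_quad (h : MomentLe C m) : ∀ᵐ η ∂m, η ∈ Quad :=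
  h.ae_iso.mono fun _ hη => isoRegion_subset_quad hη

lemma mono (h : MomentLe C m) {C' : ℝ} (hC : C ≤ C') : MomentLe C' m :=
  ⟨h.iso, h.lintegral_le.trans (ENNReal.ofReal_le_ofReal hC)⟩

lemma measure_univ_le (h : MomentLe C m) : m univ ≤ ENNReal.ofReal C := by
  rw [← lintegral_one]
  refine (lintegral_mono_ae (h.ae_iso.mono fun η hη => ?_)).trans h.lintegral_le
  simpa using iso_one_le_weight hη

lemma isFiniteMeasure (h : MomentLe C m) : IsFiniteMeasure m :=
  ⟨h.measure_univ_le.trans_lt ENNReal.ofReal_lt_top⟩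

lemma real_univ_le (h : MomentLe C m) (hC : 0 ≤ C) : m.real univ ≤ C :=
  ENNReal.toReal_le_of_le_ofReal hC h.measure_univ_le

lemma integrable_weight (h : MomentLe C m) : Integrable weight m := by
  refine ⟨measurable_weight.aestronglyMeasurable, ?_⟩
  rw [hasFiniteIntegral_iff_ofReal
    (h.ae_iso.mono fun η hη => zero_le_one.trans (iso_one_le_weight hη))]
  exact h.lintegral_le.trans_lt ENNReal.ofReal_lt_top

lemma integral_weight_le (h : MomentLe C m) (hC : 0 ≤ C) : ∫ η, weight η ∂m ≤ C := by
  rw [integral_eq_lintegral_of_nonneg_ae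
    (h.ae_iso.mono fun η hη => zero_le_one.trans (iso_one_le_weight hη))
    measurable_weight.aestronglyMeasurable]
  exact ENNReal.toReal_le_of_le_ofReal hC h.lintegral_le

/-- Bounded measurable functions have integral controlled by the bound. -/
lemma abs_integral_le (h : MomentLe C m) (hC : 0 ≤ C) {φ : ℝ × ℝ → ℝ} {b : ℝ} (hb : 0 ≤ b)
    (hφ : ∀ η ∈ IsoRegion, |φ η| ≤ b) : |∫ η, φ η ∂m| ≤ b * C := by
  have := h.isFiniteMeasure
  have h1 := norm_integral_le_of_norm_le_const (f := φ) (h.ae_iso.mono hφ)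
  exact h1.trans (mul_le_mul_of_nonneg_left (h.real_univ_le hC) hb)

/-- Functions dominated by the weight have integral controlled by the moment bound. -/
lemma abs_integral_le_of_le_weight (h : MomentLe C m) (hC : 0 ≤ C) {φ : ℝ × ℝ → ℝ} {b : ℝ}
    (hb : 0 ≤ b) (hφ : ∀ η ∈ IsoRegion, |φ η| ≤ b * weight η) : |∫ η, φ η ∂m| ≤ b * C := by
  have h1 := norm_integral_le_of_norm_le (f := φ) (h.integrable_weight.const_mul b) (h.ae_iso.mono hφ)
  rw [integral_const_mul] at h1
  exact h1.trans (mul_le_mul_of_nonneg_left (h.integral_weight_le hC) hb)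

lemma integrable_of_le_weight (h : MomentLe C m) {φ : ℝ × ℝ → ℝ} (hm : Measurable φ) {b : ℝ}
    (hφ : ∀ η ∈ IsoRegion, |φ η| ≤ b * weight η) : Integrable φ m :=
  (h.integrable_weight.const_mul b).mono' hm.aestronglyMeasurable (h.ae_iso.mono hφ)

lemma integrable_of_bounded (h : MomentLe C m) {φ : ℝ × ℝ → ℝ} (hm : Measurable φ) {b : ℝ}
    (hφ : ∀ η, |φ η| ≤ b) : Integrable φ m := by
  have := h.isFiniteMeasure
  exact Integrable.of_bound hm.aestronglyMeasurable b (ae_of_all _ hφ)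

lemma ae_prod_iso (h : MomentLe C m) :
    ∀ᵐ q ∂(m.prod m), q.1 ∈ IsoRegion ∧ q.2 ∈ IsoRegion := by
  have := h.isFiniteMeasure
  exact (Measure.quasiMeasurePreserving_fst.ae h.ae_iso).and
    (Measure.quasiMeasurePreserving_snd.ae h.ae_iso)

/-- Functions dominated by a product of weights. -/
lemma abs_integral_prod_le (h : MomentLe C m) {F : (ℝ × ℝ) × (ℝ × ℝ) → ℝ}
    {g k : ℝ × ℝ → ℝ} (hg : Integrable g m) (hk : Integrable k m)
    (hF : ∀ q : (ℝ × ℝ) × (ℝ × ℝ), q.1 ∈ IsoRegion → q.2 ∈ IsoRegion → |F q| ≤ g q.1 * k q.2) :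
    |∫ q, F q ∂(m.prod m)| ≤ (∫ η, g η ∂m) * ∫ η, k η ∂m := by
  have := h.isFiniteMeasure
  have h1 := norm_integral_le_of_norm_le (f := F) (hg.mul_prod hk)
    (h.ae_prod_iso.mono fun q hq => hF q hq.1 hq.2)
  rwa [integral_prod_mul] at h1

lemma integrable_prod (h : MomentLe C m) {F : (ℝ × ℝ) × (ℝ × ℝ) → ℝ} (hm : Measurable F)
    {g k : ℝ × ℝ → ℝ} (hg : Integrable g m) (hk : Integrable k m)
    (hF : ∀ q : (ℝ × ℝ) × (ℝ × ℝ), q.1 ∈ IsoRegion → q.2 ∈ IsoRegion → |F q| ≤ g q.1 * k q.2) :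
    Integrable F (m.prod m) := by
  have := h.isFiniteMeasure
  exact (hg.mul_prod hk).mono' hm.aestronglyMeasurable
    (h.ae_prod_iso.mono fun q hq => hF q hq.1 hq.2)

end MomentLe

/-! ### The explicit Euler scheme -/

section Scheme

/-- The time step of the scheme truncated at level `N`, for a total initial mass `M`. -/
def stepSize (ε M N : ℝ) : ℝ := ε / (2 * N ^ 3 * (1 + M))

/-- The relative displacement by fusion in one step of length `h`. -/
def fusionRate (r : ℝ × ℝ → ℝ) (ε h N : ℝ) (η : ℝ × ℝ) : ℝ := 2 * h * ε⁻¹ * truncFusion r N η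

/-- The displacement by fusion in one step of length `h`. -/
def fusionMove (r : ℝ × ℝ → ℝ) (ε h N : ℝ) (η : ℝ × ℝ) : ℝ × ℝ :=
  (η.1 - fusionRate r ε h N η * excess η, η.2)

/-- The iterates of the explicit Euler scheme. -/
def discreteSol (K : ℝ × ℝ → ℝ × ℝ → ℝ) (r : ℝ × ℝ → ℝ) (ε : ℝ) (fin : Measure (ℝ × ℝ)) (N : ℝ)
    (k : ℕ) : Measure (ℝ × ℝ) :=
  (eulerStep (truncKernel K N) (fusionMove r ε (stepSize ε (fin.real univ) N) N)
    (stepSize ε (fin.real univ) N))^[k] fin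

/-- The standing assumptions for the Euler scheme. -/
structure Scheme (K : ℝ × ℝ → ℝ × ℝ → ℝ) (r : ℝ × ℝ → ℝ)
    (K₀ K₁ al be R₀ R₁ mu sg B ε : ℝ) (fin : Measure (ℝ × ℝ)) (W N : ℝ) : Prop where
  coag : IsCoagKernel K K₀ K₁ al be
  fusion : IsFusionKernel r R₀ R₁ mu sg B
  eps_mem : ε ∈ Ioo (0 : ℝ) 1
  momentLe : MomentLe W fin
  W_nonneg : 0 ≤ W
  one_le : 1 ≤ N

namespace Scheme

variable {K : ℝ × ℝ → ℝ × ℝ → ℝ} {r : ℝ × ℝ → ℝ}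
    {K₀ K₁ al be R₀ R₁ mu sg B ε : ℝ} {fin : Measure (ℝ × ℝ)} {W N : ℝ}

lemma stepSize_pos (H : Scheme K r K₀ K₁ al be R₀ R₁ mu sg B ε fin W N) :
    0 < stepSize ε (fin.real univ) N := by
  have := H.eps_mem.1
  have := H.one_le
  have : 0 ≤ fin.real univ := measureReal_nonneg
  unfold stepSize; positivity

lemma stepSize_mul_le (H : Scheme K r K₀ K₁ al be R₀ R₁ mu sg B ε fin W N) :
    2 * stepSize ε (fin.real univ) N * N ^ 3 * (1 + fin.real univ) = ε := by
  have := H.one_le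
  have : 0 ≤ fin.real univ := measureReal_nonneg
  have : N ≠ 0 := by linarith
  have : 1 + fin.real univ ≠ 0 := by positivity
  unfold stepSize; field_simp

lemma fusionRate_nonneg (H : Scheme K r K₀ K₁ al be R₀ R₁ mu sg B ε fin W N) (η : ℝ × ℝ) :
    0 ≤ fusionRate r ε (stepSize ε (fin.real univ) N) N η := by
  have := H.stepSize_pos
  have := H.eps_mem.1
  have := H.one_le
  have := H.fusion.trunc_nonneg (N := N) (by linarith) η
  unfold fusionRate; positivity

lemma fusionRate_mul_sq_le (H : Scheme K r K₀ K₁ al be R₀ R₁ mu sg B ε fin W N) (η : ℝ × ℝ) :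
    fusionRate r ε (stepSize ε (fin.real univ) N) N η * N ^ 2 ≤ 1 := by
  have h1 := H.stepSize_pos
  have h2 := H.eps_mem.1
  have h3 := H.one_le
  have h4 := truncFusion_le (r := r) (N := N) (by linarith) η
  have h5 := H.stepSize_mul_le
  have h6 : 0 ≤ fin.real univ := measureReal_nonneg
  have h7 : 2 * stepSize ε (fin.real univ) N * N ^ 3 ≤ ε := by
    have := mul_le_mul_of_nonneg_left (show 1 ≤ 1 + fin.real univ by linarith)
      (show 0 ≤ 2 * stepSize ε (fin.real univ) N * N ^ 3 by positivity)
    linarith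
  calc fusionRate r ε (stepSize ε (fin.real univ) N) N η * N ^ 2
      ≤ 2 * stepSize ε (fin.real univ) N * ε⁻¹ * N * N ^ 2 := by
        unfold fusionRate; gcongr
    _ = 2 * stepSize ε (fin.real univ) N * N ^ 3 * ε⁻¹ := by ring
    _ ≤ ε * ε⁻¹ := by gcongr
    _ = 1 := mul_inv_cancel₀ h2.ne'

lemma fusionRate_le_one (H : Scheme K r K₀ K₁ al be R₀ R₁ mu sg B ε fin W N) (η : ℝ × ℝ) :
    fusionRate r ε (stepSize ε (fin.real univ) N) N η ≤ 1 := by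
  have h1 := H.fusionRate_mul_sq_le η
  have h2 := H.fusionRate_nonneg η
  have h3 := H.one_le
  nlinarith [one_le_pow₀ h3 (n := 2)]

lemma displacement_nonneg (H : Scheme K r K₀ K₁ al be R₀ R₁ mu sg B ε fin W N) {η : ℝ × ℝ}
    (h : η ∈ IsoRegion) :
    0 ≤ fusionRate r ε (stepSize ε (fin.real univ) N) N η * excess η :=
  mul_nonneg (H.fusionRate_nonneg η) (iso_excess_nonneg h)

lemma displacement_le (H : Scheme K r K₀ K₁ al be R₀ R₁ mu sg B ε fin W N) {η : ℝ × ℝ}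
    (h : η ∈ IsoRegion) :
    fusionRate r ε (stepSize ε (fin.real univ) N) N η * excess η ≤ 1 / N := by
  have h3 := H.one_le
  have h0 : 0 < N := by linarith
  rcases le_or_gt η.1 N with h4 | h4
  · rw [le_div_iff₀ h0]
    have h1 := H.fusionRate_mul_sq_le η
    have h2 := H.fusionRate_nonneg η
    have h5 := (iso_excess_le h).trans h4
    calc _ ≤ fusionRate r ε (stepSize ε (fin.real univ) N) N η * N * N := by gcongr
      _ ≤ 1 := by rw [mul_assoc, ← sq]; exact h1
  · rw [fusionRate, truncFusion_eq_zero h4]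
    simp only [mul_zero, zero_mul]
    positivity

lemma fusionMove_mem (H : Scheme K r K₀ K₁ al be R₀ R₁ mu sg B ε fin W N) {η : ℝ × ℝ}
    (h : η ∈ IsoRegion) : fusionMove r ε (stepSize ε (fin.real univ) N) N η ∈ IsoRegion := by
  refine ⟨h.1, ?_⟩
  have h1 := H.fusionRate_le_one η
  have h2 := iso_excess_nonneg h
  have h3 : c0 * η.2 ^ ((2 : ℝ) / 3) = η.1 - excess η := by unfold excess; ring
  change c0 * η.2 ^ ((2 : ℝ) / 3) ≤ η.1 - _
  rw [h3]
  nlinarith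

lemma measurable_fusionRate (H : Scheme K r K₀ K₁ al be R₀ R₁ mu sg B ε fin W N) (h : ℝ) :
    Measurable (fusionRate r ε h N) := by
  have := H.fusion.measurable_trunc N
  unfold fusionRate; fun_prop

lemma measurable_fusionMove (H : Scheme K r K₀ K₁ al be R₀ R₁ mu sg B ε fin W N) (h : ℝ) :
    Measurable (fusionMove r ε h N) := by
  have := H.measurable_fusionRate h
  have := continuous_excess.measurable
  unfold fusionMove; fun_prop

lemma stepAdmissible (H : Scheme K r K₀ K₁ al be R₀ R₁ mu sg B ε fin W N) {m : Measure (ℝ × ℝ)}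
    [hm : IsFiniteMeasure m] (hle : m.real univ ≤ fin.real univ) :
    StepAdmissible (truncKernel K N) (fusionMove r ε (stepSize ε (fin.real univ) N) N)
      (stepSize ε (fin.real univ) N) N m where
  measurable_kernel := H.coag.measurable_trunc N
  kernel_nonneg := H.coag.trunc_nonneg (by linarith [H.one_le])
  kernel_le := truncKernel_le (by linarith [H.one_le])
  kernel_symm := H.coag.trunc_symm N
  measurable_move := H.measurable_fusionMove _
  step_nonneg := H.stepSize_pos.le
  finite := hm
  step_le := by
    have h1 := H.stepSize_pos
    have h2 := H.eps_mem
    have h3 := H.one_le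
    have h5 := H.stepSize_mul_le
    have h6 : 0 ≤ m.real univ := measureReal_nonneg
    have h7 : N ≤ N ^ 3 := le_self_pow₀ h3 (by norm_num)
    have : stepSize ε (fin.real univ) N * N * m.real univ ≤
        stepSize ε (fin.real univ) N * N ^ 3 * (1 + fin.real univ) := by
      gcongr
      linarith
    linarith [h2.2]

lemma discreteSol_zero : discreteSol K r ε fin N 0 = fin := rfl

lemma discreteSol_succ (k : ℕ) : discreteSol K r ε fin N (k + 1) =
    eulerStep (truncKernel K N) (fusionMove r ε (stepSize ε (fin.real univ) N) N)
      (stepSize ε (fin.real univ) N) (discreteSol K r ε fin N k) :=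
  Function.iterate_succ_apply' _ _ _

lemma discreteSol_basic (H : Scheme K r K₀ K₁ al be R₀ R₁ mu sg B ε fin W N) (k : ℕ) :
    IsFiniteMeasure (discreteSol K r ε fin N k) ∧ IsIsoMeasure (discreteSol K r ε fin N k) ∧
      discreteSol K r ε fin N k univ ≤ fin univ := by
  have hf := H.momentLe.isFiniteMeasure
  induction k with
  | zero => exact ⟨hf, H.momentLe.iso, le_rfl⟩
  | succ k ih =>
    obtain ⟨i1, i2, i3⟩ := ih
    have A := H.stepAdmissible (m := discreteSol K r ε fin N k)
      (ENNReal.toReal_mono (measure_ne_top _ _) i3)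
    have hiso : ∀ᵐ η ∂(discreteSol K r ε fin N k), η ∈ IsoRegion := i2
    have hiso2 : ∀ᵐ q ∂((discreteSol K r ε fin N k).prod (discreteSol K r ε fin N k)),
        q.1 ∈ IsoRegion ∧ q.2 ∈ IsoRegion :=
      (Measure.quasiMeasurePreserving_fst.ae hiso).and
        (Measure.quasiMeasurePreserving_snd.ae hiso)
    rw [discreteSol_succ]
    refine ⟨A.isFiniteMeasure_eulerStep, ?_, ?_⟩
    · have h1 := A.lintegral_eulerStep_le_of_subadditive (φ := IsoRegionᶜ.indicator 1)
        (measurable_one.indicator measurableSet_isoRegion.compl)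
        (hiso.mono fun η hη => by
          rw [Set.indicator_of_notMem (Set.notMem_compl_iff.2 (H.fusionMove_mem hη))]
          exact zero_le)
        (hiso2.mono fun q hq => by
          rw [Set.indicator_of_notMem (Set.notMem_compl_iff.2 (iso_add hq.1 hq.2))]
          exact zero_le)
      rw [lintegral_indicator_one measurableSet_isoRegion.compl,
        lintegral_indicator_one measurableSet_isoRegion.compl] at h1
      exact le_antisymm (h1.trans_eq i2) (zero_le)
    · have h1 := A.lintegral_eulerStep_le_of_subadditive (φ := fun _ => 1) measurable_const
        (by simp) (by simp)
      simp only [lintegral_one] at h1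
      exact h1.trans i3

lemma discrete_isFiniteMeasure (H : Scheme K r K₀ K₁ al be R₀ R₁ mu sg B ε fin W N) (k : ℕ) :
    IsFiniteMeasure (discreteSol K r ε fin N k) := (H.discreteSol_basic k).1

lemma discrete_ae_iso (H : Scheme K r K₀ K₁ al be R₀ R₁ mu sg B ε fin W N) (k : ℕ) :
    ∀ᵐ η ∂(discreteSol K r ε fin N k), η ∈ IsoRegion := (H.discreteSol_basic k).2.1

lemma discrete_ae_prod_iso (H : Scheme K r K₀ K₁ al be R₀ R₁ mu sg B ε fin W N) (k : ℕ) :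
    ∀ᵐ q ∂((discreteSol K r ε fin N k).prod (discreteSol K r ε fin N k)),
      q.1 ∈ IsoRegion ∧ q.2 ∈ IsoRegion :=
  have := H.discrete_isFiniteMeasure k
  (Measure.quasiMeasurePreserving_fst.ae (H.discrete_ae_iso k)).and
    (Measure.quasiMeasurePreserving_snd.ae (H.discrete_ae_iso k))

lemma discrete_admissible (H : Scheme K r K₀ K₁ al be R₀ R₁ mu sg B ε fin W N) (k : ℕ) :
    StepAdmissible (truncKernel K N) (fusionMove r ε (stepSize ε (fin.real univ) N) N)
      (stepSize ε (fin.real univ) N) N (discreteSol K r ε fin N k) := by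
  have hf := H.momentLe.isFiniteMeasure
  obtain ⟨i1, i2, i3⟩ := H.discreteSol_basic k
  exact H.stepAdmissible (ENNReal.toReal_mono (measure_ne_top _ _) i3)

/-- The dissipation of area along the scheme. -/
lemma discrete_area (H : Scheme K r K₀ K₁ al be R₀ R₁ mu sg B ε fin W N) (k : ℕ) :
    ∫⁻ η, ENNReal.ofReal η.1 ∂(discreteSol K r ε fin N k) +
      ∑ j ∈ Finset.range k, 2⁻¹ * ∫⁻ η, ENNReal.ofReal
        (fusionRate r ε (stepSize ε (fin.real univ) N) N η * excess η)
          ∂(discreteSol K r ε fin N j) ≤ ENNReal.ofReal W := by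
  induction k with
  | zero =>
    simp only [Finset.range_zero, Finset.sum_empty, add_zero, discreteSol_zero]
    exact (lintegral_mono_ae (H.momentLe.ae_iso.mono fun η hη =>
      ENNReal.ofReal_le_ofReal (iso_fst_le_weight hη))).trans H.momentLe.lintegral_le
  | succ k ih =>
    have hr := H.measurable_fusionRate (stepSize ε (fin.real univ) N)
    have he := continuous_excess.measurable
    have h1 := (H.discrete_admissible k).lintegral_eulerStep_le
      (φ := fun η => ENNReal.ofReal η.1) (d := fun η => ENNReal.ofReal
        (fusionRate r ε (stepSize ε (fin.real univ) N) N η * excess η)) (c := 0)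
      (by fun_prop) (by fun_prop)
      ((H.discrete_ae_iso k).mono fun η hη => by
        rw [← ENNReal.ofReal_add (iso_fst_pos (H.fusionMove_mem hη)).le
          (H.displacement_nonneg hη)]
        refine ENNReal.ofReal_le_ofReal ?_
        simp [fusionMove])
      ((H.discrete_ae_prod_iso k).mono fun q hq => by
        simp only [Prod.fst_add, Pi.zero_apply, add_zero]
        exact ENNReal.ofReal_add_le)
    simp only [Pi.zero_apply, mul_zero, lintegral_zero, add_zero] at h1
    rw [Finset.sum_range_succ, discreteSol_succ]
    refine le_trans ?_ ih
    calc _ = _ := by rw [add_comm (∑ j ∈ _, _), ← add_assoc]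
      _ ≤ _ := by gcongr

/-- Moments of low order in the volume are nonincreasing along the scheme. -/
lemma discrete_low_moment (H : Scheme K r K₀ K₁ al be R₀ R₁ mu sg B ε fin W N) (k : ℕ) :
    ∫⁻ η, ENNReal.ofReal (η.2 ^ (-1 : ℝ) + 1 + η.2 + η.1) ∂(discreteSol K r ε fin N k) ≤
      ENNReal.ofReal (3 * W) := by
  induction k with
  | zero =>
    have h1 : ∫⁻ η, ENNReal.ofReal (3 * weight η) ∂fin ≤ ENNReal.ofReal (3 * W) := by
      have := measurable_weight
      simp_rw [ENNReal.ofReal_mul (show (0 : ℝ) ≤ 3 by norm_num)]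
      rw [lintegral_const_mul _ (by fun_prop)]
      gcongr
      exact H.momentLe.lintegral_le
    refine (lintegral_mono_ae (H.momentLe.ae_iso.mono fun η hη =>
      ENNReal.ofReal_le_ofReal ?_)).trans h1
    have h2 := iso_one_le_weight hη
    have h3 := iso_snd_le_weight hη
    have h4 := Real.rpow_nonneg hη.1.le 2
    unfold weight at *
    linarith
  | succ k ih =>
    rw [discreteSol_succ]
    refine le_trans ((H.discrete_admissible k).lintegral_eulerStep_le_of_subadditive
      (φ := fun η => ENNReal.ofReal (η.2 ^ (-1 : ℝ) + 1 + η.2 + η.1)) (by fun_prop) ?_ ?_) ih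
    · filter_upwards [H.discrete_ae_iso k] with η hη
      refine ENNReal.ofReal_le_ofReal ?_
      have := H.displacement_nonneg hη
      simp only [fusionMove]
      linarith
    · filter_upwards [H.discrete_ae_prod_iso k] with q hq
      have a1 := Real.rpow_nonneg hq.1.1.le (-1)
      have a2 := Real.rpow_nonneg hq.2.1.le (-1)
      have a3 := iso_fst_pos hq.1
      have a4 := iso_fst_pos hq.2
      have a5 := hq.1.1
      have a6 := hq.2.1
      rw [← ENNReal.ofReal_add (by positivity) (by positivity)]
      refine ENNReal.ofReal_le_ofReal ?_
      have : (q.1.2 + q.2.2) ^ (-1 : ℝ) ≤ q.1.2 ^ (-1 : ℝ) :=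
        Real.rpow_le_rpow_of_nonpos a5 (by linarith) (by norm_num)
      simp only [Prod.fst_add, Prod.snd_add]
      linarith

end Scheme

end Scheme

/-! ### The derivative in the area variable -/

section AreaDerivative

variable {φ : ℝ × ℝ → ℝ}

lemma hasDerivAt_da (hφ : Differentiable ℝ φ) (x v : ℝ) :
    HasDerivAt (fun a => φ (a, v)) (da φ (x, v)) x :=
  DifferentiableAt.hasDerivAt (hφ.comp (by fun_prop : Differentiable ℝ fun a : ℝ => (a, v)) x)

lemma da_eq_fderiv (hφ : Differentiable ℝ φ) (η : ℝ × ℝ) : da φ η = fderiv ℝ φ η (1, 0) := by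
  have h1 : HasDerivAt (fun a : ℝ => (a, η.2)) ((1 : ℝ), (0 : ℝ)) η.1 :=
    (hasDerivAt_id _).prodMk (hasDerivAt_const _ _)
  exact ((hφ η).hasFDerivAt.comp_hasDerivAt (x := η.1) (f := fun a => (a, η.2)) h1).deriv

lemma continuous_da (hφ : ContDiff ℝ 1 φ) : Continuous (da φ) := by
  have : da φ = fun η => fderiv ℝ φ η (1, 0) :=
    funext fun η => da_eq_fderiv (hφ.differentiable one_ne_zero) η
  rw [this]
  exact (hφ.continuous_fderiv one_ne_zero).clm_apply continuous_const

lemma da_eq_zero {η : ℝ × ℝ} (h : η ∉ tsupport φ) : da φ η = 0 := by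
  have h1 : φ =ᶠ[𝓝 η] 0 := notMem_tsupport_iff_eventuallyEq.1 h
  have h2 : (fun a => φ (a, η.2)) =ᶠ[𝓝 η.1] fun _ => 0 := by
    have : Tendsto (fun a : ℝ => (a, η.2)) (𝓝 η.1) (𝓝 η) :=
      (Continuous.prodMk_left η.2).tendsto' _ _ rfl
    exact this.eventually h1
  rw [da, h2.deriv_eq, deriv_const]

lemma IsCcQuad.da (hc : IsCcQuad φ) (hφ : ContDiff ℝ 1 φ) : IsCcQuad (da φ) :=
  isCcQuad_of_eq_zero (continuous_da hφ) hc.2.1 hc.2.2 fun _ h => da_eq_zero h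

lemma abs_sub_add_mul_da_le (hφ : Differentiable ℝ φ) {η : ℝ × ℝ} {d ω : ℝ} (hd : 0 ≤ d)
    (hω : ∀ x, |x - η.1| ≤ d → |da φ (x, η.2) - da φ η| ≤ ω) :
    |φ (η.1 - d, η.2) - φ η + d * da φ η| ≤ ω * d := by
  have h1 : ∀ x ∈ Icc (η.1 - d) η.1, HasDerivWithinAt (fun a => φ (a, η.2) - a * da φ η)
      (da φ (x, η.2) - 1 * da φ η) (Icc (η.1 - d) η.1) x := fun x _ =>
    ((hasDerivAt_da hφ x η.2).sub ((hasDerivAt_id x).mul_const _)).hasDerivWithinAt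
  have h2 := (convex_Icc (η.1 - d) η.1).norm_image_sub_le_of_norm_hasDerivWithin_le (C := ω) h1
    (fun x hx => by
      rw [one_mul]
      exact hω x (abs_le.2 ⟨by linarith [hx.1], by linarith [hx.2]⟩))
    (right_mem_Icc.2 (by linarith)) (left_mem_Icc.2 (by linarith))
  simp only [Real.norm_eq_abs] at h2
  have e1 : η.1 - d - η.1 = -d := by ring
  rw [e1, abs_neg, abs_of_nonneg hd] at h2
  convert h2 using 2
  ring

end AreaDerivative

/-- The (weak form of the) coagulation and fusion operator with kernels `κ` and `c * ρ`. -/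
def generator (κ : (ℝ × ℝ) × (ℝ × ℝ) → ℝ) (ρ : ℝ × ℝ → ℝ) (c : ℝ) (φ : ℝ × ℝ → ℝ)
    (m : Measure (ℝ × ℝ)) : ℝ :=
  1 / 2 * ∫ q, κ q * (φ (q.1 + q.2) - φ q.1 - φ q.2) ∂(m.prod m)
    - c * ∫ η, ρ η * excess η * da φ η ∂m

namespace Scheme

variable {K : ℝ × ℝ → ℝ × ℝ → ℝ} {r : ℝ × ℝ → ℝ}
    {K₀ K₁ al be R₀ R₁ mu sg B ε : ℝ} {fin : Measure (ℝ × ℝ)} {W N : ℝ}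

lemma kernel_mul_le (hK : IsCoagKernel K K₀ K₁ al be) {η η' : ℝ × ℝ} (h : η ∈ Quad)
    (h' : η' ∈ Quad) : K η η' * (2 * η.2 * η'.2) ≤
      2 * K₀ * ((1 + η.2) * (η'.2 + η'.2 ^ (2 : ℝ)) + (η.2 + η.2 ^ (2 : ℝ)) * (1 + η'.2)) := by
  have hal := hK.al_mem
  have hbe := hK.be_mem
  have hK0 := hK.K0_pos
  have p := h.2
  have p' := h'.2
  have aux {v : ℝ} (hv : 0 < v) : v ^ (-al) * v ≤ 1 + v ∧ v ^ be * v ≤ v + v ^ (2 : ℝ) := by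
    constructor
    · rw [← Real.rpow_add_one hv.ne']
      exact rpow_le_one_add hv (by linarith [hal.2]) (by linarith [hal.1])
    · have := mul_le_mul_of_nonneg_right (rpow_le_one_add hv hbe.1.le hbe.2.le) hv.le
      rw [Real.rpow_two]
      linarith [this, sq v]
  obtain ⟨a1, a2⟩ := aux p
  obtain ⟨b1, b2⟩ := aux p'
  have c1 := Real.rpow_pos_of_pos p be
  have c2 := Real.rpow_pos_of_pos p' be
  have c3 := Real.rpow_pos_of_pos p (-al)
  have c4 := Real.rpow_pos_of_pos p' (-al)
  calc K η η' * (2 * η.2 * η'.2)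
      ≤ K₀ * (η.2 ^ (-al) * η'.2 ^ be + η'.2 ^ (-al) * η.2 ^ be) * (2 * η.2 * η'.2) := by
        gcongr
        exact hK.upper η h η' h'
    _ = 2 * K₀ * ((η.2 ^ (-al) * η.2) * (η'.2 ^ be * η'.2) +
        (η.2 ^ be * η.2) * (η'.2 ^ (-al) * η'.2)) := by ring
    _ ≤ _ := by gcongr

/-- Growth of the second moment in the volume along the scheme. -/
lemma discrete_sq_moment (H : Scheme K r K₀ K₁ al be R₀ R₁ mu sg B ε fin W N) (k : ℕ) :
    ENNReal.ofReal (3 * W) + ∫⁻ η, ENNReal.ofReal (η.2 ^ (2 : ℝ)) ∂(discreteSol K r ε fin N k) ≤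
      ENNReal.ofReal
        (Real.exp (6 * K₀ * W * (k * stepSize ε (fin.real univ) N)) * (4 * W)) := by
  have hW := H.W_nonneg
  have hK0 := H.coag.K0_pos
  have hh := H.stepSize_pos
  have hκ := H.coag.measurable_trunc N
  set h := stepSize ε (fin.real univ) N with h_def
  induction k with
  | zero =>
    have h1 : ∫⁻ η, ENNReal.ofReal (η.2 ^ (2 : ℝ)) ∂fin ≤ ENNReal.ofReal W := by
      refine (lintegral_mono_ae (H.momentLe.ae_iso.mono fun η hη =>
        ENNReal.ofReal_le_ofReal ?_)).trans H.momentLe.lintegral_le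
      have := Real.rpow_nonneg hη.1.le (-1)
      have := iso_fst_pos hη
      unfold weight; linarith
    rw [discreteSol_zero]
    calc _ ≤ ENNReal.ofReal (3 * W) + ENNReal.ofReal W := by gcongr
      _ = _ := by
        rw [← ENNReal.ofReal_add (by positivity) hW]
        congr 1
        simp only [Nat.cast_zero, zero_mul, mul_zero, Real.exp_zero]
        ring
  | succ k ih =>
    set m := discreteSol K r ε fin N k with hm
    have hfm : IsFiniteMeasure m := H.discrete_isFiniteMeasure k
    set X := ENNReal.ofReal (3 * W) + ∫⁻ η, ENNReal.ofReal (η.2 ^ (2 : ℝ)) ∂m with hX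
    have h1 := (H.discrete_admissible k).lintegral_eulerStep_le
      (φ := fun η => ENNReal.ofReal (η.2 ^ (2 : ℝ))) (d := 0)
      (c := fun q => ENNReal.ofReal (2 * q.1.2 * q.2.2))
      (by fun_prop) measurable_zero (ae_of_all _ fun η => by simp [fusionMove])
      ((H.discrete_ae_prod_iso k).mono fun q hq => by
        have := hq.1.1
        have := hq.2.1
        rw [← ENNReal.ofReal_add (by positivity) (by positivity),
          ← ENNReal.ofReal_add (by positivity) (by positivity)]
        refine ENNReal.ofReal_le_ofReal (le_of_eq ?_)
        simp only [Prod.snd_add, Real.rpow_two]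
        ring)
    have low := H.discrete_low_moment k
    have m1 : ∫⁻ η, ENNReal.ofReal (1 + η.2) ∂m ≤ ENNReal.ofReal (3 * W) := by
      refine le_trans (lintegral_mono_ae ((H.discrete_ae_iso k).mono fun η hη =>
        ENNReal.ofReal_le_ofReal ?_)) low
      have := Real.rpow_nonneg hη.1.le (-1)
      have := iso_fst_pos hη
      linarith
    have m2 : ∫⁻ η, ENNReal.ofReal (η.2 + η.2 ^ (2 : ℝ)) ∂m ≤ X := by
      have : ∫⁻ η, ENNReal.ofReal η.2 ∂m ≤ ENNReal.ofReal (3 * W) := by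
        refine le_trans (lintegral_mono_ae ((H.discrete_ae_iso k).mono fun η hη =>
          ENNReal.ofReal_le_ofReal ?_)) low
        have := Real.rpow_nonneg hη.1.le (-1)
        have := iso_fst_pos hη
        linarith
      calc _ ≤ ∫⁻ η, (ENNReal.ofReal η.2 + ENNReal.ofReal (η.2 ^ (2 : ℝ))) ∂m :=
            lintegral_mono fun η => ENNReal.ofReal_add_le
        _ = ∫⁻ η, ENNReal.ofReal η.2 ∂m + ∫⁻ η, ENNReal.ofReal (η.2 ^ (2 : ℝ)) ∂m :=
            lintegral_add_left (by fun_prop) _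
        _ ≤ X := by rw [hX]; gcongr
    have h2 : ∫⁻ q, ENNReal.ofReal (truncKernel K N q) * ENNReal.ofReal (2 * q.1.2 * q.2.2)
        ∂(m.prod m) ≤ ENNReal.ofReal (2 * K₀) * (2 * (ENNReal.ofReal (3 * W) * X)) := by
      calc _ ≤ ∫⁻ q, ENNReal.ofReal (2 * K₀) *
            (ENNReal.ofReal (1 + q.1.2) * ENNReal.ofReal (q.2.2 + q.2.2 ^ (2 : ℝ)) +
              ENNReal.ofReal (q.1.2 + q.1.2 ^ (2 : ℝ)) * ENNReal.ofReal (1 + q.2.2))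
              ∂(m.prod m) := by
            refine lintegral_mono_ae ((H.discrete_ae_prod_iso k).mono fun q hq => ?_)
            have q1 := isoRegion_subset_quad hq.1
            have q2 := isoRegion_subset_quad hq.2
            have p1 := hq.1.1
            have p2 := hq.2.1
            rw [← ENNReal.ofReal_mul (H.coag.trunc_nonneg (by linarith [H.one_le]) q),
              ← ENNReal.ofReal_mul (by positivity), ← ENNReal.ofReal_mul (by positivity),
              ← ENNReal.ofReal_add (by positivity) (by positivity),
              ← ENNReal.ofReal_mul (by positivity)]
            refine ENNReal.ofReal_le_ofReal (le_trans ?_ (kernel_mul_le H.coag q1 q2))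
            gcongr
            exact truncKernel_le_self ⟨q1, q2⟩
        _ = ENNReal.ofReal (2 * K₀) *
            ((∫⁻ η, ENNReal.ofReal (1 + η.2) ∂m) *
                (∫⁻ η, ENNReal.ofReal (η.2 + η.2 ^ (2 : ℝ)) ∂m) +
              (∫⁻ η, ENNReal.ofReal (η.2 + η.2 ^ (2 : ℝ)) ∂m) *
                ∫⁻ η, ENNReal.ofReal (1 + η.2) ∂m) := by
            rw [lintegral_const_mul _ (by fun_prop), lintegral_add_left (by fun_prop),
              lintegral_prod_mul (f := fun η : ℝ × ℝ => ENNReal.ofReal (1 + η.2))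
                (g := fun η : ℝ × ℝ => ENNReal.ofReal (η.2 + η.2 ^ (2 : ℝ)))
                (by fun_prop) (by fun_prop),
              lintegral_prod_mul (f := fun η : ℝ × ℝ => ENNReal.ofReal (η.2 + η.2 ^ (2 : ℝ)))
                (g := fun η : ℝ × ℝ => ENNReal.ofReal (1 + η.2)) (by fun_prop) (by fun_prop)]
        _ ≤ ENNReal.ofReal (2 * K₀) * (ENNReal.ofReal (3 * W) * X + X * ENNReal.ofReal (3 * W)) :=
            by gcongr
        _ = _ := by ring
    have h3 : ENNReal.ofReal (3 * W) +
        ∫⁻ η, ENNReal.ofReal (η.2 ^ (2 : ℝ)) ∂(discreteSol K r ε fin N (k + 1)) ≤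
        ENNReal.ofReal (Real.exp (6 * K₀ * W * h)) * X := by
      rw [discreteSol_succ]
      simp only [Pi.zero_apply, lintegral_zero, mul_zero, add_zero] at h1
      calc _ ≤ ENNReal.ofReal (3 * W) + (∫⁻ η, ENNReal.ofReal (η.2 ^ (2 : ℝ)) ∂m +
            ENNReal.ofReal (h / 2) *
              (ENNReal.ofReal (2 * K₀) * (2 * (ENNReal.ofReal (3 * W) * X)))) := by
            gcongr
            exact h1.trans (by gcongr)
        _ = (1 + ENNReal.ofReal (h / 2) * ENNReal.ofReal (2 * K₀) * ENNReal.ofReal 2 *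
              ENNReal.ofReal (3 * W)) * X := by
            rw [← add_assoc, ← hX, show ENNReal.ofReal 2 = 2 by simp]; ring
        _ ≤ _ := by
            gcongr
            rw [← ENNReal.ofReal_mul (by positivity), ← ENNReal.ofReal_mul (by positivity),
              ← ENNReal.ofReal_mul (by positivity), ← ENNReal.ofReal_one,
              ← ENNReal.ofReal_add zero_le_one (by positivity)]
            refine ENNReal.ofReal_le_ofReal ?_
            have := Real.add_one_le_exp (6 * K₀ * W * h)
            linarith
    calc _ ≤ ENNReal.ofReal (Real.exp (6 * K₀ * W * h)) * X := h3
      _ ≤ ENNReal.ofReal (Real.exp (6 * K₀ * W * h)) *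
          ENNReal.ofReal (Real.exp (6 * K₀ * W * (k * h)) * (4 * W)) := by gcongr
      _ = _ := by
          rw [← ENNReal.ofReal_mul (Real.exp_pos _).le, ← mul_assoc, ← Real.exp_add]
          congr 3
          push_cast
          ring

lemma discrete_momentLe (H : Scheme K r K₀ K₁ al be R₀ R₁ mu sg B ε fin W N) (k : ℕ) :
    MomentLe (Real.exp (6 * K₀ * W * (k * stepSize ε (fin.real univ) N)) * (4 * W))
      (discreteSol K r ε fin N k) := by
  refine ⟨H.discrete_ae_iso k, le_trans ?_ (H.discrete_sq_moment k)⟩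
  calc _ ≤ ∫⁻ η, (ENNReal.ofReal (η.2 ^ (-1 : ℝ) + 1 + η.2 + η.1) +
        ENNReal.ofReal (η.2 ^ (2 : ℝ))) ∂(discreteSol K r ε fin N k) := by
        refine lintegral_mono_ae ((H.discrete_ae_iso k).mono fun η hη => ?_)
        refine (ENNReal.ofReal_le_ofReal ?_).trans ENNReal.ofReal_add_le
        have := hη.1
        unfold weight; linarith
    _ = _ := lintegral_add_right _ (by fun_prop)
    _ ≤ _ := by gcongr; exact H.discrete_low_moment k

lemma integrable_displacement (H : Scheme K r K₀ K₁ al be R₀ R₁ mu sg B ε fin W N) (k : ℕ) :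
    Integrable (fun η => fusionRate r ε (stepSize ε (fin.real univ) N) N η * excess η)
      (discreteSol K r ε fin N k) := by
  have := H.discrete_isFiniteMeasure k
  have hr := H.measurable_fusionRate (stepSize ε (fin.real univ) N)
  have he := continuous_excess.measurable
  refine Integrable.of_bound (by fun_prop) (1 / N) ((H.discrete_ae_iso k).mono fun η hη => ?_)
  rw [Real.norm_of_nonneg (H.displacement_nonneg hη)]
  exact H.displacement_le hη

lemma integral_displacement (k : ℕ) :
    1 / 2 * ∫ η, fusionRate r ε (stepSize ε (fin.real univ) N) N η * excess η
      ∂(discreteSol K r ε fin N k) = stepSize ε (fin.real univ) N *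
        (ε⁻¹ * ∫ η, truncFusion r N η * excess η ∂(discreteSol K r ε fin N k)) := by
  simp only [fusionRate, mul_assoc]
  rw [integral_const_mul, integral_const_mul, integral_const_mul]
  ring

/-- The total fusion along the scheme is bounded by the initial area. -/
lemma sum_fusion_le (H : Scheme K r K₀ K₁ al be R₀ R₁ mu sg B ε fin W N) (k : ℕ) :
    ∑ j ∈ Finset.range k, stepSize ε (fin.real univ) N *
      (ε⁻¹ * ∫ η, truncFusion r N η * excess η ∂(discreteSol K r ε fin N j)) ≤ W := by
  have h1 := le_trans le_add_self (H.discrete_area k)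
  have h2 (j : ℕ) : 2⁻¹ * ∫⁻ η, ENNReal.ofReal
        (fusionRate r ε (stepSize ε (fin.real univ) N) N η * excess η)
          ∂(discreteSol K r ε fin N j) = ENNReal.ofReal (stepSize ε (fin.real univ) N *
      (ε⁻¹ * ∫ η, truncFusion r N η * excess η ∂(discreteSol K r ε fin N j))) := by
    rw [← integral_displacement, ENNReal.ofReal_mul (by norm_num),
      ofReal_integral_eq_lintegral_ofReal (H.integrable_displacement j)
        ((H.discrete_ae_iso j).mono fun η hη => H.displacement_nonneg hη)]
    congr 1
    rw [one_div, ENNReal.ofReal_inv_of_pos (by norm_num)]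
    norm_num
  simp only [h2] at h1
  rw [← ENNReal.ofReal_sum_of_nonneg] at h1
  · exact (ENNReal.ofReal_le_ofReal_iff H.W_nonneg).1 h1
  · intro j _
    rw [← integral_displacement]
    exact mul_nonneg (by norm_num) (integral_nonneg_of_ae
      ((H.discrete_ae_iso j).mono fun η hη => H.displacement_nonneg hη))

/-- Consistency of one step of the scheme. -/
lemma discrete_consistency (H : Scheme K r K₀ K₁ al be R₀ R₁ mu sg B ε fin W N)
    {φ : ℝ × ℝ → ℝ} (hφ : ContDiff ℝ 1 φ) (hc : IsCcQuad φ) {ω : ℝ}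
    (hω : ∀ η : ℝ × ℝ, ∀ x, |x - η.1| ≤ 1 / N → |da φ (x, η.2) - da φ η| ≤ ω) (k : ℕ) :
    |∫ η, φ η ∂(discreteSol K r ε fin N (k + 1)) - ∫ η, φ η ∂(discreteSol K r ε fin N k) -
      stepSize ε (fin.real univ) N *
        generator (truncKernel K N) (truncFusion r N) ε⁻¹ φ (discreteSol K r ε fin N k)| ≤
    ω * (stepSize ε (fin.real univ) N *
      (ε⁻¹ * ∫ η, truncFusion r N η * excess η ∂(discreteSol K r ε fin N k))) := by
  obtain ⟨C, -, hC⟩ := hc.exists_bound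
  obtain ⟨C', -, hC'⟩ := (hc.da hφ).exists_bound
  have hfm := H.discrete_isFiniteMeasure k
  have hr := H.measurable_fusionRate (stepSize ε (fin.real univ) N)
  have he := continuous_excess.measurable
  have hd := (continuous_da hφ).measurable
  have hφm := hφ.continuous.measurable
  have hΦ := H.measurable_fusionMove (stepSize ε (fin.real univ) N)
  rw [discreteSol_succ, (H.discrete_admissible k).integral_eulerStep hφ.continuous.measurable hC,
    ← integral_displacement]
  set m := discreteSol K r ε fin N k with hm
  have e1 : stepSize ε (fin.real univ) N * (ε⁻¹ *
      ∫ η, truncFusion r N η * excess η * da φ η ∂m) = 1 / 2 * ∫ η,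
        fusionRate r ε (stepSize ε (fin.real univ) N) N η * excess η * da φ η ∂m := by
    simp only [fusionRate, mul_assoc]
    rw [integral_const_mul, integral_const_mul, integral_const_mul]
    ring
  have i1 : Integrable (fun η =>
      fusionRate r ε (stepSize ε (fin.real univ) N) N η * excess η * da φ η) m :=
    (H.integrable_displacement k).mul_bdd (c := C') hd.aestronglyMeasurable (ae_of_all _ hC')
  have i2 : Integrable (fun η => φ (fusionMove r ε (stepSize ε (fin.real univ) N) N η) - φ η) m :=
    (Integrable.of_bound (hφm.comp hΦ).aestronglyMeasurable C (ae_of_all _ fun _ => hC _)).sub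
      (Integrable.of_bound hφm.aestronglyMeasurable C (ae_of_all _ hC))
  have e2 : ∀ a b c d : ℝ, a + 1 / 2 * b + stepSize ε (fin.real univ) N / 2 * c - a -
      stepSize ε (fin.real univ) N * (1 / 2 * c - d) =
      1 / 2 * b + stepSize ε (fin.real univ) N * d := by intros; ring
  rw [generator, e2, e1, ← mul_add, ← integral_add i2 i1, abs_mul,
    abs_of_nonneg (by norm_num : (0 : ℝ) ≤ 1 / 2), mul_left_comm, ← integral_const_mul]
  gcongr
  rw [← Real.norm_eq_abs]
  refine norm_integral_le_of_norm_le ((H.integrable_displacement k).const_mul ω)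
    ((H.discrete_ae_iso k).mono fun η hη => ?_)
  exact abs_sub_add_mul_da_le (hφ.differentiable one_ne_zero) (H.displacement_nonneg hη)
    fun x hx => hω η x (hx.trans (H.displacement_le hη))

end Scheme

/-! ### Vague convergence -/

section VagueConvergence

variable {ι : Type*} {l : Filter ι} {m : ι → Measure (ℝ × ℝ)} {m₀ : Measure (ℝ × ℝ)} {C : ℝ}

/-- Convergence of measures on the open quadrant against compactly supported functions. -/
def VagueTendsto (l : Filter ι) (m : ι → Measure (ℝ × ℝ)) (m₀ : Measure (ℝ × ℝ)) : Prop :=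
  ∀ φ, IsCcQuad φ → Tendsto (fun i => ∫ η, φ η ∂(m i)) l (𝓝 (∫ η, φ η ∂m₀))

lemma tendsto_of_forall_approx {x : ι → ℝ} {x₀ : ℝ} {D : ℝ} (hD : 0 < D)
    (h : ∀ δ > 0, ∃ (u : ι → ℝ) (u₀ : ℝ), Tendsto u l (𝓝 u₀) ∧ (∀ᶠ i in l, |x i - u i| ≤ D * δ) ∧
      |x₀ - u₀| ≤ D * δ) : Tendsto x l (𝓝 x₀) := by
  rw [Metric.tendsto_nhds]
  intro e he
  obtain ⟨u, u₀, h1, h2, h3⟩ := h (e / (3 * D)) (by positivity)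
  have e1 : D * (e / (3 * D)) = e / 3 := by field_simp
  rw [e1] at h3
  filter_upwards [h2, (Metric.tendsto_nhds.1 h1) (e / 3) (by positivity)] with i hi hi'
  rw [e1] at hi
  rw [Real.dist_eq] at hi' ⊢
  have : x i - x₀ = (x i - u i) + (u i - u₀) - (x₀ - u₀) := by ring
  rw [this]
  calc _ ≤ |x i - u i| + |u i - u₀| + |x₀ - u₀| :=
        (abs_sub _ _).trans (add_le_add_left (abs_add_le _ _) _)
    _ < e := by linarith

/-- Uniform approximation upgrades the class of test functions. -/
lemma VagueTendsto.tendsto_of_approx (h : VagueTendsto l m m₀) (hC : 0 ≤ C)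
    (hm : ∀ᶠ i in l, MomentLe C (m i)) (hm₀ : MomentLe C m₀) {φ : ℝ × ℝ → ℝ} (hφ : Continuous φ)
    {b : ℝ} (hb : ∀ η, |φ η| ≤ b)
    (happ : ∀ δ > 0, ∃ ψ, IsCcQuad ψ ∧ ∀ η, |φ η - ψ η| ≤ δ) :
    Tendsto (fun i => ∫ η, φ η ∂(m i)) l (𝓝 (∫ η, φ η ∂m₀)) := by
  refine tendsto_of_forall_approx (D := C + 1) (by linarith) fun δ hδ => ?_
  obtain ⟨ψ, hψ, hd⟩ := happ δ hδ
  obtain ⟨b', -, hb'⟩ := hψ.exists_bound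
  have key : ∀ μ : Measure (ℝ × ℝ), MomentLe C μ →
      |∫ η, φ η ∂μ - ∫ η, ψ η ∂μ| ≤ (C + 1) * δ := fun μ hμ => by
    rw [← integral_sub (hμ.integrable_of_bounded hφ.measurable hb)
      (hμ.integrable_of_bounded hψ.1.measurable hb')]
    refine (hμ.abs_integral_le hC hδ.le fun η _ => hd η).trans ?_
    nlinarith
  exact ⟨_, _, h ψ hψ, hm.mono fun i hi => key _ hi, key _ hm₀⟩

lemma VagueTendsto.tendsto_integral_prod (h : VagueTendsto l m m₀) (hC : 0 ≤ C)
    (hm : ∀ᶠ i in l, MomentLe C (m i)) (hm₀ : MomentLe C m₀) {F : (ℝ × ℝ) × (ℝ × ℝ) → ℝ}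
    (hF : Continuous F) {S : Set (ℝ × ℝ)} (hS : IsCompact S) (hSQ : S ⊆ Quad)
    (hFS : ∀ q ∉ S ×ˢ S, F q = 0) :
    Tendsto (fun i => ∫ q, F q ∂((m i).prod (m i))) l (𝓝 (∫ q, F q ∂(m₀.prod m₀))) := by
  have hcs : HasCompactSupport F := HasCompactSupport.intro (hS.prod hS) hFS
  obtain ⟨b, hb⟩ := hcs.exists_bound_of_continuous hF
  have hbn : 0 ≤ b := (norm_nonneg _).trans (hb 0)
  have hsec (η : ℝ × ℝ) : IsCcQuad fun η' => F (η, η') :=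
    isCcQuad_of_eq_zero (by fun_prop) hS hSQ fun η' hη' => hFS _ fun hq => hη' hq.2
  have hm₀f := hm₀.isFiniteMeasure
  set G : Measure (ℝ × ℝ) → ℝ × ℝ → ℝ := fun μ η => ∫ η', F (η, η') ∂μ with hG
  have hGc (μ : Measure (ℝ × ℝ)) (hμ : MomentLe C μ) : Continuous (G μ) := by
    have := hμ.isFiniteMeasure
    exact continuous_of_dominated (bound := fun _ => b)
      (fun η => (hsec η).1.aestronglyMeasurable) (fun η => ae_of_all _ fun η' => hb _)
      (integrable_const _) (ae_of_all _ fun η' => by fun_prop)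
  have hG0 (μ : Measure (ℝ × ℝ)) (η : ℝ × ℝ) (hη : η ∉ S) : G μ η = 0 := by
    rw [hG]
    exact integral_eq_zero_of_ae (ae_of_all _ fun η' => hFS _ fun hq => hη hq.1)
  have hGcc : IsCcQuad (G m₀) := isCcQuad_of_eq_zero (hGc _ hm₀) hS hSQ (hG0 m₀)
  have hGint (μ : Measure (ℝ × ℝ)) (hμ : MomentLe C μ) :
      ∫ q, F q ∂(μ.prod μ) = ∫ η, G μ η ∂μ := by
    have := hμ.isFiniteMeasure
    exact integral_prod _ (Integrable.of_bound hF.aestronglyMeasurable b (ae_of_all _ hb))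
  have huc := hcs.uniformContinuous_of_continuous hF
  -- uniform convergence of the partial integrals
  have hunif : ∀ δ > 0, ∀ᶠ i in l, ∀ η, |G (m i) η - G m₀ η| ≤ (2 * C + 1) * δ := by
    intro δ hδ
    obtain ⟨d, hd, hdF⟩ := Metric.uniformContinuous_iff.1 huc δ hδ
    have hclose (μ : Measure (ℝ × ℝ)) (hμ : MomentLe C μ) (η ζ : ℝ × ℝ) (hηζ : dist η ζ < d) :
        |G μ η - G μ ζ| ≤ δ * C := by
      have := hμ.isFiniteMeasure
      rw [hG, ← integral_sub (hμ.integrable_of_bounded (hsec η).1.measurable fun _ => hb _)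
        (hμ.integrable_of_bounded (hsec ζ).1.measurable fun _ => hb _)]
      refine hμ.abs_integral_le hC hδ.le fun η' _ => ?_
      have := hdF (a := (η, η')) (b := (ζ, η')) (by
        rw [Prod.dist_eq]; simpa using hηζ)
      exact this.le
    obtain ⟨t, -, htS⟩ := hS.elim_nhds_subcover (fun η => Metric.ball η d)
      fun η _ => Metric.ball_mem_nhds η hd
    have hev : ∀ᶠ i in l, ∀ ζ ∈ t, |G (m i) ζ - G m₀ ζ| ≤ δ := by
      rw [Filter.eventually_all_finset]
      intro ζ _
      filter_upwards [(Metric.tendsto_nhds.1 (h _ (hsec ζ))) δ hδ] with i hi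
      exact hi.le
    filter_upwards [hev, hm] with i hi hmi η
    by_cases hη : η ∈ S
    · obtain ⟨ζ, hζ, hηζ⟩ := mem_iUnion₂.1 (htS hη)
      have a1 := hclose _ hmi η ζ hηζ
      have a2 := hclose _ hm₀ η ζ hηζ
      have a3 := hi ζ hζ
      have : G (m i) η - G m₀ η = (G (m i) η - G (m i) ζ) + (G (m i) ζ - G m₀ ζ)
        - (G m₀ η - G m₀ ζ) := by ring
      rw [this]
      calc _ ≤ |G (m i) η - G (m i) ζ| + |G (m i) ζ - G m₀ ζ| + |G m₀ η - G m₀ ζ| :=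
            (abs_sub _ _).trans (add_le_add_left (abs_add_le _ _) _)
        _ ≤ _ := by linarith
    · rw [hG0 _ η hη, hG0 _ η hη, sub_zero, abs_zero]
      positivity
  refine tendsto_of_forall_approx (D := (2 * C + 1) * C + 1) (by positivity) fun δ hδ =>
    ⟨_, _, h _ hGcc, ?_, ?_⟩
  · filter_upwards [hunif δ hδ, hm] with i hi hmi
    obtain ⟨b1, -, hb1⟩ := hGcc.exists_bound
    have hb2 : ∀ η, |G (m i) η| ≤ b * C := fun η => hmi.abs_integral_le hC hbn fun _ _ => hb _
    rw [hGint _ hmi, ← integral_sub (hmi.integrable_of_bounded (hGc _ hmi).measurable hb2)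
      (hmi.integrable_of_bounded hGcc.1.measurable hb1)]
    refine (hmi.abs_integral_le hC (by positivity) fun η _ => hi η).trans ?_
    nlinarith
  · rw [hGint _ hm₀, sub_self, abs_zero]
    positivity

end VagueConvergence

section CoagulationTerm

variable {ι : Type*} {l : Filter ι} {m : ι → Measure (ℝ × ℝ)} {m₀ : Measure (ℝ × ℝ)} {C : ℝ}
  {K : ℝ × ℝ → ℝ × ℝ → ℝ} {K₀ K₁ al be : ℝ} {r : ℝ × ℝ → ℝ} {R₀ R₁ mu sg B : ℝ}

/-- The increment of an observable in the coagulation of two particles. -/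
def coagIncr (φ : ℝ × ℝ → ℝ) (q : (ℝ × ℝ) × (ℝ × ℝ)) : ℝ := φ (q.1 + q.2) - φ q.1 - φ q.2

lemma abs_coagIncr_le {φ : ℝ × ℝ → ℝ} {b : ℝ} (hb : ∀ η, |φ η| ≤ b) (q : (ℝ × ℝ) × (ℝ × ℝ)) :
    |coagIncr φ q| ≤ 3 * b := by
  have h1 := hb (q.1 + q.2)
  have h2 := hb q.1
  have h3 := hb q.2
  rw [abs_le] at *
  unfold coagIncr
  constructor <;> linarith [h1.1, h1.2, h2.1, h2.2, h3.1, h3.2]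

lemma continuous_coagIncr {φ : ℝ × ℝ → ℝ} (hφ : Continuous φ) : Continuous (coagIncr φ) := by
  unfold coagIncr; fun_prop

/-- Measurable kernels dominated by the product of the coagulation weights. -/
structure IsDominatedKernel (K₀ al be : ℝ) (κ : (ℝ × ℝ) × (ℝ × ℝ) → ℝ) : Prop where
  measurable : Measurable κ
  abs_le : ∀ q : (ℝ × ℝ) × (ℝ × ℝ), q.1 ∈ IsoRegion → q.2 ∈ IsoRegion →
    |κ q| ≤ K₀ * (coagWeight al be q.1 * coagWeight al be q.2)

lemma IsCoagKernel.isDominatedKernel_trunc (hK : IsCoagKernel K K₀ K₁ al be) {N : ℝ}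
    (hN : 0 ≤ N) : IsDominatedKernel K₀ al be (truncKernel K N) :=
  ⟨hK.measurable_trunc N, fun q h1 h2 => by
    rw [abs_of_nonneg (hK.trunc_nonneg hN q)]
    have q1 := isoRegion_subset_quad h1
    have q2 := isoRegion_subset_quad h2
    exact (truncKernel_le_self ⟨q1, q2⟩).trans (hK.le_coagWeight_mul q1 q2)⟩

/-- The coagulation kernel extended by zero. -/
def extKernel (K : ℝ × ℝ → ℝ × ℝ → ℝ) : (ℝ × ℝ) × (ℝ × ℝ) → ℝ :=
  (Quad ×ˢ Quad).indicator fun q => K q.1 q.2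

lemma extKernel_eq {q : (ℝ × ℝ) × (ℝ × ℝ)} (hq : q ∈ Quad ×ˢ Quad) :
    extKernel K q = K q.1 q.2 := Set.indicator_of_mem hq _

lemma IsCoagKernel.isDominatedKernel_ext (hK : IsCoagKernel K K₀ K₁ al be) :
    IsDominatedKernel K₀ al be (extKernel K) :=
  ⟨ContinuousOn.measurable_indicator_real hK.cont (measurableSet_quad.prod measurableSet_quad),
    fun q h1 h2 => by
    have q1 := isoRegion_subset_quad h1
    have q2 := isoRegion_subset_quad h2
    rw [extKernel_eq ⟨q1, q2⟩, abs_of_nonneg (hK.nonneg q1 q2)]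
    exact hK.le_coagWeight_mul q1 q2⟩

lemma MomentLe.integrable_coagWeight (hm : MomentLe C m₀) (hal : al ∈ Icc (0 : ℝ) 1)
    (hbe : be ∈ Icc (0 : ℝ) 1) : Integrable (coagWeight al be) m₀ :=
  hm.integrable_of_le_weight (measurable_coagWeight al be) fun η hη => by
    rw [abs_of_nonneg (coagWeight_nonneg (isoRegion_subset_quad hη))]
    exact iso_coagWeight_le hη hal hbe

lemma IsDominatedKernel.integrable_mul {κ : (ℝ × ℝ) × (ℝ × ℝ) → ℝ}
    (hκ : IsDominatedKernel K₀ al be κ) (hm : MomentLe C m₀) (hal : al ∈ Icc (0 : ℝ) 1)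
    (hbe : be ∈ Icc (0 : ℝ) 1) {F : (ℝ × ℝ) × (ℝ × ℝ) → ℝ} (hF : Measurable F) {b : ℝ}
    (hb : ∀ q, |F q| ≤ b) : Integrable (fun q => κ q * F q) (m₀.prod m₀) := by
  have hI := hm.integrable_coagWeight hal hbe
  refine hm.integrable_prod (hκ.measurable.mul hF) (hI.const_mul (K₀ * b)) hI
    fun q h1 h2 => ?_
  have h3 := hκ.abs_le q h1 h2
  rw [abs_mul]
  calc _ ≤ K₀ * (coagWeight al be q.1 * coagWeight al be q.2) * b :=
        mul_le_mul h3 (hb q) (abs_nonneg _) ((abs_nonneg _).trans h3)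
    _ = _ := by ring

lemma IsDominatedKernel.abs_integral_mul_le {κ : (ℝ × ℝ) × (ℝ × ℝ) → ℝ}
    (hκ : IsDominatedKernel K₀ al be κ) (hm : MomentLe C m₀) (hC : 0 ≤ C) (hK₀ : 0 ≤ K₀)
    (hal : al ∈ Icc (0 : ℝ) 1) (hbe : be ∈ Icc (0 : ℝ) 1) {F : (ℝ × ℝ) × (ℝ × ℝ) → ℝ} {b : ℝ}
    (hb0 : 0 ≤ b) (hb : ∀ q, |F q| ≤ b) :
    |∫ q, κ q * F q ∂(m₀.prod m₀)| ≤ 16 * K₀ * b * C ^ 2 := by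
  have hI := hm.integrable_weight
  have h1 := hm.abs_integral_prod_le (F := fun q => κ q * F q) (hI.const_mul (16 * K₀ * b)) hI
    fun q h1 h2 => by
      have h3 := hκ.abs_le q h1 h2
      have w1 := iso_coagWeight_le h1 hal hbe
      have w2 := iso_coagWeight_le h2 hal hbe
      have w3 := coagWeight_nonneg (al := al) (be := be) (isoRegion_subset_quad h1)
      have w4 := coagWeight_nonneg (al := al) (be := be) (isoRegion_subset_quad h2)
      have w5 : 0 ≤ 4 * weight q.1 := by linarith [iso_one_le_weight h1]
      rw [abs_mul]
      calc _ ≤ K₀ * (coagWeight al be q.1 * coagWeight al be q.2) * b :=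
            mul_le_mul h3 (hb q) (abs_nonneg _) ((abs_nonneg _).trans h3)
        _ ≤ K₀ * ((4 * weight q.1) * (4 * weight q.2)) * b := by gcongr
        _ = _ := by ring
  refine h1.trans ?_
  have h2 := hm.integral_weight_le hC
  have h3 : 0 ≤ ∫ η, weight η ∂m₀ := integral_nonneg_of_ae
    (hm.ae_iso.mono fun η hη => zero_le_one.trans (iso_one_le_weight hη))
  rw [integral_const_mul]
  calc _ ≤ 16 * K₀ * b * C * C := by gcongr
    _ = _ := by ring

/-- The part of the coagulation term far from a large compact set is uniformly small. -/
lemma IsDominatedKernel.abs_integral_cutoff_le {κ : (ℝ × ℝ) × (ℝ × ℝ) → ℝ}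
    (hκ : IsDominatedKernel K₀ al be κ) (hm : MomentLe C m₀) (hC : 0 ≤ C) (hK₀ : 0 ≤ K₀)
    (hal : al ∈ Icc (0 : ℝ) 1) (hbe : be ∈ Icc (0 : ℝ) 1) {F : (ℝ × ℝ) × (ℝ × ℝ) → ℝ}
    (hF : Measurable F) {b : ℝ} (hb0 : 0 ≤ b) (hb : ∀ q, |F q| ≤ b) {R δ : ℝ} (hδ : 0 ≤ δ)
    (hR : ∀ η ∈ IsoRegion, (1 - cutoff R η) * coagWeight al be η ≤ δ * weight η) :
    |∫ q, κ q * F q ∂(m₀.prod m₀) - ∫ q, κ q * (cutoff R q.1 * cutoff R q.2 * F q) ∂(m₀.prod m₀)|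
      ≤ 8 * K₀ * b * C ^ 2 * δ := by
  have hc := (contDiff_cutoff R).continuous.measurable
  have hI := hm.integrable_weight
  have hcut (q : (ℝ × ℝ) × (ℝ × ℝ)) : |cutoff R q.1 * cutoff R q.2 * F q| ≤ b := by
    rw [abs_mul, abs_mul, abs_of_nonneg (cutoff_nonneg _ _), abs_of_nonneg (cutoff_nonneg _ _)]
    have h := mul_le_one₀ (cutoff_le_one R q.1) (cutoff_nonneg R q.2) (cutoff_le_one R q.2)
    exact (mul_le_mul h (hb q) (abs_nonneg _) zero_le_one).trans_eq (one_mul b)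
  rw [← integral_sub (hκ.integrable_mul hm hal hbe hF hb)
    (hκ.integrable_mul hm hal hbe (by fun_prop) hcut)]
  have h1 := hm.abs_integral_prod_le
    (F := fun q => κ q * F q - κ q * (cutoff R q.1 * cutoff R q.2 * F q))
    (hI.const_mul (8 * K₀ * b * δ)) hI fun q h1 h2 => by
      have h3 := hκ.abs_le q h1 h2
      have w1 := iso_coagWeight_le h1 hal hbe
      have w2 := iso_coagWeight_le h2 hal hbe
      have w3 := coagWeight_nonneg (al := al) (be := be) (isoRegion_subset_quad h1)
      have w4 := coagWeight_nonneg (al := al) (be := be) (isoRegion_subset_quad h2)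
      have w5 := iso_one_le_weight h1
      have w6 := iso_one_le_weight h2
      have a1 := cutoff_nonneg R q.1
      have a2 := cutoff_nonneg R q.2
      have b1 := cutoff_le_one R q.1
      have b2 := cutoff_le_one R q.2
      have r1 := hR _ h1
      have r2 := hR _ h2
      have e : κ q * F q - κ q * (cutoff R q.1 * cutoff R q.2 * F q) =
        κ q * F q * (1 - cutoff R q.1 * cutoff R q.2) := by ring
      have e2 : 0 ≤ 1 - cutoff R q.1 * cutoff R q.2 := by nlinarith
      have e3 : 1 - cutoff R q.1 * cutoff R q.2 ≤ (1 - cutoff R q.1) + (1 - cutoff R q.2) := by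
        nlinarith
      rw [e, abs_mul, abs_mul, abs_of_nonneg e2]
      calc _ ≤ K₀ * (coagWeight al be q.1 * coagWeight al be q.2) * b *
            ((1 - cutoff R q.1) + (1 - cutoff R q.2)) := by
            refine mul_le_mul (mul_le_mul h3 (hb q) (abs_nonneg _) ((abs_nonneg _).trans h3)) e3
              e2 (by positivity)
        _ = K₀ * b * (((1 - cutoff R q.1) * coagWeight al be q.1) * coagWeight al be q.2 +
            coagWeight al be q.1 * ((1 - cutoff R q.2) * coagWeight al be q.2)) := by ring
        _ ≤ K₀ * b * ((δ * weight q.1) * (4 * weight q.2) +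
            (4 * weight q.1) * (δ * weight q.2)) := by
            gcongr
        _ = _ := by ring
  refine h1.trans ?_
  have h2 := hm.integral_weight_le hC
  have h3 : 0 ≤ ∫ η, weight η ∂m₀ := integral_nonneg_of_ae
    (hm.ae_iso.mono fun η hη => zero_le_one.trans (iso_one_le_weight hη))
  rw [integral_const_mul]
  calc _ ≤ 8 * K₀ * b * δ * C * C := by gcongr
    _ = _ := by ring

/-- Convergence of the coagulation term, for a sequence of kernels which agree with `K` on compact
sets eventually. -/
lemma tendsto_coagulation (hK : IsCoagKernel K K₀ K₁ al be) (h : VagueTendsto l m m₀) (hC : 0 ≤ C)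
    (hm : ∀ᶠ i in l, MomentLe C (m i)) (hm₀ : MomentLe C m₀) {κ : ι → (ℝ × ℝ) × (ℝ × ℝ) → ℝ}
    (hκ : ∀ i, IsDominatedKernel K₀ al be (κ i))
    (hκK : ∀ S : Set ((ℝ × ℝ) × (ℝ × ℝ)), IsCompact S → S ⊆ Quad ×ˢ Quad →
      ∀ᶠ i in l, ∀ q ∈ S, κ i q = K q.1 q.2)
    {φ : ℝ × ℝ → ℝ} (hφ : IsCcQuad φ) :
    Tendsto (fun i => ∫ q, κ i q * coagIncr φ q ∂((m i).prod (m i))) l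
      (𝓝 (∫ q, extKernel K q * coagIncr φ q ∂(m₀.prod m₀))) := by
  obtain ⟨b, hb0, hb⟩ := hφ.exists_bound
  have hal : al ∈ Ioo (0 : ℝ) 1 := hK.al_mem
  have hal' : al ∈ Icc (0 : ℝ) 1 := ⟨hal.1.le, hal.2.le⟩
  have hbe' : be ∈ Icc (0 : ℝ) 1 := ⟨hK.be_mem.1.le, hK.be_mem.2.le⟩
  have hK0 := hK.K0_pos
  have hΔ := continuous_coagIncr hφ.1
  refine tendsto_of_forall_approx (D := 8 * K₀ * (3 * b) * C ^ 2 + 1) (by positivity)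
    fun δ hδ => ?_
  obtain ⟨R, hR0, hR⟩ := ((eventually_gt_atTop (0 : ℝ)).and (eventually_one_sub_cutoff_mul_le
    (al := al) (be := be) ⟨hal.1.le, hal.2⟩ ⟨hK.be_mem.1.le, hK.be_mem.2⟩ hδ)).exists
  set S : Set (ℝ × ℝ) := Icc (1 / R) (2 * R) ×ˢ Icc (1 / R) (2 * R) with hS_def
  have hS : IsCompact S := isCompact_Icc.prod isCompact_Icc
  have hSQ : S ⊆ Quad := fun η hη => by
    have : 0 < 1 / R := by positivity
    exact ⟨this.trans_le hη.1.1, this.trans_le hη.2.1⟩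
  have hzero (q : (ℝ × ℝ) × (ℝ × ℝ)) (hq : q ∉ S ×ˢ S) : cutoff R q.1 * cutoff R q.2 = 0 := by
    rcases not_and_or.1 hq with hq | hq
    · rw [cutoff_eq_zero hR0 hq, zero_mul]
    · rw [cutoff_eq_zero hR0 hq, mul_zero]
  have hcR := (contDiff_cutoff R).continuous
  set F : (ℝ × ℝ) × (ℝ × ℝ) → ℝ :=
    fun q => extKernel K q * (cutoff R q.1 * cutoff R q.2 * coagIncr φ q) with hF_def
  have hF0 : ∀ q ∉ S ×ˢ S, F q = 0 := fun q hq => by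
    rw [hF_def]; simp only [hzero q hq, zero_mul, mul_zero]
  have hF : Continuous F := by
    have hsub : tsupport F ⊆ Quad ×ˢ Quad :=
      (closure_minimal (fun q hq => by_contra fun hn => Function.mem_support.1 hq (hF0 q hn))
        (hS.prod hS).isClosed).trans (prod_mono hSQ hSQ)
    refine ContinuousOn.continuous_of_tsupport_subset ?_ (isOpen_quad.prod isOpen_quad) hsub
    refine ContinuousOn.mul (hK.cont.congr fun q hq => extKernel_eq hq) ?_
    exact Continuous.continuousOn (by fun_prop)
  have key (μ : Measure (ℝ × ℝ)) (hμ : MomentLe C μ) (κ' : (ℝ × ℝ) × (ℝ × ℝ) → ℝ)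
      (hκ' : IsDominatedKernel K₀ al be κ') (he : ∀ q ∈ S ×ˢ S, κ' q = K q.1 q.2) :
      |∫ q, κ' q * coagIncr φ q ∂(μ.prod μ) - ∫ q, F q ∂(μ.prod μ)| ≤
        (8 * K₀ * (3 * b) * C ^ 2 + 1) * δ := by
    have e1 : F = fun q => κ' q * (cutoff R q.1 * cutoff R q.2 * coagIncr φ q) := by
      funext q
      by_cases hq : q ∈ S ×ˢ S
      · rw [hF_def, he q hq]
        simp only [extKernel_eq (prod_mono hSQ hSQ hq)]
      · rw [hF0 q hq, hzero q hq, zero_mul, mul_zero]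
    rw [e1]
    refine (hκ'.abs_integral_cutoff_le hμ hC hK0.le hal' hbe' hΔ.measurable (by positivity)
      (abs_coagIncr_le hb) hδ.le hR).trans ?_
    nlinarith
  refine ⟨_, _, h.tendsto_integral_prod hC hm hm₀ hF hS hSQ hF0, ?_, ?_⟩
  · filter_upwards [hm, hκK (S ×ˢ S) (hS.prod hS) (prod_mono hSQ hSQ)] with i hi hi'
    exact key _ hi _ (hκ i) hi'
  · exact key _ hm₀ _ hK.isDominatedKernel_ext fun q hq => extKernel_eq (prod_mono hSQ hSQ hq)

/-- Convergence of the fusion term. -/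
lemma tendsto_fusion (hr : IsFusionKernel r R₀ R₁ mu sg B) (h : VagueTendsto l m m₀)
    {ρ : ι → ℝ × ℝ → ℝ}
    (hρ : ∀ S : Set (ℝ × ℝ), IsCompact S → S ⊆ Quad → ∀ᶠ i in l, ∀ η ∈ S, ρ i η = r η)
    {φ : ℝ × ℝ → ℝ} (hφ : IsCcQuad φ) :
    Tendsto (fun i => ∫ η, ρ i η * excess η * φ η ∂(m i)) l
      (𝓝 (∫ η, r η * excess η * φ η ∂m₀)) := by
  have h1 : IsCcQuad fun η => φ η * (r η * excess η) :=
    hφ.mul_continuousOn (hr.smooth.continuousOn.mul continuous_excess.continuousOn)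
  have h2 := h _ h1
  simp only [fun η => mul_comm (φ η) (r η * excess η)] at h2
  refine h2.congr' ?_
  filter_upwards [hρ _ hφ.2.1 hφ.2.2] with i hi
  congr 1
  funext η
  by_cases hη : η ∈ tsupport φ
  · rw [hi η hη]
  · rw [image_eq_zero_of_notMem_tsupport hη, mul_zero, mul_zero]

end CoagulationTerm

/-! ### Limits of time-discrete evolutions -/

section StepLimit

variable {l : Filter ℕ} {h : ℕ → ℝ} {S g : ℕ → ℕ → ℝ}

/-- Approximate solutions `S` of the difference equation `S (k+1) - S k = h * g k`, with vanishing
defect and locally bounded right-hand side. -/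
structure StepConsistent (l : Filter ℕ) (h : ℕ → ℝ) (S g : ℕ → ℕ → ℝ) : Prop where
  step_pos : ∀ n, 0 < h n
  step_tendsto : Tendsto h l (𝓝 0)
  defect : ∀ T, ∀ δ > 0, ∀ᶠ n in l, ∀ j k : ℕ, j ≤ k → k * h n ≤ T →
    |S n k - S n j - ∑ i ∈ Finset.Ico j k, h n * g n i| ≤ δ
  bound : ∀ T, ∃ B, 0 ≤ B ∧ ∀ᶠ n in l, ∀ k : ℕ, k * h n ≤ T → |g n k| ≤ B

lemma floor_mul_le {x t : ℝ} (hx : 0 < x) (ht : 0 ≤ t) : (⌊t / x⌋₊ : ℝ) * x ≤ t := by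
  rw [← le_div_iff₀ hx]
  exact Nat.floor_le (by positivity)

lemma lt_floor_add_one_mul {x : ℝ} (hx : 0 < x) (t : ℝ) : t < (⌊t / x⌋₊ : ℝ) * x + x := by
  have := Nat.lt_floor_add_one (t / x)
  rw [div_lt_iff₀ hx] at this
  linarith

lemma floor_div_mono {x s t : ℝ} (hx : 0 < x) (hst : s ≤ t) : ⌊s / x⌋₊ ≤ ⌊t / x⌋₊ :=
  Nat.floor_mono (by gcongr)

/-- Almost Lipschitz continuity in time of the approximate solutions. -/
lemma StepConsistent.exists_abs_sub_le (H : StepConsistent l h S g) (T : ℝ) :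
    ∃ B, 0 ≤ B ∧ ∀ δ > 0, ∀ᶠ n in l, ∀ u ∈ Icc 0 T, ∀ v ∈ Icc 0 T,
      |S n ⌊u / h n⌋₊ - S n ⌊v / h n⌋₊| ≤ δ + B * (|u - v| + h n) := by
  obtain ⟨B, hB0, hB⟩ := H.bound T
  refine ⟨B, hB0, fun δ hδ => ?_⟩
  filter_upwards [hB, H.defect T δ hδ] with n hBn hdn
  have hn := H.step_pos n
  have key (v : ℝ) (hv : v ∈ Icc 0 T) (u : ℝ) (hu : u ∈ Icc 0 T) (hvu : v ≤ u) :
      |S n ⌊u / h n⌋₊ - S n ⌊v / h n⌋₊| ≤ δ + B * (|u - v| + h n) := by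
    have hjk := floor_div_mono hn hvu
    have hu1 := floor_mul_le hn hu.1
    have hv1 := lt_floor_add_one_mul hn v
    set k := ⌊u / h n⌋₊
    set j := ⌊v / h n⌋₊
    have hd := hdn j k hjk (hu1.trans hu.2)
    have hs : |∑ i ∈ Finset.Ico j k, h n * g n i| ≤ (k - j) * (h n * B) := by
      refine (Finset.abs_sum_le_sum_abs _ _).trans ?_
      refine (Finset.sum_le_card_nsmul _ _ (h n * B) fun i hi => ?_).trans_eq ?_
      · rw [abs_mul, abs_of_pos hn]
        refine mul_le_mul_of_nonneg_left (hBn i ?_) hn.le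
        have : (i : ℝ) ≤ k := by exact_mod_cast (Finset.mem_Ico.1 hi).2.le
        exact (mul_le_mul_of_nonneg_right this hn.le).trans (hu1.trans hu.2)
      · rw [Nat.card_Ico, nsmul_eq_mul, Nat.cast_sub hjk]
    have h3 : (k - j) * (h n * B) ≤ B * (|u - v| + h n) := by
      have : (k - j : ℝ) * h n ≤ |u - v| + h n := by
        rw [abs_of_nonneg (sub_nonneg.2 hvu)]
        nlinarith
      nlinarith
    have : S n k - S n j = (S n k - S n j - ∑ i ∈ Finset.Ico j k, h n * g n i)
      + ∑ i ∈ Finset.Ico j k, h n * g n i := by ring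
    rw [this]
    exact (abs_add_le _ _).trans (add_le_add hd (hs.trans h3))
  intro u hu v hv
  rcases le_total v u with hvu | hvu
  · exact key v hv u hu hvu
  · rw [abs_sub_comm, abs_sub_comm u v]
    exact key u hu v hv hvu

variable {S₀ g₀ : ℝ → ℝ}

/-- Approximate solutions converge along with their time argument. -/
lemma StepConsistent.tendsto_prod (H : StepConsistent l h S g)
    (hS : ∀ t, 0 ≤ t → Tendsto (fun n => S n ⌊t / h n⌋₊) l (𝓝 (S₀ t))) {t : ℝ} (ht : 0 ≤ t) :
    Tendsto (fun p : ℕ × ℝ => S p.1 ⌊p.2 / h p.1⌋₊) (l ×ˢ 𝓝[Ici 0] t) (𝓝 (S₀ t)) := by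
  obtain ⟨B, hB0, hB⟩ := H.exists_abs_sub_le (t + 1)
  refine tendsto_of_forall_approx (D := 1 + 2 * B) (by positivity) fun δ hδ =>
    ⟨_, _, (hS t ht).comp tendsto_fst, ?_, by rw [sub_self, abs_zero]; positivity⟩
  have e1 : ∀ᶠ n in l, (∀ u ∈ Icc 0 (t + 1), ∀ v ∈ Icc 0 (t + 1),
      |S n ⌊u / h n⌋₊ - S n ⌊v / h n⌋₊| ≤ δ + B * (|u - v| + h n)) ∧ h n ≤ δ :=
    (hB δ hδ).and ((H.step_tendsto.eventually_lt_const hδ).mono fun _ h => h.le)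
  have e2 : ∀ᶠ u in 𝓝[Ici 0] t, 0 ≤ u ∧ u ≤ t + 1 ∧ |u - t| ≤ δ := by
    filter_upwards [self_mem_nhdsWithin, nhdsWithin_le_nhds (Iic_mem_nhds (lt_add_one t)),
      nhdsWithin_le_nhds (Metric.closedBall_mem_nhds t hδ)] with u h1 h2 h3
    exact ⟨h1, h2, h3⟩
  filter_upwards [e1.prod_mk e2] with p hp
  refine (hp.1.1 p.2 ⟨hp.2.1, hp.2.2.1⟩ t ⟨ht, by linarith⟩).trans ?_
  nlinarith [hp.1.2, hp.2.2.2]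

variable [l.NeBot]

lemma StepConsistent.exists_abs_limit_sub_le (H : StepConsistent l h S g)
    (hS : ∀ t, 0 ≤ t → Tendsto (fun n => S n ⌊t / h n⌋₊) l (𝓝 (S₀ t))) (T : ℝ) :
    ∃ B, 0 ≤ B ∧ ∀ u ∈ Icc 0 T, ∀ v ∈ Icc 0 T, |S₀ u - S₀ v| ≤ B * |u - v| := by
  obtain ⟨B, hB0, hB⟩ := H.exists_abs_sub_le T
  refine ⟨B, hB0, fun u hu v hv => le_of_forall_pos_le_add fun δ hδ => ?_⟩
  have h1 := ((hS u hu.1).sub (hS v hv.1)).abs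
  have h2 : Tendsto (fun n => δ + B * (|u - v| + h n)) l (𝓝 (δ + B * (|u - v| + 0))) :=
    ((H.step_tendsto.const_add _).const_mul _).const_add _
  have := le_of_tendsto_of_tendsto h1 h2 ((hB δ hδ).mono fun n hn => hn u hu v hv)
  linarith

lemma StepConsistent.continuousOn_limit (H : StepConsistent l h S g)
    (hS : ∀ t, 0 ≤ t → Tendsto (fun n => S n ⌊t / h n⌋₊) l (𝓝 (S₀ t))) :
    ContinuousOn S₀ (Ici 0) := by
  intro t ht
  obtain ⟨B, hB0, hB⟩ := H.exists_abs_limit_sub_le hS (t + 1)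
  have ht' : (0 : ℝ) ≤ t := ht
  rw [ContinuousWithinAt, tendsto_iff_dist_tendsto_zero]
  have h1 : Tendsto (fun u => B * |u - t|) (𝓝[Ici 0] t) (𝓝 0) := by
    have : Continuous fun u => B * |u - t| := by fun_prop
    simpa using (this.tendsto t).mono_left (nhdsWithin_le_nhds (s := Ici 0))
  refine squeeze_zero' (Eventually.of_forall fun _ => dist_nonneg) ?_ h1
  filter_upwards [self_mem_nhdsWithin, nhdsWithin_le_nhds (Iic_mem_nhds (lt_add_one t))]
    with u hu hu'
  rw [Real.dist_eq]
  exact hB u ⟨hu, hu'⟩ t ⟨ht', by linarith⟩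

lemma StepConsistent.hasDerivWithinAt (H : StepConsistent l h S g)
    (hS : ∀ t, 0 ≤ t → Tendsto (fun n => S n ⌊t / h n⌋₊) l (𝓝 (S₀ t))) {t : ℝ} (ht : 0 ≤ t)
    (hg : Tendsto (fun p : ℕ × ℝ => g p.1 ⌊p.2 / h p.1⌋₊) (l ×ˢ 𝓝[Ici 0] t) (𝓝 (g₀ t))) :
    HasDerivWithinAt S₀ (g₀ t) (Ioi t) t := by
  rw [hasDerivWithinAt_iff_isLittleO, Asymptotics.isLittleO_iff]
  intro δ hδ
  have h1 := (Metric.tendsto_nhds.1 hg) δ hδ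
  obtain ⟨pa, hpa, pb, hpb, hp⟩ := eventually_prod_iff.1 h1
  obtain ⟨e, he, hpe⟩ := Metric.mem_nhdsWithin_iff.1 hpb
  filter_upwards [self_mem_nhdsWithin, nhdsWithin_le_nhds (Metric.ball_mem_nhds t he)] with u hu hue
  have htu : t < u := hu
  have hue' : u - t < e := by
    rw [Metric.mem_ball, Real.dist_eq, abs_of_pos (sub_pos.2 htu)] at hue; exact hue
  rw [Real.norm_eq_abs, Real.norm_eq_abs, abs_of_pos (sub_pos.2 htu), smul_eq_mul]
  refine le_of_forall_pos_le_add fun δ' hδ' => ?_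
  have l1 := (((hS u (ht.trans htu.le)).sub (hS t ht)).sub_const ((u - t) * g₀ t)).abs
  have l2 : Tendsto (fun n => δ' + δ * (u - t + h n) + h n * |g₀ t|) l
      (𝓝 (δ' + δ * (u - t + 0) + 0 * |g₀ t|)) :=
    (((H.step_tendsto.const_add _).const_mul _).const_add _).add (H.step_tendsto.mul_const _)
  have l3 := le_of_tendsto_of_tendsto l1 l2 ?_
  · linarith
  filter_upwards [hpa, H.defect u δ' hδ'] with n hn hdn
  have hpos := H.step_pos n
  have hjk := floor_div_mono hpos htu.le
  have u1 := floor_mul_le hpos (ht.trans htu.le)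
  have u2 := lt_floor_add_one_mul hpos u
  have v1 := floor_mul_le hpos ht
  have v2 := lt_floor_add_one_mul hpos t
  have hgi : ∀ i ∈ Finset.Ico ⌊t / h n⌋₊ ⌊u / h n⌋₊, |h n * (g n i - g₀ t)| ≤ h n * δ := by
    intro i hi
    obtain ⟨hi1, hi2⟩ := Finset.mem_Ico.1 hi
    rw [abs_mul, abs_of_pos hpos]
    refine mul_le_mul_of_nonneg_left ?_ hpos.le
    have e1 : ⌊max t (i * h n) / h n⌋₊ = i := by
      rw [← max_div_div_right hpos.le, mul_div_cancel_right₀ _ hpos.ne']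
      rcases le_total (t / h n) i with h3 | h3
      · rw [max_eq_right h3, Nat.floor_natCast]
      · rw [max_eq_left h3]
        exact le_antisymm hi1 (Nat.le_floor h3)
    have hi3 : (i : ℝ) * h n ≤ u := by
      have : (i : ℝ) ≤ ⌊u / h n⌋₊ := by exact_mod_cast hi2.le
      exact (mul_le_mul_of_nonneg_right this hpos.le).trans u1
    have hm1 : t ≤ max t (i * h n) := le_max_left _ _
    have hm2 : max t (i * h n) ≤ u := max_le htu.le hi3
    have := hp hn (hpe (a := max t (i * h n)) ⟨by
      rw [Metric.mem_ball, Real.dist_eq, abs_of_nonneg (sub_nonneg.2 hm1)]; linarith,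
      ht.trans hm1⟩)
    simp only [e1] at this
    exact this.le
  have hd := hdn _ _ hjk u1
  set k := ⌊u / h n⌋₊
  set j := ⌊t / h n⌋₊
  have hcard : ((Finset.Ico j k).card : ℝ) = k - j := by
    rw [Nat.card_Ico, Nat.cast_sub hjk]
  have hsum : ∑ i ∈ Finset.Ico j k, h n * g n i =
      ∑ i ∈ Finset.Ico j k, h n * (g n i - g₀ t) + (k - j) * h n * g₀ t := by
    simp only [mul_sub, Finset.sum_sub_distrib, Finset.sum_const, nsmul_eq_mul, hcard]
    ring
  have hs : |∑ i ∈ Finset.Ico j k, h n * (g n i - g₀ t)| ≤ (k - j) * (h n * δ) := by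
    refine (Finset.abs_sum_le_sum_abs _ _).trans ((Finset.sum_le_card_nsmul _ _ _ hgi).trans_eq ?_)
    rw [nsmul_eq_mul, hcard]
  have hc : |(k - j) * h n * g₀ t - (u - t) * g₀ t| ≤ h n * |g₀ t| := by
    rw [← sub_mul, abs_mul]
    refine mul_le_mul_of_nonneg_right (abs_le.2 ⟨?_, ?_⟩) (abs_nonneg _) <;> nlinarith
  have hs' : (k - j) * (h n * δ) ≤ δ * (u - t + h n) := by
    have : (k - j : ℝ) * h n ≤ u - t + h n := by nlinarith
    nlinarith
  rw [show S n k - S n j - (u - t) * g₀ t = (S n k - S n j - ∑ i ∈ Finset.Ico j k, h n * g n i)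
    + ∑ i ∈ Finset.Ico j k, h n * (g n i - g₀ t) + ((k - j) * h n * g₀ t - (u - t) * g₀ t) by
    rw [hsum]; ring]
  refine (abs_add_le _ _).trans ((add_le_add_left (abs_add_le _ _) _).trans ?_)
  linarith

end StepLimit

/-! ### The sequence of Euler schemes -/

section SchemeSequence

/-- The time step at the `n`-th truncation level. -/
def seqStep (ε : ℝ) (fin : Measure (ℝ × ℝ)) (n : ℕ) : ℝ := stepSize ε (fin.real univ) (n + 1)

/-- The iterates of the Euler scheme at the `n`-th truncation level. -/
def seqSol (K : ℝ × ℝ → ℝ × ℝ → ℝ) (r : ℝ × ℝ → ℝ) (ε : ℝ) (fin : Measure (ℝ × ℝ)) (n k : ℕ) :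
    Measure (ℝ × ℝ) :=
  discreteSol K r ε fin (n + 1) k

/-- The a priori moment bound at time `t`. -/
def momentBound (K₀ W t : ℝ) : ℝ := Real.exp (6 * K₀ * W * t) * (4 * W)

variable {K : ℝ × ℝ → ℝ × ℝ → ℝ} {r : ℝ × ℝ → ℝ}
    {K₀ K₁ al be R₀ R₁ mu sg B ε : ℝ} {fin : Measure (ℝ × ℝ)} {W : ℝ} {m : Measure (ℝ × ℝ)} {C : ℝ}

lemma generator_eq (κ : (ℝ × ℝ) × (ℝ × ℝ) → ℝ) (ρ : ℝ × ℝ → ℝ) (c : ℝ) (φ : ℝ × ℝ → ℝ)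
    (m : Measure (ℝ × ℝ)) : generator κ ρ c φ m =
      1 / 2 * ∫ q, κ q * coagIncr φ q ∂(m.prod m) - c * ∫ η, ρ η * excess η * da φ η ∂m := rfl

/-- A uniform bound for the fusion term. -/
lemma IsFusionKernel.exists_abs_integral_le (hr : IsFusionKernel r R₀ R₁ mu sg B)
    {φ : ℝ × ℝ → ℝ} (hφ : IsCcQuad φ) : ∃ D, 0 ≤ D ∧ ∀ (C : ℝ) (m : Measure (ℝ × ℝ))
      (ρ : ℝ × ℝ → ℝ), 0 ≤ C → MomentLe C m → (∀ η ∈ Quad, |ρ η| ≤ r η) →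
      |∫ η, ρ η * excess η * φ η ∂m| ≤ D * C := by
  have h1 : IsCcQuad fun η => φ η * (r η * excess η) :=
    hφ.mul_continuousOn (hr.smooth.continuousOn.mul continuous_excess.continuousOn)
  obtain ⟨D, hD0, hD⟩ := h1.exists_bound
  refine ⟨D, hD0, fun C m ρ hC hm hρ => hm.abs_integral_le hC hD0 fun η hη => ?_⟩
  have hq := isoRegion_subset_quad hη
  refine le_trans ?_ (hD η)
  rw [abs_mul, abs_mul, abs_mul, abs_mul, mul_comm |φ η|]
  have := (hρ η hq).trans (le_abs_self _)
  gcongr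

lemma exists_abs_generator_le (hK : IsCoagKernel K K₀ K₁ al be)
    (hr : IsFusionKernel r R₀ R₁ mu sg B) {c : ℝ} {φ : ℝ × ℝ → ℝ} (hφ : IsCcQuad φ)
    (hφ' : ContDiff ℝ 1 φ) (C : ℝ) (hC : 0 ≤ C) :
    ∃ D, 0 ≤ D ∧ ∀ (m : Measure (ℝ × ℝ)) (κ : (ℝ × ℝ) × (ℝ × ℝ) → ℝ) (ρ : ℝ × ℝ → ℝ),
      MomentLe C m → IsDominatedKernel K₀ al be κ → (∀ η ∈ Quad, |ρ η| ≤ r η) →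
      |generator κ ρ c φ m| ≤ D := by
  obtain ⟨b, hb0, hb⟩ := hφ.exists_bound
  obtain ⟨D, hD0, hD⟩ := hr.exists_abs_integral_le (hφ.da hφ')
  have hK0 := hK.K0_pos
  refine ⟨1 / 2 * (16 * K₀ * (3 * b) * C ^ 2) + |c| * (D * C), by positivity,
    fun m κ ρ hm hκ hρ => ?_⟩
  rw [generator_eq]
  refine (abs_sub _ _).trans (add_le_add ?_ ?_)
  · rw [abs_mul, abs_of_nonneg (by norm_num : (0 : ℝ) ≤ 1 / 2)]
    exact mul_le_mul_of_nonneg_left (hκ.abs_integral_mul_le hm hC hK0.le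
      ⟨hK.al_mem.1.le, hK.al_mem.2.le⟩ ⟨hK.be_mem.1.le, hK.be_mem.2.le⟩ (by positivity)
      (abs_coagIncr_le hb)) (by norm_num)
  · rw [abs_mul]
    exact mul_le_mul_of_nonneg_left (hD C m ρ hC hm hρ) (abs_nonneg c)

lemma IsFusionKernel.abs_trunc_le (hr : IsFusionKernel r R₀ R₁ mu sg B) {N : ℝ} (hN : 0 ≤ N)
    {η : ℝ × ℝ} (hη : η ∈ Quad) : |truncFusion r N η| ≤ r η := by
  rw [abs_of_nonneg (hr.trunc_nonneg hN η)]
  exact hr.trunc_le_self hη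

namespace Scheme

lemma level (H : Scheme K r K₀ K₁ al be R₀ R₁ mu sg B ε fin W 1) (n : ℕ) :
    Scheme K r K₀ K₁ al be R₀ R₁ mu sg B ε fin W (n + 1) :=
  ⟨H.coag, H.fusion, H.eps_mem, H.momentLe, H.W_nonneg, by
    have : (0 : ℝ) ≤ n := n.cast_nonneg
    linarith⟩

lemma seqStep_pos (H : Scheme K r K₀ K₁ al be R₀ R₁ mu sg B ε fin W 1) (n : ℕ) :
    0 < seqStep ε fin n := (H.level n).stepSize_pos

lemma seqStep_le (H : Scheme K r K₀ K₁ al be R₀ R₁ mu sg B ε fin W 1) (n : ℕ) :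
    seqStep ε fin n ≤ 1 / (n + 1) := by
  have h0 := (H.level n).one_le
  have h1 : 0 ≤ fin.real univ := measureReal_nonneg
  have h2 := H.eps_mem.2
  unfold seqStep stepSize
  set N : ℝ := n + 1
  refine div_le_div₀ zero_le_one h2.le (by linarith) ?_
  have h3 : N ≤ N ^ 3 := by nlinarith [mul_nonneg (sub_nonneg.2 h0) (sub_nonneg.2 h0)]
  have h4 : 0 ≤ N ^ 3 * fin.real univ := by positivity
  nlinarith

lemma tendsto_seqStep (H : Scheme K r K₀ K₁ al be R₀ R₁ mu sg B ε fin W 1) :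
    Tendsto (seqStep ε fin) atTop (𝓝 0) :=
  squeeze_zero (fun n => (H.seqStep_pos n).le) H.seqStep_le tendsto_one_div_add_atTop_nhds_zero_nat

lemma momentBound_nonneg (H : Scheme K r K₀ K₁ al be R₀ R₁ mu sg B ε fin W 1) (t : ℝ) :
    0 ≤ momentBound K₀ W t := by
  have := H.W_nonneg
  unfold momentBound; positivity

lemma momentBound_mono (H : Scheme K r K₀ K₁ al be R₀ R₁ mu sg B ε fin W 1) {s t : ℝ}
    (hst : s ≤ t) : momentBound K₀ W s ≤ momentBound K₀ W t := by
  have := H.W_nonneg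
  have := H.coag.K0_pos
  unfold momentBound
  gcongr

lemma seqSol_momentLe (H : Scheme K r K₀ K₁ al be R₀ R₁ mu sg B ε fin W 1) {n k : ℕ} {t : ℝ}
    (hk : k * seqStep ε fin n ≤ t) : MomentLe (momentBound K₀ W t) (seqSol K r ε fin n k) :=
  ((H.level n).discrete_momentLe k).mono (H.momentBound_mono hk)

lemma seqSol_floor_momentLe (H : Scheme K r K₀ K₁ al be R₀ R₁ mu sg B ε fin W 1) (n : ℕ) {t : ℝ}
    (ht : 0 ≤ t) :
    MomentLe (momentBound K₀ W t) (seqSol K r ε fin n ⌊t / seqStep ε fin n⌋₊) :=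
  H.seqSol_momentLe (floor_mul_le (H.seqStep_pos n) ht)

lemma integral_fusion_nonneg (H : Scheme K r K₀ K₁ al be R₀ R₁ mu sg B ε fin W 1) (n k : ℕ) :
    0 ≤ seqStep ε fin n *
      (ε⁻¹ * ∫ η, truncFusion r (n + 1) η * excess η ∂(seqSol K r ε fin n k)) := by
  have h1 := (H.seqStep_pos n).le
  have h2 := inv_nonneg.2 H.eps_mem.1.le
  have h3 : 0 ≤ ∫ η, truncFusion r (n + 1) η * excess η ∂(seqSol K r ε fin n k) :=
    integral_nonneg_of_ae (((H.level n).discrete_ae_iso k).mono fun η hη =>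
      mul_nonneg (H.fusion.trunc_nonneg (by positivity) η) (iso_excess_nonneg hη))
  positivity

lemma stepConsistent (H : Scheme K r K₀ K₁ al be R₀ R₁ mu sg B ε fin W 1) {l : Filter ℕ}
    (hl : l ≤ atTop) {φ : ℝ × ℝ → ℝ} (hφ : ContDiff ℝ 1 φ) (hc : IsCcQuad φ) :
    StepConsistent l (seqStep ε fin) (fun n k => ∫ η, φ η ∂(seqSol K r ε fin n k))
      (fun n k => generator (truncKernel K (n + 1)) (truncFusion r (n + 1)) ε⁻¹ φ
        (seqSol K r ε fin n k)) := by
  have hW := H.W_nonneg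
  refine ⟨H.seqStep_pos, H.tendsto_seqStep.mono_left hl, fun T δ hδ => ?_, fun T => ?_⟩
  · obtain ⟨d, hd, hdφ⟩ := Metric.uniformContinuous_iff.1
      ((hc.da hφ).2.1.uniformContinuous_of_continuous (hc.da hφ).1) (δ / (W + 1)) (by positivity)
    have h1 : ∀ᶠ n : ℕ in l, 1 / ((n : ℝ) + 1) < d :=
      (tendsto_one_div_add_atTop_nhds_zero_nat.eventually_lt_const hd).filter_mono hl
    filter_upwards [h1] with n hn j k hjk _
    have hω (η : ℝ × ℝ) (x : ℝ) (hx : |x - η.1| ≤ 1 / ((n : ℝ) + 1)) :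
        |da φ (x, η.2) - da φ η| ≤ δ / (W + 1) := by
      refine (hdφ (a := (x, η.2)) (b := η) ?_).le
      rw [Prod.dist_eq]
      simpa [Real.dist_eq, hd] using hx.trans_lt hn
    rw [← Finset.sum_Ico_sub (fun k => ∫ η, φ η ∂(seqSol K r ε fin n k)) hjk,
      ← Finset.sum_sub_distrib]
    refine (Finset.abs_sum_le_sum_abs _ _).trans ((Finset.sum_le_sum fun i _ =>
      (H.level n).discrete_consistency hφ hc hω i).trans ?_)
    rw [← Finset.mul_sum]
    have h2 := (Finset.sum_le_sum_of_subset_of_nonneg (Finset.Ico_subset_Ico_left j.zero_le)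
      fun i _ _ => H.integral_fusion_nonneg n i).trans
      ((congrArg (fun s => Finset.sum s _) (Finset.range_eq_Ico k).symm).le.trans
        ((H.level n).sum_fusion_le k))
    calc _ ≤ δ / (W + 1) * W := mul_le_mul_of_nonneg_left h2 (by positivity)
      _ ≤ δ := by
        rw [div_mul_eq_mul_div, div_le_iff₀ (by positivity)]
        nlinarith
  · obtain ⟨D, hD0, hD⟩ := exists_abs_generator_le H.coag H.fusion (c := ε⁻¹) hc hφ
      (momentBound K₀ W T) (H.momentBound_nonneg T)
    exact ⟨D, hD0, Eventually.of_forall fun n k hk => hD _ _ _ (H.seqSol_momentLe hk)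
      (H.coag.isDominatedKernel_trunc (by positivity))
      fun η hη => H.fusion.abs_trunc_le (by positivity) hη⟩

/-- The accumulated dissipation is consistent with the instantaneous one. -/
lemma stepConsistent_dissipation (H : Scheme K r K₀ K₁ al be R₀ R₁ mu sg B ε fin W 1)
    {l : Filter ℕ} (hl : l ≤ atTop) {φ : ℝ × ℝ → ℝ} (hc : IsCcQuad φ) :
    StepConsistent l (seqStep ε fin)
      (fun n k => ∑ j ∈ Finset.range k, seqStep ε fin n *
        ∫ η, truncFusion r (n + 1) η * excess η * φ η ∂(seqSol K r ε fin n j))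
      (fun n k => ∫ η, truncFusion r (n + 1) η * excess η * φ η ∂(seqSol K r ε fin n k)) := by
  refine ⟨H.seqStep_pos, H.tendsto_seqStep.mono_left hl, fun T δ hδ => ?_, fun T => ?_⟩
  · refine Eventually.of_forall fun n j k hjk _ => ?_
    rw [Finset.sum_Ico_eq_sub _ hjk, sub_self, abs_zero]
    exact hδ.le
  · obtain ⟨D, hD0, hD⟩ := H.fusion.exists_abs_integral_le hc
    exact ⟨D * momentBound K₀ W T, mul_nonneg hD0 (H.momentBound_nonneg T),
      Eventually.of_forall fun n k hk => hD _ _ _ (H.momentBound_nonneg T) (H.seqSol_momentLe hk)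
      fun η hη => H.fusion.abs_trunc_le (by positivity) hη⟩

lemma sum_dissipation_mem (H : Scheme K r K₀ K₁ al be R₀ R₁ mu sg B ε fin W 1) {φ : ℝ × ℝ → ℝ}
    (hm : Measurable φ) (hφ : ∀ η, φ η ∈ Icc (0 : ℝ) 1) (n k : ℕ) :
    ∑ j ∈ Finset.range k, seqStep ε fin n *
        ∫ η, truncFusion r (n + 1) η * excess η * φ η ∂(seqSol K r ε fin n j) ∈
      Icc 0 (ε * W) := by
  have hε := H.eps_mem.1
  have hn := H.seqStep_pos n
  have hr (η : ℝ × ℝ) : 0 ≤ truncFusion r (n + 1) η := H.fusion.trunc_nonneg (by positivity) η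
  constructor
  · refine Finset.sum_nonneg fun j _ => mul_nonneg hn.le (integral_nonneg_of_ae ?_)
    filter_upwards [(H.level n).discrete_ae_iso j] with η hη
    exact mul_nonneg (mul_nonneg (hr η) (iso_excess_nonneg hη)) (hφ η).1
  · have h1 : ∀ j ∈ Finset.range k, seqStep ε fin n *
        ∫ η, truncFusion r (n + 1) η * excess η * φ η ∂(seqSol K r ε fin n j) ≤
        ε * (seqStep ε fin n *
          (ε⁻¹ * ∫ η, truncFusion r (n + 1) η * excess η ∂(seqSol K r ε fin n j))) := by
      intro j _
      have e : ∀ x y : ℝ, ε * (x * (ε⁻¹ * y)) = x * y := fun x y => by field_simp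
      rw [e]
      refine mul_le_mul_of_nonneg_left ?_ hn.le
      have hmom := (H.level n).discrete_momentLe j
      have hmr := H.fusion.measurable_trunc ((n : ℝ) + 1)
      have hme := continuous_excess.measurable
      have hb (η : ℝ × ℝ) (hη : η ∈ IsoRegion) :
          0 ≤ truncFusion r (n + 1) η * excess η ∧
          truncFusion r (n + 1) η * excess η ≤ (n + 1) * weight η := by
        have h1 := iso_excess_nonneg hη
        refine ⟨mul_nonneg (hr η) h1, ?_⟩
        exact mul_le_mul (truncFusion_le (by positivity) η)
          ((iso_excess_le hη).trans (iso_fst_le_weight hη)) h1 (by positivity)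
      refine integral_mono_ae
        (hmom.integrable_of_le_weight (b := n + 1) (by fun_prop) fun η hη => ?_)
        (hmom.integrable_of_le_weight (b := n + 1) (by fun_prop) fun η hη => ?_)
        (hmom.ae_iso.mono fun η hη => mul_le_of_le_one_right (hb η hη).1 (hφ η).2)
      · rw [abs_of_nonneg (mul_nonneg (hb η hη).1 (hφ η).1)]
        exact (mul_le_of_le_one_right (hb η hη).1 (hφ η).2).trans (hb η hη).2
      · rw [abs_of_nonneg (hb η hη).1]
        exact (hb η hη).2
    refine (Finset.sum_le_sum h1).trans ?_
    rw [← Finset.mul_sum]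
    exact mul_le_mul_of_nonneg_left ((H.level n).sum_fusion_le k) hε.le

end Scheme

end SchemeSequence

/-! ### Vague compactness -/

section VagueCompactness

variable {C : ℝ}

lemma continuousOn_weight : ContinuousOn weight Quad := by
  unfold weight
  refine ContinuousOn.add (ContinuousOn.add ?_ ?_) continuousOn_fst
  · exact continuousOn_snd.rpow_const fun η hη => Or.inl hη.2.ne'
  · exact continuousOn_snd.rpow_const fun η hη => Or.inl hη.2.ne'

lemma weight_nonneg {η : ℝ × ℝ} (h : η ∈ Quad) : 0 ≤ weight η := by
  have h1 := Real.rpow_nonneg h.2.le (-1 : ℝ)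
  have h2 := Real.rpow_nonneg h.2.le (2 : ℝ)
  have h3 := h.1
  unfold weight
  linarith

/-- Vague limits of measures with bounded moments inherit the bound. -/
lemma VagueTendsto.momentLe {ι : Type*} {l : Filter ι} [l.NeBot] {m : ι → Measure (ℝ × ℝ)}
    {m₀ : Measure (ℝ × ℝ)} [IsFiniteMeasureOnCompacts m₀] (h : VagueTendsto l m m₀)
    (hQ : ∀ᵐ η ∂m₀, η ∈ Quad) (hC : 0 ≤ C) (hm : ∀ i, MomentLe C (m i)) : MomentLe C m₀ := by
  have hpos (n : ℕ) : (0 : ℝ) < n + 1 := by positivity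
  refine ⟨?_, ?_⟩
  · set φ : ℕ → ℝ × ℝ → ℝ := fun n η => cutoff (n + 1) η * max 0 (-excess η) with hφ_def
    have hφ (n : ℕ) : IsCcQuad (φ n) := (isCcQuad_cutoff (hpos n)).mul_continuousOn
      (Continuous.continuousOn (by have := continuous_excess; fun_prop))
    have hφ0 (n : ℕ) (η : ℝ × ℝ) : 0 ≤ φ n η :=
      mul_nonneg (cutoff_nonneg _ _) (le_max_left _ _)
    have h0 (n : ℕ) : φ n =ᵐ[m₀] 0 := by
      rw [← integral_eq_zero_iff_of_nonneg (hφ0 n)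
        ((hφ n).1.integrable_of_hasCompactSupport (hφ n).2.1)]
      refine tendsto_nhds_unique (h _ (hφ n)) (tendsto_const_nhds.congr fun i => ?_)
      refine (integral_eq_zero_of_ae ((hm i).ae_iso.mono fun η hη => ?_)).symm
      simp [hφ_def, iso_excess_nonneg hη]
    show ∀ᵐ η ∂m₀, η ∈ IsoRegion
    filter_upwards [hQ, ae_all_iff.2 h0] with η hη hη0
    obtain ⟨n, hn⟩ := ((tendsto_atTop_add_const_right _ (1 : ℝ)
      tendsto_natCast_atTop_atTop).eventually (tendsto_cutoff hη)).exists (f := atTop (α := ℕ))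
    have h1 := hη0 n
    simp only [hφ_def, hn, one_mul, Pi.zero_apply] at h1
    have h2 : -excess η ≤ 0 := h1 ▸ le_max_right _ _
    refine ⟨hη.2, ?_⟩
    unfold excess at h2
    linarith
  · set φ : ℕ → ℝ × ℝ → ℝ := fun n η => cutoff (n + 1) η * weight η with hφ_def
    have hφ (n : ℕ) : IsCcQuad (φ n) := (isCcQuad_cutoff (hpos n)).mul_continuousOn
      continuousOn_weight
    have hle (n : ℕ) : ∫⁻ η, ENNReal.ofReal (φ n η) ∂m₀ ≤ ENNReal.ofReal C := by
      rw [← ofReal_integral_eq_lintegral_ofReal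
        ((hφ n).1.integrable_of_hasCompactSupport (hφ n).2.1)
        (hQ.mono fun η hη => mul_nonneg (cutoff_nonneg _ _) (weight_nonneg hη))]
      refine ENNReal.ofReal_le_ofReal (le_of_tendsto (h _ (hφ n)) (Eventually.of_forall fun i => ?_))
      have := (hm i).abs_integral_le_of_le_weight hC (φ := φ n) zero_le_one fun η hη => by
        have hw := weight_nonneg (isoRegion_subset_quad hη)
        rw [hφ_def, one_mul, abs_of_nonneg (mul_nonneg (cutoff_nonneg _ _) hw)]
        exact mul_le_of_le_one_left hw (cutoff_le_one _ _)
      rw [one_mul] at this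
      exact (le_abs_self _).trans this
    calc ∫⁻ η, ENNReal.ofReal (weight η) ∂m₀
        ≤ ∫⁻ η, liminf (fun n => ENNReal.ofReal (φ n η)) atTop ∂m₀ := by
          refine lintegral_mono_ae (hQ.mono fun η hη => ?_)
          refine (Tendsto.liminf_eq (tendsto_const_nhds.congr' ?_)).ge
          filter_upwards [(tendsto_atTop_add_const_right _ (1 : ℝ)
            tendsto_natCast_atTop_atTop).eventually (tendsto_cutoff hη)] with n hn
          simp [hφ_def, hn]
      _ ≤ liminf (fun n => ∫⁻ η, ENNReal.ofReal (φ n η) ∂m₀) atTop :=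
          lintegral_liminf_le fun n => (hφ n).1.measurable.ennreal_ofReal
      _ ≤ _ := by
          refine liminf_le_of_le ⟨0, by simp⟩ fun b hb => ?_
          obtain ⟨n, hn⟩ := hb.exists
          exact hn.trans (hle n)

/-- A sequence of measures with bounded moments converges vaguely along any ultrafilter. -/
lemma exists_vagueTendsto {ι : Type*} (l : Ultrafilter ι) {m : ι → Measure (ℝ × ℝ)} (hC : 0 ≤ C)
    (hm : ∀ i, MomentLe C (m i)) : ∃ m₀, MomentLe C m₀ ∧ VagueTendsto (l : Filter ι) m m₀ := by
  have hInt (i : ι) (g : CompactlySupportedContinuousMap (ℝ × ℝ) ℝ) : Integrable g (m i) := by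
    obtain ⟨b, hb⟩ := g.hasCompactSupport.exists_bound_of_continuous g.continuous
    exact (hm i).integrable_of_bounded g.continuous.measurable hb
  have L (g : CompactlySupportedContinuousMap (ℝ × ℝ) ℝ) :
      ∃ x, Tendsto (fun i => ∫ η, g η ∂(m i)) l (𝓝 x) := by
    obtain ⟨b, hb⟩ := g.hasCompactSupport.exists_bound_of_continuous g.continuous
    have hb0 : 0 ≤ b := (norm_nonneg _).trans (hb 0)
    obtain ⟨x, -, hx⟩ := (isCompact_Icc (a := -(b * C)) (b := b * C)).ultrafilter_le_nhds'
      (l.map fun i => ∫ η, g η ∂(m i)) (by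
        rw [Ultrafilter.mem_map]
        exact Filter.mem_of_superset univ_mem fun i _ => abs_le.1
          ((hm i).abs_integral_le hC hb0 fun η _ => hb η))
    exact ⟨x, hx⟩
  choose Λ hΛ using L
  let Λ' : CompactlySupportedContinuousMap (ℝ × ℝ) ℝ →ₚ[ℝ] ℝ :=
  { toFun := Λ
    map_add' g g' := by
      refine tendsto_nhds_unique (hΛ (g + g')) (((hΛ g).add (hΛ g')).congr fun i => ?_)
      exact (integral_add (hInt i g) (hInt i g')).symm
    map_smul' c g := by
      refine tendsto_nhds_unique (hΛ (c • g)) (((hΛ g).const_smul c).congr fun i => ?_)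
      exact (integral_smul c _).symm
    monotone' g g' hgg' := le_of_tendsto_of_tendsto' (hΛ g) (hΛ g')
      fun i => integral_mono (hInt i g) (hInt i g') hgg' }
  have key : VagueTendsto (l : Filter ι) m ((RealRMK.rieszMeasure Λ').restrict Quad) := by
    intro φ hφ
    rw [setIntegral_eq_integral_of_forall_compl_eq_zero fun η hη =>
      image_eq_zero_of_notMem_tsupport fun h => hη (hφ.2.2 h)]
    let g : CompactlySupportedContinuousMap (ℝ × ℝ) ℝ := ⟨⟨φ, hφ.1⟩, hφ.2.1⟩
    have h1 : ∫ η, φ η ∂(RealRMK.rieszMeasure Λ') = Λ g := RealRMK.integral_rieszMeasure Λ' g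
    rw [h1]
    exact hΛ g
  exact ⟨_, key.momentLe (ae_restrict_mem measurableSet_quad) hC hm, key⟩

end VagueCompactness

/-! ### The limit flow -/

section LimitFlow

variable {K : ℝ × ℝ → ℝ × ℝ → ℝ} {r : ℝ × ℝ → ℝ}
    {K₀ K₁ al be R₀ R₁ mu sg B ε : ℝ} {fin : Measure (ℝ × ℝ)} {W : ℝ} {f : ℝ → Measure (ℝ × ℝ)}

lemma integral_eq_sub_of_right_deriv {G g : ℝ → ℝ} (hG : ContinuousOn G (Ici 0))
    (hg : ContinuousOn g (Ici 0)) (h : ∀ t, 0 ≤ t → HasDerivWithinAt G (g t) (Ioi t) t) {t : ℝ}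
    (ht : 0 ≤ t) : ∫ s in (0 : ℝ)..t, g s = G t - G 0 := by
  have hsub : uIcc 0 t ⊆ Ici 0 := by
    rw [uIcc_of_le ht]; exact Icc_subset_Ici_self
  refine intervalIntegral.integral_eq_sub_of_hasDeriv_right (hG.mono hsub) (fun s hs => h s ?_)
    (hg.mono hsub).intervalIntegrable
  rw [min_eq_left ht] at hs
  exact hs.1.le

/-- A vague limit of the Euler schemes along a nonprincipal ultrafilter. -/
structure IsLimitFlow (K : ℝ × ℝ → ℝ × ℝ → ℝ) (r : ℝ × ℝ → ℝ) (ε : ℝ) (fin : Measure (ℝ × ℝ))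
    (K₀ W : ℝ) (f : ℝ → Measure (ℝ × ℝ)) : Prop where
  momentLe : ∀ t, 0 ≤ t → MomentLe (momentBound K₀ W t) (f t)
  tendsto : ∀ t, 0 ≤ t → VagueTendsto (hyperfilter ℕ : Filter ℕ)
    (fun n => seqSol K r ε fin n ⌊t / seqStep ε fin n⌋₊) (f t)

namespace Scheme

lemma exists_limitFlow (H : Scheme K r K₀ K₁ al be R₀ R₁ mu sg B ε fin W 1) :
    ∃ f, IsLimitFlow K r ε fin K₀ W f := by
  have h (t : ℝ) : ∃ m, 0 ≤ t → MomentLe (momentBound K₀ W t) m ∧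
      VagueTendsto (hyperfilter ℕ : Filter ℕ)
        (fun n => seqSol K r ε fin n ⌊t / seqStep ε fin n⌋₊) m := by
    by_cases ht : 0 ≤ t
    · obtain ⟨m, hm⟩ := exists_vagueTendsto (hyperfilter ℕ) (H.momentBound_nonneg t)
        fun n => H.seqSol_floor_momentLe n ht
      exact ⟨m, fun _ => hm⟩
    · exact ⟨0, fun h => absurd h ht⟩
  choose f hf using h
  exact ⟨f, fun t ht => (hf t ht).1, fun t ht => (hf t ht).2⟩

end Scheme

namespace IsLimitFlow

lemma momentLe_of_le (hf : IsLimitFlow K r ε fin K₀ W f)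
    (H : Scheme K r K₀ K₁ al be R₀ R₁ mu sg B ε fin W 1) {s t : ℝ} (hs : 0 ≤ s) (hst : s ≤ t) :
    MomentLe (momentBound K₀ W t) (f s) := (hf.momentLe s hs).mono (H.momentBound_mono hst)

lemma eventually_seq_momentLe (H : Scheme K r K₀ K₁ al be R₀ R₁ mu sg B ε fin W 1) (t : ℝ)
    (l : Filter ℕ) : ∀ᶠ p : ℕ × ℝ in l ×ˢ 𝓝[Ici 0] t, MomentLe (momentBound K₀ W (t + 1))
      (seqSol K r ε fin p.1 ⌊p.2 / seqStep ε fin p.1⌋₊) := by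
  have h1 : ∀ᶠ u in 𝓝[Ici 0] t, 0 ≤ u ∧ u ≤ t + 1 := by
    filter_upwards [self_mem_nhdsWithin, nhdsWithin_le_nhds (Iic_mem_nhds (lt_add_one t))]
      with u h1 h2 using ⟨h1, h2⟩
  filter_upwards [h1.prod_inr l] with p hp
  exact (H.seqSol_floor_momentLe p.1 hp.1).mono (H.momentBound_mono hp.2)

lemma eventually_momentLe (hf : IsLimitFlow K r ε fin K₀ W f)
    (H : Scheme K r K₀ K₁ al be R₀ R₁ mu sg B ε fin W 1) (t : ℝ) :
    ∀ᶠ u in 𝓝[Ici 0] t, MomentLe (momentBound K₀ W (t + 1)) (f u) := by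
  filter_upwards [self_mem_nhdsWithin, nhdsWithin_le_nhds (Iic_mem_nhds (lt_add_one t))]
    with u h1 h2 using hf.momentLe_of_le H h1 h2

lemma vagueTendsto_prod (hf : IsLimitFlow K r ε fin K₀ W f)
    (H : Scheme K r K₀ K₁ al be R₀ R₁ mu sg B ε fin W 1) {t : ℝ} (ht : 0 ≤ t) :
    VagueTendsto ((hyperfilter ℕ : Filter ℕ) ×ˢ 𝓝[Ici 0] t)
      (fun p => seqSol K r ε fin p.1 ⌊p.2 / seqStep ε fin p.1⌋₊) (f t) := by
  intro φ hφ
  set C := momentBound K₀ W (t + 1)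
  have hC : 0 ≤ C := H.momentBound_nonneg _
  obtain ⟨b, -, hb⟩ := hφ.exists_bound
  refine tendsto_of_forall_approx (D := C + 1) (by linarith) fun δ hδ => ?_
  obtain ⟨g, hg, hgφ, hgs⟩ := hφ.1.exists_contDiff_approx 1 (ε := fun _ => δ) continuous_const
    fun _ => hδ
  have hgc : IsCcQuad g := isCcQuad_of_eq_zero hg.continuous hφ.2.1 hφ.2.2 fun η hη =>
    Function.notMem_support.1 fun h => hη (subset_tsupport φ (hgs h))
  obtain ⟨b', -, hb'⟩ := hgc.exists_bound
  have key (μ : Measure (ℝ × ℝ)) (hμ : MomentLe C μ) :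
      |∫ η, φ η ∂μ - ∫ η, g η ∂μ| ≤ (C + 1) * δ := by
    rw [← integral_sub (hμ.integrable_of_bounded hφ.1.measurable hb)
      (hμ.integrable_of_bounded hgc.1.measurable hb')]
    refine (hμ.abs_integral_le hC hδ.le fun η _ => ?_).trans (by nlinarith)
    rw [abs_sub_comm]
    exact (hgφ η).le
  exact ⟨_, _, (H.stepConsistent Nat.hyperfilter_le_atTop hg hgc).tendsto_prod
    (fun s hs => hf.tendsto s hs g hgc) ht,
    (eventually_seq_momentLe H t _).mono fun p hp => key _ hp,
    key _ (hf.momentLe_of_le H ht (by linarith))⟩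

lemma vagueTendsto (hf : IsLimitFlow K r ε fin K₀ W f)
    (H : Scheme K r K₀ K₁ al be R₀ R₁ mu sg B ε fin W 1) {t : ℝ} (ht : 0 ≤ t) :
    VagueTendsto (𝓝[Ici 0] t) f (f t) := by
  intro φ hφ
  rw [Metric.tendsto_nhds]
  intro δ hδ
  obtain ⟨pa, hpa, pb, hpb, hp⟩ := eventually_prod_iff.1
    ((Metric.tendsto_nhds.1 (hf.vagueTendsto_prod H ht φ hφ)) (δ / 2) (by positivity))
  filter_upwards [hpb, self_mem_nhdsWithin] with u hu hu0
  have h1 := le_of_tendsto ((hf.tendsto u hu0 φ hφ).dist (tendsto_const_nhds (x := ∫ η, φ η ∂(f t))))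
    (hpa.mono fun n hn => (hp hn hu).le)
  linarith

lemma tendsto_seq_generator (hf : IsLimitFlow K r ε fin K₀ W f)
    (H : Scheme K r K₀ K₁ al be R₀ R₁ mu sg B ε fin W 1) {φ : ℝ × ℝ → ℝ} (hφ : ContDiff ℝ 1 φ)
    (hc : IsCcQuad φ) {t : ℝ} (ht : 0 ≤ t) :
    Tendsto (fun p : ℕ × ℝ => generator (truncKernel K (p.1 + 1)) (truncFusion r (p.1 + 1)) ε⁻¹ φ
      (seqSol K r ε fin p.1 ⌊p.2 / seqStep ε fin p.1⌋₊))
      ((hyperfilter ℕ : Filter ℕ) ×ˢ 𝓝[Ici 0] t) (𝓝 (generator (extKernel K) r ε⁻¹ φ (f t))) := by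
  have hN : Tendsto (fun p : ℕ × ℝ => (p.1 : ℝ) + 1) ((hyperfilter ℕ : Filter ℕ) ×ˢ 𝓝[Ici 0] t)
      atTop := (tendsto_atTop_add_const_right _ (1 : ℝ) (tendsto_natCast_atTop_atTop.mono_left
        Nat.hyperfilter_le_atTop)).comp tendsto_fst
  have h1 := tendsto_coagulation H.coag (hf.vagueTendsto_prod H ht) (H.momentBound_nonneg (t + 1))
    (eventually_seq_momentLe H t _) (hf.momentLe_of_le H ht (by linarith))
    (κ := fun p => truncKernel K (p.1 + 1))
    (fun p => H.coag.isDominatedKernel_trunc (by positivity))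
    (fun S hS hSQ => hN.eventually (eventually_truncKernel_eq H.coag hS hSQ)) hc
  have h2 := tendsto_fusion H.fusion (hf.vagueTendsto_prod H ht)
    (ρ := fun p => truncFusion r (p.1 + 1))
    (fun S hS hSQ => hN.eventually (eventually_truncFusion_eq H.fusion hS hSQ)) (hc.da hφ)
  exact (h1.const_mul _).sub (h2.const_mul _)

/-- The weak equation in differential form. -/
lemma hasDerivWithinAt_integral (hf : IsLimitFlow K r ε fin K₀ W f)
    (H : Scheme K r K₀ K₁ al be R₀ R₁ mu sg B ε fin W 1) {φ : ℝ × ℝ → ℝ} (hφ : ContDiff ℝ 1 φ)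
    (hc : IsCcQuad φ) {t : ℝ} (ht : 0 ≤ t) :
    HasDerivWithinAt (fun s => ∫ η, φ η ∂(f s)) (generator (extKernel K) r ε⁻¹ φ (f t))
      (Ioi t) t :=
  (H.stepConsistent Nat.hyperfilter_le_atTop hφ hc).hasDerivWithinAt
    (g₀ := fun t => generator (extKernel K) r ε⁻¹ φ (f t))
    (fun s hs => hf.tendsto s hs φ hc) ht (hf.tendsto_seq_generator H hφ hc ht)

/-- The total dissipation by fusion is bounded. -/
lemma integral_dissipation_le (hf : IsLimitFlow K r ε fin K₀ W f)
    (H : Scheme K r K₀ K₁ al be R₀ R₁ mu sg B ε fin W 1) {φ : ℝ × ℝ → ℝ}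
    (hc : IsCcQuad φ) (hφ : ∀ η, φ η ∈ Icc (0 : ℝ) 1) {t : ℝ} (ht : 0 ≤ t) :
    ContinuousOn (fun s => ∫ η, r η * excess η * φ η ∂(f s)) (Ici 0) ∧
      ∫ s in (0 : ℝ)..t, ∫ η, r η * excess η * φ η ∂(f s) ≤ ε * W := by
  have hmem := H.sum_dissipation_mem hc.1.measurable hφ
  have hcons := H.stepConsistent_dissipation Nat.hyperfilter_le_atTop hc
  set S : ℕ → ℕ → ℝ := fun n k => ∑ j ∈ Finset.range k, seqStep ε fin n *
        ∫ η, truncFusion r (n + 1) η * excess η * φ η ∂(seqSol K r ε fin n j)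
  have hS (s : ℝ) : ∃ x ∈ Icc 0 (ε * W),
      Tendsto (fun n => S n ⌊s / seqStep ε fin n⌋₊) (hyperfilter ℕ : Filter ℕ) (𝓝 x) := by
    obtain ⟨x, hx, hx'⟩ := (isCompact_Icc (a := 0) (b := ε * W)).ultrafilter_le_nhds'
      ((hyperfilter ℕ).map fun n => S n ⌊s / seqStep ε fin n⌋₊) (by
        rw [Ultrafilter.mem_map]
        exact Filter.mem_of_superset univ_mem fun n _ => hmem n _)
    exact ⟨x, hx, hx'⟩
  choose S₀ hS₀ hlim using hS
  have hN (t : ℝ) : Tendsto (fun p : ℕ × ℝ => (p.1 : ℝ) + 1)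
      ((hyperfilter ℕ : Filter ℕ) ×ˢ 𝓝[Ici 0] t) atTop :=
    (tendsto_atTop_add_const_right _ (1 : ℝ) (tendsto_natCast_atTop_atTop.mono_left
        Nat.hyperfilter_le_atTop)).comp tendsto_fst
  have hcont : ContinuousOn (fun s => ∫ η, r η * excess η * φ η ∂(f s)) (Ici 0) := fun s hs =>
    tendsto_fusion H.fusion (hf.vagueTendsto H hs) (ρ := fun _ => r)
      (fun _ _ _ => Eventually.of_forall fun _ _ _ => rfl) hc
  refine ⟨hcont, ?_⟩
  rw [integral_eq_sub_of_right_deriv (hcons.continuousOn_limit fun s _ => hlim s) hcont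
    (fun s hs => hcons.hasDerivWithinAt (g₀ := fun s => ∫ η, r η * excess η * φ η ∂(f s))
      (fun s _ => hlim s) hs
      (tendsto_fusion H.fusion (hf.vagueTendsto_prod H hs)
        (ρ := fun p => truncFusion r (p.1 + 1))
        (fun T hT hTQ => (hN s).eventually (eventually_truncFusion_eq H.fusion hT hTQ)) hc)) ht]
  linarith [(hS₀ t).2, (hS₀ 0).1]

/-- The initial datum is attained. -/
lemma integral_zero (hf : IsLimitFlow K r ε fin K₀ W f) {φ : ℝ × ℝ → ℝ} (hc : IsCcQuad φ) :
    ∫ η, φ η ∂(f 0) = ∫ η, φ η ∂fin := by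
  refine tendsto_nhds_unique (hf.tendsto 0 le_rfl φ hc) (tendsto_const_nhds.congr fun n => ?_)
  simp only [zero_div, Nat.floor_zero]
  rfl

end IsLimitFlow

end LimitFlow

/-! ### Time-dependent test functions supported in a compact set -/

section TimeDependent

variable {ψ : ℝ × (ℝ × ℝ) → ℝ} {S : Set (ℝ × ℝ)}

lemma hasDerivAt_time (hψ : Differentiable ℝ ψ) (s : ℝ) (η : ℝ × ℝ) :
    HasDerivAt (fun u => ψ (u, η)) (fderiv ℝ ψ (s, η) (1, 0)) s :=
  (hψ (s, η)).hasFDerivAt.comp_hasDerivAt (x := s) (f := fun u => (u, η))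
    ((hasDerivAt_id _).prodMk (hasDerivAt_const _ _))

lemma continuous_deriv_time (hψ : ContDiff ℝ 1 ψ) :
    Continuous fun q : ℝ × (ℝ × ℝ) => deriv (fun u => ψ (u, q.2)) q.1 := by
  simp only [fun q : ℝ × (ℝ × ℝ) =>
    (hasDerivAt_time (hψ.differentiable one_ne_zero) q.1 q.2).deriv]
  exact (hψ.continuous_fderiv one_ne_zero).clm_apply continuous_const

lemma contDiff_slice (hψ : ContDiff ℝ 1 ψ) (s : ℝ) : ContDiff ℝ 1 fun η => ψ (s, η) :=
  hψ.comp (contDiff_const.prodMk contDiff_id)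

lemma da_slice_eq_fderiv (hψ : Differentiable ℝ ψ) (q : ℝ × (ℝ × ℝ)) :
    da (fun η => ψ (q.1, η)) q.2 = fderiv ℝ ψ q (0, (1, 0)) := by
  have h1 : HasDerivAt (fun a : ℝ => (q.1, (a, q.2.2))) ((0 : ℝ), ((1 : ℝ), (0 : ℝ))) q.2.1 :=
    (hasDerivAt_const _ _).prodMk ((hasDerivAt_id _).prodMk (hasDerivAt_const _ _))
  exact ((hψ q).hasFDerivAt.comp_hasDerivAt (x := q.2.1)
    (f := fun a => (q.1, (a, q.2.2))) h1).deriv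

lemma continuous_da_slice (hψ : ContDiff ℝ 1 ψ) :
    Continuous fun q : ℝ × (ℝ × ℝ) => da (fun η => ψ (q.1, η)) q.2 := by
  simp only [da_slice_eq_fderiv (hψ.differentiable one_ne_zero)]
  exact (hψ.continuous_fderiv one_ne_zero).clm_apply continuous_const

lemma deriv_time_eq_zero {η : ℝ × ℝ} (h : ∀ s, ψ (s, η) = 0) (s : ℝ) :
    deriv (fun u => ψ (u, η)) s = 0 := by simp [h]

lemma da_slice_eq_zero (hS : IsClosed S) (h0 : ∀ s, ∀ η ∉ S, ψ (s, η) = 0) (s : ℝ) {η : ℝ × ℝ}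
    (hη : η ∉ S) : da (fun p => ψ (s, p)) η = 0 := by
  refine da_eq_zero fun h => hη ?_
  refine closure_minimal (fun p hp => ?_) hS h
  by_contra hn
  exact hp (h0 s p hn)

lemma isCcQuad_slice (hψ : Continuous ψ) (hS : IsCompact S) (hSQ : S ⊆ Quad)
    (h0 : ∀ s, ∀ η ∉ S, ψ (s, η) = 0) (s : ℝ) : IsCcQuad fun η => ψ (s, η) :=
  isCcQuad_of_eq_zero (by fun_prop) hS hSQ (h0 s)

lemma eventually_abs_slice_sub_le (hψ : Continuous ψ) (hS : IsCompact S)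
    (h0 : ∀ s, ∀ η ∉ S, ψ (s, η) = 0) (t : ℝ) {δ : ℝ} (hδ : 0 < δ) :
    ∀ᶠ s in 𝓝 t, ∀ η, |ψ (s, η) - ψ (t, η)| ≤ δ := by
  have h : ∀ᶠ s in 𝓝 t, ∀ η ∈ S, |ψ (s, η) - ψ (t, η)| < δ := by
    refine hS.eventually_forall_of_forall_eventually fun η _ => ?_
    have : Continuous fun z : ℝ × (ℝ × ℝ) => |ψ (z.1, z.2) - ψ (t, z.2)| := by fun_prop
    refine this.continuousAt.eventually_lt continuousAt_const ?_
    simpa using hδ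
  filter_upwards [h] with s hs η
  by_cases hη : η ∈ S
  · exact (hs η hη).le
  · simp [h0 _ η hη, hδ.le]

lemma eventually_abs_slice_sub_sub_le (hψ : ContDiff ℝ 1 ψ) (hS : IsCompact S)
    (h0 : ∀ s, ∀ η ∉ S, ψ (s, η) = 0) (t : ℝ) {δ : ℝ} (hδ : 0 < δ) :
    ∀ᶠ s in 𝓝 t, ∀ η,
      |ψ (s, η) - ψ (t, η) - (s - t) * deriv (fun u => ψ (u, η)) t| ≤ δ * |s - t| := by
  obtain ⟨e, he, hb⟩ := Metric.eventually_nhds_iff_ball.1 (eventually_abs_slice_sub_le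
    (continuous_deriv_time hψ) hS (fun s η hη => deriv_time_eq_zero (fun u => h0 u η hη) s) t hδ)
  filter_upwards [Metric.ball_mem_nhds t he] with s hs η
  have h1 : ∀ u ∈ Metric.ball t e, HasDerivWithinAt
      (fun u => ψ (u, η) - u * deriv (fun u => ψ (u, η)) t)
      (deriv (fun u => ψ (u, η)) u - 1 * deriv (fun u => ψ (u, η)) t) (Metric.ball t e) u :=
    fun u _ => ((hasDerivAt_time (hψ.differentiable one_ne_zero) u
      η).differentiableAt.hasDerivAt.sub ((hasDerivAt_id u).mul_const _)).hasDerivWithinAt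
  have h2 := (convex_ball t e).norm_image_sub_le_of_norm_hasDerivWithin_le (C := δ) h1
    (fun u hu => by
      rw [one_mul]
      exact hb u hu η) (Metric.mem_ball_self he) hs
  rw [Real.norm_eq_abs, Real.norm_eq_abs] at h2
  convert h2 using 2
  ring

variable {K : ℝ × ℝ → ℝ × ℝ → ℝ} {r : ℝ × ℝ → ℝ}
    {K₀ K₁ al be R₀ R₁ mu sg B ε : ℝ} {fin : Measure (ℝ × ℝ)} {W : ℝ} {f : ℝ → Measure (ℝ × ℝ)}

namespace IsLimitFlow

lemma continuousOn_integral_slice (hf : IsLimitFlow K r ε fin K₀ W f)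
    (H : Scheme K r K₀ K₁ al be R₀ R₁ mu sg B ε fin W 1) (hψ : Continuous ψ) (hS : IsCompact S)
    (hSQ : S ⊆ Quad) (h0 : ∀ s, ∀ η ∉ S, ψ (s, η) = 0) :
    ContinuousOn (fun s => ∫ η, ψ (s, η) ∂(f s)) (Ici 0) := by
  intro t ht
  have hC := H.momentBound_nonneg (t + 1)
  have hc := isCcQuad_slice hψ hS hSQ h0
  refine tendsto_of_forall_approx (D := momentBound K₀ W (t + 1) + 1) (by linarith) fun δ hδ =>
    ⟨_, _, hf.vagueTendsto H ht _ (hc t), ?_, by simp; positivity⟩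
  filter_upwards [hf.eventually_momentLe H t,
    nhdsWithin_le_nhds (eventually_abs_slice_sub_le hψ hS h0 t hδ)] with s hs hsδ
  obtain ⟨b, -, hb⟩ := (hc s).exists_bound
  obtain ⟨b', -, hb'⟩ := (hc t).exists_bound
  rw [← integral_sub (hs.integrable_of_bounded (hc s).1.measurable hb)
    (hs.integrable_of_bounded (hc t).1.measurable hb')]
  refine (hs.abs_integral_le hC hδ.le fun η _ => hsδ η).trans ?_
  nlinarith

lemma continuousOn_coagulation_slice (hf : IsLimitFlow K r ε fin K₀ W f)
    (H : Scheme K r K₀ K₁ al be R₀ R₁ mu sg B ε fin W 1) (hψ : Continuous ψ) (hS : IsCompact S)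
    (hSQ : S ⊆ Quad) (h0 : ∀ s, ∀ η ∉ S, ψ (s, η) = 0) :
    ContinuousOn (fun s => ∫ q, extKernel K q * coagIncr (fun η => ψ (s, η)) q ∂((f s).prod (f s)))
      (Ici 0) := by
  intro t ht
  have hC := H.momentBound_nonneg (t + 1)
  have hc := isCcQuad_slice hψ hS hSQ h0
  have hK0 := H.coag.K0_pos
  have hal : al ∈ Icc (0 : ℝ) 1 := ⟨H.coag.al_mem.1.le, H.coag.al_mem.2.le⟩
  have hbe : be ∈ Icc (0 : ℝ) 1 := ⟨H.coag.be_mem.1.le, H.coag.be_mem.2.le⟩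
  have hκ := H.coag.isDominatedKernel_ext
  refine tendsto_of_forall_approx (D := 48 * K₀ * momentBound K₀ W (t + 1) ^ 2 + 1) (by positivity)
    fun δ hδ => ⟨_, _, tendsto_coagulation H.coag (hf.vagueTendsto H ht) hC
      (hf.eventually_momentLe H t) (hf.momentLe_of_le H ht (by linarith))
      (κ := fun _ => extKernel K) (fun _ => hκ)
      (fun T _ hTQ => Eventually.of_forall fun _ q hq => extKernel_eq (hTQ hq)) (hc t), ?_,
      by rw [sub_self, abs_zero]; positivity⟩
  filter_upwards [hf.eventually_momentLe H t,
    nhdsWithin_le_nhds (eventually_abs_slice_sub_le hψ hS h0 t hδ)] with s hs hsδ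
  obtain ⟨b, -, hb⟩ := (hc s).exists_bound
  obtain ⟨b', -, hb'⟩ := (hc t).exists_bound
  rw [← integral_sub
    (hκ.integrable_mul hs hal hbe (continuous_coagIncr (hc s).1).measurable (abs_coagIncr_le hb))
    (hκ.integrable_mul hs hal hbe (continuous_coagIncr (hc t).1).measurable (abs_coagIncr_le hb'))]
  have e (q : (ℝ × ℝ) × (ℝ × ℝ)) : extKernel K q * coagIncr (fun η => ψ (s, η)) q
      - extKernel K q * coagIncr (fun η => ψ (t, η)) q
      = extKernel K q * coagIncr (fun η => ψ (s, η) - ψ (t, η)) q := by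
    unfold coagIncr; ring
  simp only [e]
  refine (hκ.abs_integral_mul_le hs hC hK0.le hal hbe (b := 3 * δ) (by positivity)
    (abs_coagIncr_le hsδ)).trans ?_
  nlinarith

lemma continuousOn_fusion_slice (hf : IsLimitFlow K r ε fin K₀ W f)
    (H : Scheme K r K₀ K₁ al be R₀ R₁ mu sg B ε fin W 1) (hψ : ContDiff ℝ 1 ψ) (hS : IsCompact S)
    (hSQ : S ⊆ Quad) (h0 : ∀ s, ∀ η ∉ S, ψ (s, η) = 0) :
    ContinuousOn (fun s => ∫ η, r η * excess η * da (fun p => ψ (s, p)) η ∂(f s)) (Ici 0) := by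
  have hz (s : ℝ) (η : ℝ × ℝ) (hη : η ∉ S) : r η * excess η * da (fun p => ψ (s, p)) η = 0 := by
    rw [da_slice_eq_zero hS.isClosed h0 s hη, mul_zero]
  refine hf.continuousOn_integral_slice H
    (ψ := fun q => r q.2 * excess q.2 * da (fun p => ψ (q.1, p)) q.2) ?_ hS hSQ hz
  refine continuous_iff_continuousAt.2 fun q => ?_
  by_cases hq : q.2 ∈ Quad
  · have h1 : ContinuousAt (fun q : ℝ × (ℝ × ℝ) => r q.2) q :=
      (H.fusion.smooth.continuousOn.continuousAt (isOpen_quad.mem_nhds hq)).comp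
        continuousAt_snd
    exact (h1.mul (continuous_excess.comp continuous_snd).continuousAt).mul
      (continuous_da_slice hψ).continuousAt
  · have h1 : ∀ᶠ p : ℝ × (ℝ × ℝ) in 𝓝 q, p.2 ∉ S :=
      continuousAt_snd.eventually (hS.isClosed.isOpen_compl.mem_nhds fun h => hq (hSQ h))
    exact (continuousAt_const (y := (0 : ℝ))).congr (h1.mono fun p hp => (hz _ _ hp).symm)

/-- The product rule for the pairing of the flow with a time-dependent test function. -/
lemma hasDerivWithinAt_integral_slice (hf : IsLimitFlow K r ε fin K₀ W f)
    (H : Scheme K r K₀ K₁ al be R₀ R₁ mu sg B ε fin W 1) (hψ : ContDiff ℝ 1 ψ) (hS : IsCompact S)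
    (hSQ : S ⊆ Quad) (h0 : ∀ s, ∀ η ∉ S, ψ (s, η) = 0) {t : ℝ} (ht : 0 ≤ t) :
    HasDerivWithinAt (fun s => ∫ η, ψ (s, η) ∂(f s))
      (generator (extKernel K) r ε⁻¹ (fun η => ψ (t, η)) (f t)
        + ∫ η, deriv (fun u => ψ (u, η)) t ∂(f t)) (Ioi t) t := by
  have hC := H.momentBound_nonneg (t + 1)
  have hc := isCcQuad_slice hψ.continuous hS hSQ h0
  have hd : IsCcQuad fun η => deriv (fun u => ψ (u, η)) t :=
    isCcQuad_slice (continuous_deriv_time hψ) hS hSQ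
      (fun s η hη => deriv_time_eq_zero (fun u => h0 u η hη) s) t
  have h1 := hf.hasDerivWithinAt_integral H (contDiff_slice hψ t) (hc t) ht
  have h2 : HasDerivWithinAt (fun s => ∫ η, ψ (s, η) ∂(f s) - ∫ η, ψ (t, η) ∂(f s))
      (∫ η, deriv (fun u => ψ (u, η)) t ∂(f t)) (Ioi t) t := by
    rw [hasDerivWithinAt_iff_tendsto_slope' (by simp)]
    have hle : 𝓝[>] t ≤ 𝓝[Ici 0] t := nhdsWithin_mono _ fun s hs => ht.trans (le_of_lt hs)
    refine tendsto_of_forall_approx (D := momentBound K₀ W (t + 1) + 1) (by linarith) fun δ hδ =>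
      ⟨_, _, (hf.vagueTendsto H ht _ hd).mono_left hle, ?_, by simp; positivity⟩
    filter_upwards [hle (hf.eventually_momentLe H t), self_mem_nhdsWithin,
      nhdsWithin_le_nhds (eventually_abs_slice_sub_sub_le hψ hS h0 t hδ)] with s hs hst hsδ
    have hpos : 0 < s - t := sub_pos.2 hst
    obtain ⟨b, -, hb⟩ := (hc s).exists_bound
    obtain ⟨b', -, hb'⟩ := (hc t).exists_bound
    obtain ⟨b'', -, hb''⟩ := hd.exists_bound
    have i1 := hs.integrable_of_bounded (hc s).1.measurable hb
    have i2 := hs.integrable_of_bounded (hc t).1.measurable hb'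
    have i3 := hs.integrable_of_bounded hd.1.measurable hb''
    have h3 := hs.abs_integral_le hC (b := δ * |s - t|) (by positivity) fun η _ => hsδ η
    have i4 : Integrable (fun η => ψ (s, η) - ψ (t, η)) (f s) := i1.sub i2
    rw [integral_sub i4 (i3.const_mul _), integral_sub i1 i2, integral_const_mul,
      abs_of_pos hpos] at h3
    rw [slope_def_field, sub_self, sub_zero]
    set X := ∫ η, ψ (s, η) ∂(f s) - ∫ η, ψ (t, η) ∂(f s)
    set Y := ∫ η, deriv (fun u => ψ (u, η)) t ∂(f s)
    have e : X / (s - t) - Y = (X - (s - t) * Y) / (s - t) := by field_simp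
    rw [e, abs_div, abs_of_pos hpos, div_le_iff₀ hpos]
    refine h3.trans ?_
    have : 0 ≤ δ * (s - t) := by positivity
    nlinarith
  refine (h1.add h2).congr_of_eventuallyEq (Eventually.of_forall fun s => ?_) ?_ <;>
  simp

/-- The weak identity for test functions supported in a compact subset of the quadrant. -/
lemma weak_identity_of_compact (hf : IsLimitFlow K r ε fin K₀ W f)
    (H : Scheme K r K₀ K₁ al be R₀ R₁ mu sg B ε fin W 1) (hψ : ContDiff ℝ 1 ψ) (hS : IsCompact S)
    (hSQ : S ⊆ Quad) (h0 : ∀ s, ∀ η ∉ S, ψ (s, η) = 0) {t : ℝ} (ht : 0 ≤ t) :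
    ∫ η, ψ (t, η) ∂(f t) - ∫ η, ψ (0, η) ∂fin =
      1 / 2 * (∫ s in (0 : ℝ)..t,
        ∫ q, extKernel K q * coagIncr (fun η => ψ (s, η)) q ∂((f s).prod (f s)))
      - ε⁻¹ * (∫ s in (0 : ℝ)..t, ∫ η, r η * excess η * da (fun p => ψ (s, p)) η ∂(f s))
      + ∫ s in (0 : ℝ)..t, ∫ η, deriv (fun u => ψ (u, η)) s ∂(f s) := by
  have hsub : uIcc 0 t ⊆ Ici 0 := by
    rw [uIcc_of_le ht]; exact Icc_subset_Ici_self
  have c1 := hf.continuousOn_coagulation_slice H hψ.continuous hS hSQ h0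
  have c2 := hf.continuousOn_fusion_slice H hψ hS hSQ h0
  have c3 := hf.continuousOn_integral_slice H (continuous_deriv_time hψ) hS hSQ
      (fun s η hη => deriv_time_eq_zero (fun u => h0 u η hη) s)
  have c4 := (c1.const_smul (1 / 2 : ℝ)).sub (c2.const_smul ε⁻¹)
  have i1 := (c1.mono hsub).intervalIntegrable (μ := volume)
  have i2 := (c2.mono hsub).intervalIntegrable (μ := volume)
  have i3 := (c3.mono hsub).intervalIntegrable (μ := volume)
  have h := integral_eq_sub_of_right_deriv
    (hf.continuousOn_integral_slice H hψ.continuous hS hSQ h0) (c4.add c3)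
    (fun s hs => hf.hasDerivWithinAt_integral_slice H hψ hS hSQ h0 hs) ht
  simp only [hf.integral_zero (isCcQuad_slice hψ.continuous hS hSQ h0 0)] at h
  rw [← h]
  simp only [Pi.add_apply, Pi.sub_apply, Pi.smul_apply, smul_eq_mul]
  rw [intervalIntegral.integral_add ((i1.const_mul _).sub (i2.const_mul _)) i3,
    intervalIntegral.integral_sub (i1.const_mul _) (i2.const_mul _),
    intervalIntegral.integral_const_mul, intervalIntegral.integral_const_mul]

end IsLimitFlow

end TimeDependent

/-! ### General test functions -/

section GeneralTest

variable {ψ : ℝ × (ℝ × ℝ) → ℝ}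

lemma IsTestFun.exists_bound (hψ : IsTestFun ψ) : ∃ b, 0 ≤ b ∧ ∀ q, |ψ q| ≤ b := by
  obtain ⟨b, hb⟩ := hψ.2.1.exists_bound_of_continuous hψ.1.continuous
  exact ⟨b, (norm_nonneg _).trans (hb 0), hb⟩

lemma IsTestFun.exists_deriv_bound (hψ : IsTestFun ψ) : ∃ b, 0 ≤ b ∧
    ∀ s η, |deriv (fun u => ψ (u, η)) s| ≤ b ∧ |da (fun p => ψ (s, p)) η| ≤ b := by
  have hd := hψ.1.differentiable one_ne_zero
  obtain ⟨b, hb⟩ := (hψ.2.1.fderiv ℝ).exists_bound_of_continuous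
    (hψ.1.continuous_fderiv one_ne_zero)
  refine ⟨b, (norm_nonneg _).trans (hb 0), fun s η => ⟨?_, ?_⟩⟩
  · rw [(hasDerivAt_time hd s η).deriv, ← Real.norm_eq_abs]
    refine ((fderiv ℝ ψ (s, η)).le_of_opNorm_le (hb _) _).trans_eq ?_
    simp [Prod.norm_def]
  · rw [da_slice_eq_fderiv hd (s, η), ← Real.norm_eq_abs]
    refine ((fderiv ℝ ψ (s, η)).le_of_opNorm_le (hb _) _).trans_eq ?_
    simp [Prod.norm_def]

lemma IsTestFun.exists_eq_zero (hψ : IsTestFun ψ) :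
    ∃ A : ℝ, ∀ s a v, A < a → ψ (s, (a, v)) = 0 := by
  obtain ⟨A, hA⟩ := hψ.2.1.exists_bound_of_continuousOn (f := fun q : ℝ × (ℝ × ℝ) => q.2.1)
    (by fun_prop)
  refine ⟨A, fun s a v ha => by_contra fun h => ?_⟩
  have := hA (s, (a, v)) (subset_tsupport ψ h)
  exact absurd ((le_abs_self _).trans this) (not_le.2 ha)

lemma deriv_cutoffAux_eq_zero {R x : ℝ} (hR : 0 < R) (h1 : 2 / R ≤ x) (h2 : x ≤ R) :
    HasDerivAt (cutoffAux R) 0 x := by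
  have h : IsLocalMax (cutoffAux R) x := Eventually.of_forall fun y => by
    rw [cutoffAux_eq_one hR h1 h2]
    exact cutoffAux_le_one R y
  rw [← h.deriv_eq_zero]
  exact ((contDiff_cutoffAux R).differentiable one_ne_zero x).hasDerivAt

/-- On the isoperimetric region the cutoff does not contribute to the derivative in the area. -/
lemma da_mul_cutoff {A R s : ℝ} (hψ : ContDiff ℝ 1 ψ) (hA : ∀ s a v, A < a → ψ (s, (a, v)) = 0)
    (hR1 : 1 ≤ R) (hRA : A ≤ R) {η : ℝ × ℝ} (hη : η ∈ IsoRegion) :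
    da (fun p => ψ (s, p) * cutoff R p) η = da (fun p => ψ (s, p)) η * cutoff R η := by
  have hR : 0 < R := by linarith
  obtain ⟨x, v⟩ := η
  rcases lt_or_ge R x with hx | hx
  · have h : ∀ᶠ a in 𝓝 x, ψ (s, (a, v)) = 0 :=
      Filter.mem_of_superset (Ioi_mem_nhds (hRA.trans_lt hx)) fun a ha => hA s a v ha
    have h1 : (fun a => ψ (s, (a, v))) =ᶠ[𝓝 x] fun _ => 0 := h
    have h2 : (fun a => ψ (s, (a, v)) * cutoff R (a, v)) =ᶠ[𝓝 x] fun _ => 0 :=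
      h.mono fun a ha => by simp [ha]
    simp only [da]
    rw [h1.deriv_eq, h2.deriv_eq]
    simp
  rcases lt_or_ge v (1 / R) with hv | hv
  · have h (a : ℝ) : cutoff R (a, v) = 0 :=
      cutoff_eq_zero hR fun h => hv.not_ge h.2.1
    simp [da, h]
  · have h2 : 2 / R ≤ x := by
      have := iso_two_mul_le_fst hη (by positivity) ((div_le_one hR).2 hR1) hv
      calc 2 / R = 2 * (1 / R) := by ring
        _ ≤ x := this
    have hd := hasDerivAt_da ((contDiff_slice hψ s).differentiable one_ne_zero) x v
    have := (hd.mul ((deriv_cutoffAux_eq_zero hR h2 hx).mul_const (cutoffAux R v))).deriv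
    refine Eq.trans ?_ (this.trans ?_)
    · rfl
    · simp [cutoff]

lemma MomentLe.tendsto_integral_of_eventually_eq {C b : ℝ} {m : Measure (ℝ × ℝ)}
    (hm : MomentLe C m) {φ : ℝ × ℝ → ℝ} {φ' : ℕ → ℝ × ℝ → ℝ} (hφ' : ∀ n, Measurable (φ' n))
    (hb : ∀ n η, |φ' n η| ≤ b) (h : ∀ η ∈ Quad, ∀ᶠ n in atTop, φ' n η = φ η) :
    Tendsto (fun n => ∫ η, φ' n η ∂m) atTop (𝓝 (∫ η, φ η ∂m)) := by
  have := hm.isFiniteMeasure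
  exact tendsto_integral_of_dominated_convergence (fun _ => b)
    (fun n => (hφ' n).aestronglyMeasurable) (integrable_const b) (fun n => ae_of_all _ (hb n))
    (hm.ae_quad.mono fun η hη => tendsto_nhds_of_eventually_eq (h η hη))

lemma eventually_cutoff_nat_eq_one {η : ℝ × ℝ} (h : η ∈ Quad) :
    ∀ᶠ n : ℕ in atTop, cutoff (n + 1) η = 1 :=
  (tendsto_atTop_add_const_right _ (1 : ℝ) tendsto_natCast_atTop_atTop).eventually
    (tendsto_cutoff h)

lemma abs_mul_cutoff_le {x b : ℝ} (hx : |x| ≤ b) (R : ℝ) (η : ℝ × ℝ) : |x * cutoff R η| ≤ b := by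
  rw [abs_mul, abs_of_nonneg (cutoff_nonneg R η)]
  exact (mul_le_of_le_one_right (abs_nonneg x) (cutoff_le_one R η)).trans hx

lemma quad_add {η η' : ℝ × ℝ} (h : η ∈ Quad) (h' : η' ∈ Quad) : η + η' ∈ Quad :=
  ⟨add_pos h.1 h'.1, add_pos h.2 h'.2⟩

variable {K : ℝ × ℝ → ℝ × ℝ → ℝ} {r : ℝ × ℝ → ℝ}
    {K₀ K₁ al be R₀ R₁ mu sg B ε : ℝ} {fin : Measure (ℝ × ℝ)} {W : ℝ} {f : ℝ → Measure (ℝ × ℝ)}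

lemma IsFusionKernel.aemeasurable (hr : IsFusionKernel r R₀ R₁ mu sg B) {C : ℝ}
    {m : Measure (ℝ × ℝ)} (hm : MomentLe C m) : AEMeasurable r m :=
  ⟨Quad.indicator r, ContinuousOn.measurable_indicator_real hr.smooth.continuousOn
    measurableSet_quad, hm.ae_quad.mono fun _ hη => (Set.indicator_of_mem hη r).symm⟩

lemma aemeasurable_liminf_nat {X : Type*} [MeasurableSpace X] {μ : Measure X}
    {g : ℕ → X → ℝ≥0∞} (hg : ∀ n, AEMeasurable (g n) μ) :
    AEMeasurable (fun x => liminf (fun n => g n x) atTop) μ := by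
  refine ⟨fun x => liminf (fun n => (hg n).mk (g n) x) atTop,
    Measurable.liminf fun n => (hg n).measurable_mk, ?_⟩
  filter_upwards [ae_all_iff.2 fun n => (hg n).ae_eq_mk] with x hx
  simp only [hx]

/-- The rate of dissipation by fusion. -/
def dissipation (r : ℝ × ℝ → ℝ) (m : Measure (ℝ × ℝ)) : ℝ≥0∞ :=
  ∫⁻ η, ENNReal.ofReal (r η * excess η) ∂m

lemma IsFusionKernel.iso_mul_excess_nonneg (hr : IsFusionKernel r R₀ R₁ mu sg B) {η : ℝ × ℝ}
    (hη : η ∈ IsoRegion) : 0 ≤ r η * excess η :=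
  mul_nonneg (hr.pos _ (isoRegion_subset_quad hη)).le (iso_excess_nonneg hη)

lemma IsFusionKernel.ofReal_integral_cutoff (hr : IsFusionKernel r R₀ R₁ mu sg B) {C : ℝ}
    {m : Measure (ℝ × ℝ)} (hm : MomentLe C m) {R : ℝ} (hR : 0 < R) :
    ENNReal.ofReal (∫ η, r η * excess η * cutoff R η ∂m) =
      ∫⁻ η, ENNReal.ofReal (r η * excess η * cutoff R η) ∂m := by
  have h1 : IsCcQuad fun η => cutoff R η * (r η * excess η) :=
    (isCcQuad_cutoff hR).mul_continuousOn
      (hr.smooth.continuousOn.mul continuous_excess.continuousOn)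
  simp only [fun η => mul_comm (cutoff R η) (r η * excess η)] at h1
  obtain ⟨b, -, hb⟩ := h1.exists_bound
  exact ofReal_integral_eq_lintegral_ofReal (hm.integrable_of_bounded h1.1.measurable hb)
    (hm.ae_iso.mono fun η hη => mul_nonneg (hr.iso_mul_excess_nonneg hη) (cutoff_nonneg R η))

lemma IsFusionKernel.ofReal_integral_cutoff_le (hr : IsFusionKernel r R₀ R₁ mu sg B) {C : ℝ}
    {m : Measure (ℝ × ℝ)} (hm : MomentLe C m) {R : ℝ} (hR : 0 < R) :
    ENNReal.ofReal (∫ η, r η * excess η * cutoff R η ∂m) ≤ dissipation r m := by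
  rw [hr.ofReal_integral_cutoff hm hR]
  exact lintegral_mono_ae (hm.ae_iso.mono fun η hη => ENNReal.ofReal_le_ofReal
    (mul_le_of_le_one_right (hr.iso_mul_excess_nonneg hη) (cutoff_le_one R η)))

lemma IsFusionKernel.liminf_integral_cutoff (hr : IsFusionKernel r R₀ R₁ mu sg B) {C : ℝ}
    {m : Measure (ℝ × ℝ)} (hm : MomentLe C m) :
    liminf (fun n : ℕ => ENNReal.ofReal (∫ η, r η * excess η * cutoff (n + 1) η ∂m)) atTop =
      dissipation r m := by
  refine le_antisymm ?_ ?_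
  · exact (liminf_le_liminf (Eventually.of_forall fun n : ℕ =>
      hr.ofReal_integral_cutoff_le hm (R := n + 1) (by positivity))).trans_eq
        (liminf_const _)
  · simp only [fun n : ℕ => hr.ofReal_integral_cutoff hm (R := n + 1) (by positivity)]
    refine le_trans (lintegral_mono_ae (hm.ae_quad.mono fun η hη => ?_))
      (lintegral_liminf_le' fun n => ((((hr.aemeasurable hm).mul
        continuous_excess.measurable.aemeasurable).mul
        (contDiff_cutoff (n + 1)).continuous.measurable.aemeasurable).ennreal_ofReal))
    refine le_of_eq (Tendsto.liminf_eq (tendsto_nhds_of_eventually_eq ?_)).symm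
    filter_upwards [eventually_cutoff_nat_eq_one hη] with n hn
    simp [hn]

namespace IsLimitFlow

lemma aemeasurable_and_lintegral_dissipation_le (hf : IsLimitFlow K r ε fin K₀ W f)
    (H : Scheme K r K₀ K₁ al be R₀ R₁ mu sg B ε fin W 1) {t : ℝ} (ht : 0 ≤ t) :
    AEMeasurable (fun s => dissipation r (f s)) (volume.restrict (Ioc 0 t)) ∧
      ∫⁻ s in Ioc 0 t, dissipation r (f s) ≤ ENNReal.ofReal (ε * W) := by
  have hI (n : ℕ) := hf.integral_dissipation_le H (isCcQuad_cutoff (R := n + 1) (by positivity))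
    (fun η => ⟨cutoff_nonneg _ η, cutoff_le_one _ η⟩) ht
  have hmeas (n : ℕ) : AEMeasurable (fun s => ENNReal.ofReal
      (∫ η, r η * excess η * cutoff (n + 1) η ∂(f s))) (volume.restrict (Ioc 0 t)) :=
    ((((hI n).1.mono fun s hs => le_of_lt hs.1).aestronglyMeasurable
      measurableSet_Ioc).aemeasurable).ennreal_ofReal
  have heq : (fun s => liminf (fun n : ℕ => ENNReal.ofReal
      (∫ η, r η * excess η * cutoff (n + 1) η ∂(f s))) atTop) =ᵐ[volume.restrict (Ioc 0 t)]
      fun s => dissipation r (f s) :=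
    (ae_restrict_mem measurableSet_Ioc).mono fun s hs =>
      H.fusion.liminf_integral_cutoff (hf.momentLe s hs.1.le)
  refine ⟨(aemeasurable_liminf_nat hmeas).congr heq, ?_⟩
  rw [← lintegral_congr_ae heq]
  refine (lintegral_liminf_le' hmeas).trans ?_
  refine (liminf_le_liminf (Eventually.of_forall fun n : ℕ => ?_)).trans_eq (liminf_const _)
  rw [← ofReal_integral_eq_lintegral_ofReal, ← intervalIntegral.integral_of_le ht]
  · exact ENNReal.ofReal_le_ofReal (hI n).2
  · have hsub : uIcc 0 t ⊆ Ici 0 := by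
      rw [uIcc_of_le ht]; exact Icc_subset_Ici_self
    exact (((hI n).1.mono hsub).intervalIntegrable (μ := volume)).1
  · refine (ae_restrict_mem measurableSet_Ioc).mono fun s hs => ?_
    exact integral_nonneg_of_ae ((hf.momentLe s hs.1.le).ae_iso.mono fun η hη =>
      mul_nonneg (H.fusion.iso_mul_excess_nonneg hη) (cutoff_nonneg _ η))

lemma tendsto_fusion_cutoff (hf : IsLimitFlow K r ε fin K₀ W f)
    (H : Scheme K r K₀ K₁ al be R₀ R₁ mu sg B ε fin W 1) (hψ : IsTestFun ψ) {t : ℝ} (ht : 0 ≤ t)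
    (hmeas : ∀ n : ℕ, ContinuousOn (fun s => ∫ η, r η * excess η *
      da (fun p => ψ (s, p) * cutoff (n + 1) p) η ∂(f s)) (Ici 0)) :
    Tendsto (fun n : ℕ => ∫ s in (0 : ℝ)..t, ∫ η, r η * excess η *
      da (fun p => ψ (s, p) * cutoff (n + 1) p) η ∂(f s)) atTop
      (𝓝 (∫ s in (0 : ℝ)..t, ∫ η, r η * excess η * da (fun p => ψ (s, p)) η ∂(f s))) := by
  obtain ⟨L, hL0, hL⟩ := hψ.exists_deriv_bound
  obtain ⟨A, hA⟩ := hψ.exists_eq_zero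
  have hr := H.fusion
  obtain ⟨hD1, hD2⟩ := hf.aemeasurable_and_lintegral_dissipation_le H ht
  have hDne : ∫⁻ s in Ioc 0 t, dissipation r (f s) ≠ ⊤ := (hD2.trans_lt ENNReal.ofReal_lt_top).ne
  have hfin : ∀ᵐ s ∂(volume.restrict (Ioc 0 t)), dissipation r (f s) < ⊤ :=
    ae_lt_top' hD1 hDne
  have hlarge : ∀ᶠ n : ℕ in atTop, A ≤ n + 1 :=
    (tendsto_atTop_add_const_right _ (1 : ℝ) tendsto_natCast_atTop_atTop).eventually
      (eventually_ge_atTop A)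
  have hInt (s : ℝ) (hs : 0 ≤ s) (h : dissipation r (f s) < ⊤) :
      Integrable (fun η => r η * excess η) (f s) := by
    have hm := hf.momentLe s hs
    refine ⟨((hr.aemeasurable hm).mul
      continuous_excess.measurable.aemeasurable).aestronglyMeasurable, ?_⟩
    rwa [hasFiniteIntegral_iff_ofReal (hm.ae_iso.mono fun η hη => hr.iso_mul_excess_nonneg hη)]
  have hpt (s : ℝ) (n : ℕ) (hn : A ≤ n + 1) {η : ℝ × ℝ} (hη : η ∈ IsoRegion) :
      da (fun p => ψ (s, p) * cutoff (n + 1) p) η = da (fun p => ψ (s, p)) η * cutoff (n + 1) η :=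
    da_mul_cutoff hψ.1 hA (by simp) hn hη
  have hbd (s : ℝ) (n : ℕ) (hn : A ≤ n + 1) {η : ℝ × ℝ} (hη : η ∈ IsoRegion) :
      ‖r η * excess η * da (fun p => ψ (s, p) * cutoff (n + 1) p) η‖ ≤ r η * excess η * L := by
    have h0 := hr.iso_mul_excess_nonneg hη
    rw [hpt s n hn hη, norm_mul, Real.norm_of_nonneg h0]
    exact mul_le_mul_of_nonneg_left (abs_mul_cutoff_le (hL s η).2 _ _) h0
  have hval (s : ℝ) (hs : 0 ≤ s) : ∫ η, r η * excess η ∂(f s) = (dissipation r (f s)).toReal := by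
    have hm := hf.momentLe s hs
    exact integral_eq_lintegral_of_nonneg_ae
      (hm.ae_iso.mono fun η hη => hr.iso_mul_excess_nonneg hη)
      ((hr.aemeasurable hm).mul
      continuous_excess.measurable.aemeasurable).aestronglyMeasurable
  simp only [intervalIntegral.integral_of_le ht]
  refine tendsto_integral_filter_of_dominated_convergence
    (fun s => (dissipation r (f s)).toReal * L)
    (Eventually.of_forall fun n => ((hmeas n).mono fun s hs => le_of_lt hs.1).aestronglyMeasurable
      measurableSet_Ioc) ?_ ((integrable_toReal_of_lintegral_ne_top hD1 hDne).mul_const L) ?_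
  · filter_upwards [hlarge] with n hn
    filter_upwards [hfin, ae_restrict_mem measurableSet_Ioc] with s hs hs0
    rw [← hval s hs0.1.le, ← integral_mul_const]
    exact norm_integral_le_of_norm_le ((hInt s hs0.1.le hs).mul_const L)
      ((hf.momentLe s hs0.1.le).ae_iso.mono fun η hη => hbd s n hn hη)
  · filter_upwards [hfin, ae_restrict_mem measurableSet_Ioc] with s hs hs0
    have hm := hf.momentLe s hs0.1.le
    refine tendsto_integral_filter_of_dominated_convergence (fun η => r η * excess η * L)
      (Eventually.of_forall fun n => ?_) ?_ ((hInt s hs0.1.le hs).mul_const L) ?_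
    · exact (((hr.aemeasurable hm).mul continuous_excess.measurable.aemeasurable).mul
        (continuous_da ((contDiff_slice hψ.1 s).mul
          (contDiff_cutoff _))).measurable.aemeasurable).aestronglyMeasurable
    · filter_upwards [hlarge] with n hn
      exact hm.ae_iso.mono fun η hη => hbd s n hn hη
    · filter_upwards [hm.ae_iso] with η hη
      refine tendsto_nhds_of_eventually_eq ?_
      filter_upwards [hlarge, eventually_cutoff_nat_eq_one (isoRegion_subset_quad hη)]
        with n hn hn1
      rw [hpt s n hn hη, hn1, mul_one]

lemma tendsto_coagulation_cutoff (hf : IsLimitFlow K r ε fin K₀ W f)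
    (H : Scheme K r K₀ K₁ al be R₀ R₁ mu sg B ε fin W 1) (hψ : IsTestFun ψ) {t : ℝ} (ht : 0 ≤ t)
    (hmeas : ∀ n : ℕ, ContinuousOn (fun s => ∫ q, extKernel K q *
      coagIncr (fun p => ψ (s, p) * cutoff (n + 1) p) q ∂((f s).prod (f s))) (Ici 0)) :
    Tendsto (fun n : ℕ => ∫ s in (0 : ℝ)..t, ∫ q, extKernel K q *
      coagIncr (fun p => ψ (s, p) * cutoff (n + 1) p) q ∂((f s).prod (f s))) atTop
      (𝓝 (∫ s in (0 : ℝ)..t,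
        ∫ q, extKernel K q * coagIncr (fun p => ψ (s, p)) q ∂((f s).prod (f s)))) := by
  obtain ⟨b, hb0, hb⟩ := hψ.exists_bound
  have hK0 := H.coag.K0_pos
  have hal : al ∈ Icc (0 : ℝ) 1 := ⟨H.coag.al_mem.1.le, H.coag.al_mem.2.le⟩
  have hbe : be ∈ Icc (0 : ℝ) 1 := ⟨H.coag.be_mem.1.le, H.coag.be_mem.2.le⟩
  have hκ := H.coag.isDominatedKernel_ext
  have hbn (n : ℕ) (s : ℝ) (q : (ℝ × ℝ) × (ℝ × ℝ)) :
      |coagIncr (fun p => ψ (s, p) * cutoff (n + 1) p) q| ≤ 3 * b :=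
    abs_coagIncr_le (fun η => abs_mul_cutoff_le (hb (s, η)) _ η) q
  simp only [intervalIntegral.integral_of_le ht]
  refine tendsto_integral_of_dominated_convergence
    (fun _ => 16 * K₀ * (3 * b) * momentBound K₀ W t ^ 2)
    (fun n => ((hmeas n).mono fun s hs => le_of_lt hs.1).aestronglyMeasurable
      measurableSet_Ioc) (integrable_const _) (fun n => ?_) ?_
  · filter_upwards [ae_restrict_mem measurableSet_Ioc] with s hs
    exact hκ.abs_integral_mul_le (hf.momentLe_of_le H hs.1.le hs.2) (H.momentBound_nonneg t) hK0.le
      hal hbe (by positivity) (hbn n s)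
  · filter_upwards [ae_restrict_mem measurableSet_Ioc] with s hs
    have hm := hf.momentLe s hs.1.le
    have hc (n : ℕ) : Continuous (coagIncr fun p => ψ (s, p) * cutoff (n + 1) p) :=
      continuous_coagIncr ((contDiff_slice hψ.1 s).continuous.mul (contDiff_cutoff _).continuous)
    refine tendsto_integral_of_dominated_convergence (fun q => ‖extKernel K q * (3 * b)‖)
      (fun n => (hκ.measurable.mul (hc n).measurable).aestronglyMeasurable)
      (hκ.integrable_mul hm hal hbe measurable_const (fun _ => le_rfl)).norm
      (fun n => ae_of_all _ fun q => ?_) ?_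
    · rw [norm_mul, norm_mul, Real.norm_of_nonneg (by positivity : 0 ≤ 3 * b)]
      exact mul_le_mul_of_nonneg_left (hbn n s q) (norm_nonneg _)
    · filter_upwards [hm.ae_prod_iso] with q hq
      have h1 := isoRegion_subset_quad hq.1
      have h2 := isoRegion_subset_quad hq.2
      refine tendsto_nhds_of_eventually_eq ?_
      filter_upwards [eventually_cutoff_nat_eq_one h1, eventually_cutoff_nat_eq_one h2,
        eventually_cutoff_nat_eq_one (quad_add h1 h2)] with n e1 e2 e3
      simp [coagIncr, e1, e2, e3]

lemma tendsto_time_cutoff (hf : IsLimitFlow K r ε fin K₀ W f)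
    (H : Scheme K r K₀ K₁ al be R₀ R₁ mu sg B ε fin W 1) (hψ : IsTestFun ψ) {t : ℝ} (ht : 0 ≤ t)
    (hmeas : ∀ n : ℕ, ContinuousOn (fun s => ∫ η,
      deriv (fun u => ψ (u, η) * cutoff (n + 1) η) s ∂(f s)) (Ici 0)) :
    Tendsto (fun n : ℕ => ∫ s in (0 : ℝ)..t, ∫ η,
      deriv (fun u => ψ (u, η) * cutoff (n + 1) η) s ∂(f s)) atTop
      (𝓝 (∫ s in (0 : ℝ)..t, ∫ η, deriv (fun u => ψ (u, η)) s ∂(f s))) := by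
  obtain ⟨b, hb0, hb⟩ := hψ.exists_deriv_bound
  have hbn (n : ℕ) (s : ℝ) (η : ℝ × ℝ) :
      |deriv (fun u => ψ (u, η) * cutoff (n + 1) η) s| ≤ b := by
    rw [deriv_mul_const_field]
    exact abs_mul_cutoff_le (hb s η).1 _ η
  simp only [intervalIntegral.integral_of_le ht]
  refine tendsto_integral_of_dominated_convergence
    (fun _ => b * momentBound K₀ W t)
    (fun n => ((hmeas n).mono fun s hs => le_of_lt hs.1).aestronglyMeasurable
      measurableSet_Ioc) (integrable_const _) (fun n => ?_) ?_
  · filter_upwards [ae_restrict_mem measurableSet_Ioc] with s hs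
    exact (hf.momentLe_of_le H hs.1.le hs.2).abs_integral_le (H.momentBound_nonneg t) hb0
      fun η _ => hbn n s η
  · filter_upwards [ae_restrict_mem measurableSet_Ioc] with s hs
    refine (hf.momentLe s hs.1.le).tendsto_integral_of_eventually_eq (fun n => ?_)
      (fun n => hbn n s) fun η hη => ?_
    · simp only [deriv_mul_const_field]
      have := (continuous_deriv_time hψ.1).comp (Continuous.prodMk_right s)
      exact (this.mul (contDiff_cutoff _).continuous).measurable
    · filter_upwards [eventually_cutoff_nat_eq_one hη] with n hn
      simp [hn]

lemma weak_identity (hf : IsLimitFlow K r ε fin K₀ W f)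
    (H : Scheme K r K₀ K₁ al be R₀ R₁ mu sg B ε fin W 1) (hψ : IsTestFun ψ) {t : ℝ} (ht : 0 ≤ t) :
    ∫ η, ψ (t, η) ∂(f t) - ∫ η, ψ (0, η) ∂fin =
      1 / 2 * (∫ s in (0 : ℝ)..t,
        ∫ q, extKernel K q * coagIncr (fun η => ψ (s, η)) q ∂((f s).prod (f s)))
      - ε⁻¹ * (∫ s in (0 : ℝ)..t, ∫ η, r η * excess η * da (fun p => ψ (s, p)) η ∂(f s))
      + ∫ s in (0 : ℝ)..t, ∫ η, deriv (fun u => ψ (u, η)) s ∂(f s) := by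
  obtain ⟨b, hb0, hb⟩ := hψ.exists_bound
  have hdiff (n : ℕ) : ContDiff ℝ 1 fun q : ℝ × (ℝ × ℝ) => ψ q * cutoff (n + 1) q.2 :=
    hψ.1.mul ((contDiff_cutoff _).comp contDiff_snd)
  have hcut (n : ℕ) : IsCcQuad (cutoff ((n : ℝ) + 1)) := isCcQuad_cutoff (by positivity)
  have h0 (n : ℕ) (s : ℝ) (η : ℝ × ℝ) (hη : η ∉ tsupport (cutoff ((n : ℝ) + 1))) :
      ψ (s, η) * cutoff (n + 1) η = 0 := by
    rw [image_eq_zero_of_notMem_tsupport hη, mul_zero]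
  have hid (n : ℕ) := hf.weak_identity_of_compact H (hdiff n) (hcut n).2.1 (hcut n).2.2 (h0 n) ht
  have hslice (s : ℝ) (C : ℝ) (m : Measure (ℝ × ℝ)) (hm : MomentLe C m) :
      Tendsto (fun n : ℕ => ∫ η, ψ (s, η) * cutoff (n + 1) η ∂m) atTop
        (𝓝 (∫ η, ψ (s, η) ∂m)) :=
    hm.tendsto_integral_of_eventually_eq
      (fun n => ((contDiff_slice hψ.1 s).continuous.mul
        (contDiff_cutoff _).continuous).measurable)
      (fun n η => abs_mul_cutoff_le (hb (s, η)) _ η) fun η hη => by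
        filter_upwards [eventually_cutoff_nat_eq_one hη] with n hn
        simp [hn]
  have l1 := (hslice t _ _ (hf.momentLe t ht)).sub (hslice 0 _ _ H.momentLe)
  have l2 := hf.tendsto_coagulation_cutoff H hψ ht fun n =>
    hf.continuousOn_coagulation_slice H (hdiff n).continuous (hcut n).2.1 (hcut n).2.2 (h0 n)
  have l3 := hf.tendsto_fusion_cutoff H hψ ht fun n =>
    hf.continuousOn_fusion_slice H (hdiff n) (hcut n).2.1 (hcut n).2.2 (h0 n)
  have l4 := hf.tendsto_time_cutoff H hψ ht fun n =>
    hf.continuousOn_integral_slice H (continuous_deriv_time (hdiff n)) (hcut n).2.1 (hcut n).2.2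
      (fun s η hη => deriv_time_eq_zero (ψ := fun q => ψ q * cutoff (n + 1) q.2)
        (fun u => h0 n u η hη) s)
  exact tendsto_nhds_unique l1
    ((((l2.const_mul (1 / 2)).sub (l3.const_mul ε⁻¹)).add l4).congr fun n => (hid n).symm)

end IsLimitFlow

end GeneralTest

/-! ### The limit flow is a weak solution -/

section WeakSolution

variable {K : ℝ × ℝ → ℝ × ℝ → ℝ} {r : ℝ × ℝ → ℝ}
    {K₀ K₁ al be R₀ R₁ mu sg B ε : ℝ} {fin : Measure (ℝ × ℝ)} {W : ℝ} {f : ℝ → Measure (ℝ × ℝ)}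

lemma IsC0Quad.exists_bound {φ : ℝ × ℝ → ℝ} (hφ : IsC0Quad φ) : ∃ b, 0 ≤ b ∧ ∀ η, |φ η| ≤ b := by
  obtain ⟨S, hS, -, hb⟩ := hφ.2.2 1 one_pos
  obtain ⟨C, hC⟩ := hS.exists_bound_of_continuousOn hφ.1.continuousOn
  refine ⟨max C 1, by positivity, fun η => ?_⟩
  by_cases hη : η ∈ S
  · exact (hC η hη).trans (le_max_left _ _)
  · exact (hb η hη).trans (le_max_right _ _)

lemma IsC0Quad.exists_isCcQuad_approx {φ : ℝ × ℝ → ℝ} (hφ : IsC0Quad φ) {δ : ℝ} (hδ : 0 < δ) :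
    ∃ g, IsCcQuad g ∧ ∀ η, |φ η - g η| ≤ δ := by
  obtain ⟨S, hS, hSQ, hb⟩ := hφ.2.2 δ hδ
  obtain ⟨R, hR, hR0⟩ := ((eventually_cutoff_eq_one hS hSQ).and (eventually_gt_atTop 0)).exists
  refine ⟨fun η => cutoff R η * φ η, (isCcQuad_cutoff hR0).mul_continuousOn hφ.1.continuousOn,
    fun η => ?_⟩
  by_cases hη : η ∈ S
  · simp [hR η hη, hδ.le]
  · have e : φ η - cutoff R η * φ η = φ η * (1 - cutoff R η) := by ring
    have h0 := cutoff_le_one R η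
    have h1 := cutoff_nonneg R η
    rw [e, abs_mul, abs_of_nonneg (by linarith : 0 ≤ 1 - cutoff R η)]
    exact (mul_le_of_le_one_right (abs_nonneg _) (by linarith)).trans (hb η hη)

namespace IsLimitFlow

lemma continuousOn_integral (hf : IsLimitFlow K r ε fin K₀ W f)
    (H : Scheme K r K₀ K₁ al be R₀ R₁ mu sg B ε fin W 1) {φ : ℝ × ℝ → ℝ} (hφ : IsC0Quad φ) :
    ContinuousOn (fun t => ∫ η, φ η ∂(f t)) (Ici 0) := by
  obtain ⟨b, -, hb⟩ := hφ.exists_bound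
  exact fun t ht => (hf.vagueTendsto H ht).tendsto_of_approx (H.momentBound_nonneg (t + 1))
    (hf.eventually_momentLe H t) (hf.momentLe_of_le H ht (by linarith)) hφ.1 hb
    fun δ hδ => hφ.exists_isCcQuad_approx hδ

lemma integral_integral_kernel (hf : IsLimitFlow K r ε fin K₀ W f)
    (H : Scheme K r K₀ K₁ al be R₀ R₁ mu sg B ε fin W 1) {φ : ℝ × ℝ → ℝ} (hφ : Continuous φ)
    {b : ℝ} (hb : ∀ η, |φ η| ≤ b) {s : ℝ} (hs : 0 ≤ s) :
    ∫ η, ∫ η', K η η' * (φ (η + η') - φ η - φ η') ∂(f s) ∂(f s) =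
      ∫ q, extKernel K q * coagIncr φ q ∂((f s).prod (f s)) := by
  have hm := hf.momentLe s hs
  have := hm.isFiniteMeasure
  rw [integral_prod _ (H.coag.isDominatedKernel_ext.integrable_mul hm
    ⟨H.coag.al_mem.1.le, H.coag.al_mem.2.le⟩ ⟨H.coag.be_mem.1.le, H.coag.be_mem.2.le⟩
    (continuous_coagIncr hφ).measurable (abs_coagIncr_le hb))]
  refine integral_congr_ae (hm.ae_quad.mono fun η hη => integral_congr_ae
    (hm.ae_quad.mono fun η' hη' => ?_))
  simp only [extKernel_eq (K := K) (q := (η, η')) ⟨hη, hη'⟩, coagIncr]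

lemma isWeakSolution (hf : IsLimitFlow K r ε fin K₀ W f)
    (H : Scheme K r K₀ K₁ al be R₀ R₁ mu sg B ε fin W 1) :
    IsWeakSolution K r ε⁻¹ al be fin f := by
  refine ⟨fun t ht => (hf.momentLe t ht).iso, fun φ hφ => hf.continuousOn_integral H hφ,
    fun T hT => ⟨ENNReal.ofReal 4 * ENNReal.ofReal (momentBound K₀ W T),
      ENNReal.mul_ne_top ENNReal.ofReal_ne_top ENNReal.ofReal_ne_top, fun t ht => ?_⟩,
    fun ψ hψ t ht => ?_⟩
  · have hm := hf.momentLe_of_le H ht.1 ht.2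
    refine le_trans ?_ (mul_le_mul_right hm.lintegral_le _)
    rw [← lintegral_const_mul _ measurable_weight.ennreal_ofReal]
    refine lintegral_mono_ae (hm.ae_iso.mono fun η hη => ?_)
    rw [← ENNReal.ofReal_mul (by norm_num)]
    exact ENNReal.ofReal_le_ofReal (iso_coagWeight_le hη
      ⟨H.coag.al_mem.1.le, H.coag.al_mem.2.le⟩ ⟨H.coag.be_mem.1.le, H.coag.be_mem.2.le⟩)
  · obtain ⟨b, -, hb⟩ := hψ.exists_bound
    have h := hf.weak_identity H hψ ht
    have e1 : ∫ s in (0 : ℝ)..t, (1 / 2) *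
        ∫ η, ∫ η', K η η' * (ψ (s, η + η') - ψ (s, η) - ψ (s, η')) ∂(f s) ∂(f s) =
        1 / 2 * ∫ s in (0 : ℝ)..t,
          ∫ q, extKernel K q * coagIncr (fun η => ψ (s, η)) q ∂((f s).prod (f s)) := by
      rw [← intervalIntegral.integral_const_mul]
      refine intervalIntegral.integral_congr fun s hs => ?_
      rw [uIcc_of_le ht] at hs
      have := hf.integral_integral_kernel H (contDiff_slice hψ.1 s).continuous
        (fun η => hb (s, η)) hs.1
      simp only [this]
    have e2 : ∫ s in (0 : ℝ)..t,
          ∫ η, r η * (c0 * η.2 ^ ((2 : ℝ) / 3) - η.1) * da (fun p => ψ (s, p)) η ∂(f s) =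
        -∫ s in (0 : ℝ)..t, ∫ η, r η * excess η * da (fun p => ψ (s, p)) η ∂(f s) := by
      rw [← intervalIntegral.integral_neg]
      congr 1
      funext s
      rw [← integral_neg]
      congr 1
      funext η
      unfold excess
      ring
    rw [WeakIdentity, e1, e2]
    linarith

end IsLimitFlow

end WeakSolution

end

/-- existence of a weak solution of the ε-fusion coagulation problem with
a uniform-in-time bound on the (v⁻¹ + v² + a)-moment. -/
theorem existence_of_weak_solutions
    (K : ℝ × ℝ → ℝ × ℝ → ℝ) (K₀ K₁ al be : ℝ) (hK : IsCoagKernel K K₀ K₁ al be)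
    (r : ℝ × ℝ → ℝ) (R₀ R₁ mu sg B : ℝ) (hr : IsFusionKernel r R₀ R₁ mu sg B)
    (fin : Measure (ℝ × ℝ)) (hfin_iso : IsIsoMeasure fin)
    (hfin_mom : (∫⁻ η : ℝ × ℝ, ENNReal.ofReal
        (η.2 ^ (-1 : ℝ) + η.2 ^ (2 : ℝ) + η.1) ∂fin) ≠ ⊤)
    (T : ℝ) (hT : 0 < T) (ε : ℝ) (hε : ε ∈ Ioo (0 : ℝ) 1) :
    ∃ f : ℝ → Measure (ℝ × ℝ),
      IsWeakSolution K r ε⁻¹ al be fin f ∧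
      ∃ C : ℝ≥0∞, C ≠ ⊤ ∧ ∀ t ∈ Icc (0 : ℝ) T,
        (∫⁻ η : ℝ × ℝ, ENNReal.ofReal
          (η.2 ^ (-1 : ℝ) + η.2 ^ (2 : ℝ) + η.1) ∂(f t)) ≤ C := by
  set W := (∫⁻ η, ENNReal.ofReal (weight η) ∂fin).toReal
  have hfin : MomentLe W fin := ⟨hfin_iso, (ENNReal.ofReal_toReal hfin_mom).ge⟩
  have H : Scheme K r K₀ K₁ al be R₀ R₁ mu sg B ε fin W 1 :=
    ⟨hK, hr, hε, hfin, ENNReal.toReal_nonneg, le_rfl⟩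
  obtain ⟨f, hf⟩ := H.exists_limitFlow
  exact ⟨f, hf.isWeakSolution H, ENNReal.ofReal (momentBound K₀ W T), ENNReal.ofReal_ne_top,
    fun t ht => (hf.momentLe_of_le H ht.1 ht.2).lintegral_le⟩
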